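/- (Intermediate claim in the proof of Theorem A.) Let f ∈ ℂ[X,Y] be an irreducible polynomial whose zero set Z(f) ⊆ ℂ² is contractible in the Euclidean topology. Then the curve Z(f) has at most one singular point; i.e., the set of points p ∈ ℂ² at which f and both partial derivatives ∂f/∂X and ∂f/∂Y vanish simultaneously contains at most one element. -/

import Mathlib

section

open Topology Filter Polynomial Function.Periodic Asymptotics

/-- A discrete copy of `ℂ`, used as the fibre of a covering space. -/
@[ext] structure DiscreteComplex where
  val : ℂ

instance : TopologicalSpace DiscreteComplex := ⊥
instance : DiscreteTopology DiscreteComplex := ⟨rfl⟩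

/-- The covering space of germs of functions differing from the `f i` by local constants. -/
noncomputable def gluingCore {X : Type*} [TopologicalSpace X] (U : X → Set X)
    (hU : ∀ i, IsOpen (U i)) (hcov : ∀ x, x ∈ U x) (f : X → X → ℂ)
    (hf : ∀ i j, ∀ x ∈ U i, x ∈ U j → ∀ᶠ y in 𝓝 x, f i y - f j y = f i x - f j x) :
    FiberBundleCore X X DiscreteComplex where
  baseSet := U
  isOpen_baseSet := hU
  indexAt := id
  mem_baseSet_at := hcov
  coordChange i j x v := ⟨v.val + (f i x - f j x)⟩
  coordChange_self i x _ v := by simp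
  continuousOn_coordChange i j := by
    rintro ⟨x, v⟩ ⟨⟨hi, hj⟩, -⟩
    refine ContinuousAt.continuousWithinAt ?_
    refine continuousAt_const (y := (⟨v.val + (f i x - f j x)⟩ : DiscreteComplex)).congr ?_
    have h1 : ∀ᶠ p : X × DiscreteComplex in 𝓝 (x, v), f i p.1 - f j p.1 = f i x - f j x :=
      (continuous_fst.tendsto (x, v)).eventually (hf i j x hi hj)
    have h2 : ∀ᶠ p : X × DiscreteComplex in 𝓝 (x, v), p.2 = v :=
      continuousAt_snd.eventually (p := fun w => w = v) (by simp [nhds_discrete])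
    filter_upwards [h1, h2] with p hp hv
    rw [hp, hv]
  coordChange_comp i j k x _ v := by
    ext
    simp only
    ring

theorem exists_glued_primitive {X : Type*} [TopologicalSpace X] [ContractibleSpace X]
    (U : X → Set X)
    (hU : ∀ i, IsOpen (U i)) (hcov : ∀ x, x ∈ U x) (f : X → X → ℂ)
    (hf : ∀ i j, ∀ x ∈ U i, x ∈ U j → ∀ᶠ y in 𝓝 x, f i y - f j y = f i x - f j x) :
    ∃ F : X → ℂ, ∀ i, ∀ x ∈ U i, ∀ᶠ y in 𝓝 x, F y - f i y = F x - f i x := by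
  set Z := gluingCore U hU hcov f hf with hZ
  have cov : IsCoveringMap Z.proj := FiberBundle.isCoveringMap (F := DiscreteComplex) (E := Z.Fiber)
  obtain ⟨x₀, ⟨H⟩⟩ := id_nullhomotopic X
  let H' : C(unitInterval × X, X) := H.symm.toContinuousMap
  have H0 : ∀ x, H' (0, x) = x₀ := fun x => by
    change H.symm (0, x) = x₀
    simp
  have H1 : ∀ x, H' (1, x) = x := fun x => by
    change H.symm (1, x) = x
    simp
  let e₀ : Z.TotalSpace := ⟨x₀, (⟨0⟩ : DiscreteComplex)⟩
  let L := cov.liftHomotopy H' (ContinuousMap.const X e₀) (by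
    intro x; rw [H0]; rfl)
  have hL : ∀ p, Z.proj (L p) = H' p := fun p => congrFun (cov.liftHomotopy_lifts H' _ _) p
  let s : X → Z.TotalSpace := fun x => L (1, x)
  have hs : Continuous s := by fun_prop
  have hproj : ∀ x, (s x).1 = x := fun x => (hL (1, x)).trans (H1 x)
  let v : X → DiscreteComplex := fun x => (s x).2
  refine ⟨fun x => (v x).val + f x x, fun i x hx => ?_⟩
  have h3 : ∀ y, (Z.localTriv i (s y)).2 = ⟨(v y).val + (f y y - f i y)⟩ := by
    intro y
    rw [Z.localTriv_apply]
    change (⟨(v y).val + (f (s y).1 (s y).1 - f i (s y).1)⟩ : DiscreteComplex) = _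
    rw [hproj y]
  have h4 : ContinuousAt (fun y => (Z.localTriv i (s y)).2) x := by
    have : ContinuousAt (Z.localTriv i) (s x) := by
      refine (Z.localTriv i).continuousAt ?_
      rw [Z.mem_localTriv_source, hproj]
      exact hx
    exact continuousAt_snd.comp (this.comp hs.continuousAt)
  have h5 := h4.eventually (p := fun v => v = (Z.localTriv i (s x)).2) (by simp [nhds_discrete])
  filter_upwards [h5] with y hy
  rw [h3, h3, DiscreteComplex.mk.injEq] at hy
  linear_combination hy

theorem contDiff_polynomial_eval (p : ℂ[X]) {n : WithTop ℕ∞} :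
    ContDiff ℂ n fun x : ℂ => p.eval x := by
  have : (fun x : ℂ => p.eval x) = fun x => aeval x p := by
    ext x
    rw [coe_aeval_eq_eval]
  rw [this]
  exact p.contDiff_aeval n

theorem evalEval_eq_sum (P : ℂ[X][X]) (x y : ℂ) :
    P.evalEval x y = ∑ n ∈ Finset.range (P.natDegree + 1), (P.coeff n).eval x * y ^ n := by
  rw [← map_evalRingHom_eval, eval_map, eval₂_eq_sum_range]
  simp

theorem contDiff_evalEval (P : ℂ[X][X]) {n : WithTop ℕ∞} :
    ContDiff ℂ n (fun p : ℂ × ℂ => P.evalEval p.1 p.2) := by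
  simp_rw [evalEval_eq_sum]
  refine ContDiff.sum fun i _ => ?_
  exact ((contDiff_polynomial_eval _).comp contDiff_fst).mul (contDiff_snd.pow i)

theorem continuous_evalEval (P : ℂ[X][X]) : Continuous (fun p : ℂ × ℂ => P.evalEval p.1 p.2) :=
  (contDiff_evalEval P (n := 0)).continuous

theorem hasDerivAt_evalEval_right (P : ℂ[X][X]) (x y : ℂ) :
    HasDerivAt (fun y => P.evalEval x y) (P.derivative.evalEval x y) y := by
  have := (P.map (evalRingHom x)).hasDerivAt y
  simpa only [derivative_map, map_evalRingHom_eval] using this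

theorem hasStrictFDerivAt_evalEval (P : ℂ[X][X]) (u : ℂ × ℂ) :
    HasStrictFDerivAt (fun p : ℂ × ℂ => P.evalEval p.1 p.2)
      (fderiv ℂ (fun p : ℂ × ℂ => P.evalEval p.1 p.2) u) u :=
  (contDiff_evalEval P (n := 1)).contDiffAt.hasStrictFDerivAt one_ne_zero

/-- Chain rule for `P(x(t), y(t))`. -/
theorem hasDerivAt_evalEval_comp (P : ℂ[X][X]) {f g : ℂ → ℂ} {f' g' t : ℂ}
    (hf : HasDerivAt f f' t) (hg : HasDerivAt g g' t) :
    HasDerivAt (fun t => P.evalEval (f t) (g t))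
      (deriv (fun x => P.evalEval x (g t)) (f t) * f' + P.derivative.evalEval (f t) (g t) * g') t := by
  set L := fderiv ℂ (fun p : ℂ × ℂ => P.evalEval p.1 p.2) (f t, g t) with hL
  have hP : HasFDerivAt (fun p : ℂ × ℂ => P.evalEval p.1 p.2) L (f t, g t) :=
    (hasStrictFDerivAt_evalEval P _).hasFDerivAt
  have h1 : HasDerivAt (fun x => P.evalEval x (g t)) (L (1, 0)) (f t) :=
    hP.comp_hasDerivAt (f t) (f := fun x => (x, g t))
      ((hasDerivAt_id _).prodMk (hasDerivAt_const _ _))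
  have h2 : HasDerivAt (fun y => P.evalEval (f t) y) (L (0, 1)) (g t) :=
    hP.comp_hasDerivAt (g t) (f := fun y => (f t, y))
      ((hasDerivAt_const _ _).prodMk (hasDerivAt_id _))
  have h3 : HasDerivAt (fun t => P.evalEval (f t) (g t)) (L (f', g')) t :=
    hP.comp_hasDerivAt t (f := fun t => (f t, g t)) (hf.prodMk hg)
  rw [h1.deriv, (hasDerivAt_evalEval_right P _ _).unique h2]
  convert h3 using 1
  have : ((f', g') : ℂ × ℂ) = f' • (1, 0) + g' • (0, 1) := by simp
  rw [this, map_add, map_smul, map_smul, smul_eq_mul, smul_eq_mul]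
  ring

theorem exists_implicit_root (P : ℂ[X][X]) {x y : ℂ} (h0 : P.evalEval x y = 0)
    (h1 : P.derivative.evalEval x y ≠ 0) :
    ∃ φ : ℂ → ℂ, φ x = y ∧ (∀ᶠ t in 𝓝 x, DifferentiableAt ℂ φ t ∧ P.evalEval t (φ t) = 0) ∧
      ∀ᶠ p : ℂ × ℂ in 𝓝 (x, y), P.evalEval p.1 p.2 = 0 → φ p.1 = p.2 := by
  have cd : ContDiffAt ℂ 1 (fun p : ℂ × ℂ => P.evalEval p.1 p.2) (x, y) :=
    (contDiff_evalEval P).contDiffAt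
  have df := hasStrictFDerivAt_evalEval P (x, y)
  set L := fderiv ℂ (fun p : ℂ × ℂ => P.evalEval p.1 p.2) (x, y) with hL
  have h2 : HasDerivAt (fun y => P.evalEval x y) (L (0, 1)) y :=
    df.hasFDerivAt.comp_hasDerivAt y (f := fun y => (x, y))
      ((hasDerivAt_const _ _).prodMk (hasDerivAt_id _))
  have h3 : L (0, 1) = P.derivative.evalEval x y :=
    h2.unique (hasDerivAt_evalEval_right P _ _)
  have inv : (L ∘L .inr ℂ ℂ ℂ).IsInvertible := by
    refine ⟨ContinuousLinearEquiv.unitsEquivAut ℂ (Units.mk0 _ h1), ?_⟩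
    ext
    simp [h3]
  refine ⟨cd.implicitFunction one_ne_zero inv, cd.implicitFunction_apply_self one_ne_zero inv, ?_⟩
  refine ⟨Filter.Eventually.and ?_ ?_, ?_⟩
  · exact ((cd.contDiffAt_implicitFunction one_ne_zero inv).eventually (by simp)).mono
      fun t ht => ht.differentiableAt one_ne_zero
  · simpa [h0] using cd.eventually_apply_implicitFunction one_ne_zero inv
  · filter_upwards [cd.eventually_apply_eq_iff_implicitFunction one_ne_zero inv] with p hp h
    exact hp.mp (h.trans h0.symm)

/-- An irreducible polynomial, monic in the second variable, together with a Bézout identity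
between it and its derivative. -/
structure PlaneCurve where
  P : ℂ[X][X]
  monic : P.Monic
  irr : Irreducible P
  d : ℂ[X]
  d_ne : d ≠ 0
  a : ℂ[X][X]
  b : ℂ[X][X]
  bezout : a * P + b * P.derivative = C d

namespace PlaneCurve

variable (K : PlaneCurve)

/-- The degree of the projection to the first coordinate. -/
noncomputable def N : ℕ := K.P.natDegree

/-- The fibre polynomial. -/
noncomputable def fib (x : ℂ) : ℂ[X] := K.P.map (evalRingHom x)

/-- Regular values of the projection. -/
def Reg : Set ℂ := {x | K.d.eval x ≠ 0}

theorem isOpen_Reg : IsOpen K.Reg := K.d.continuous.isOpen_preimage _ isOpen_ne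

theorem fib_eval (x y : ℂ) : (K.fib x).eval y = K.P.evalEval x y := map_evalRingHom_eval ..

theorem fib_monic (x : ℂ) : (K.fib x).Monic := K.monic.map _

theorem fib_natDegree (x : ℂ) : (K.fib x).natDegree = K.N := K.monic.natDegree_map _

theorem bezout_eval {x y : ℂ} (h : K.P.evalEval x y = 0) :
    K.b.evalEval x y * K.P.derivative.evalEval x y = K.d.eval x := by
  have := congrArg (evalEval x y) K.bezout
  simpa [h, evalEval_C] using this

theorem derivative_ne {x y : ℂ} (hx : x ∈ K.Reg) (h : K.P.evalEval x y = 0) :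
    K.P.derivative.evalEval x y ≠ 0 := fun h0 => hx (by rw [← K.bezout_eval h, h0, mul_zero])

/-- `y` enumerates the points of the curve over `x`. -/
def Enum (x : ℂ) (y : Fin K.N → ℂ) : Prop := K.fib x = ∏ i, (X - C (y i))

variable {K}

theorem Enum.evalEval_eq {x : ℂ} {y : Fin K.N → ℂ} (h : K.Enum x y) (t : ℂ) :
    K.P.evalEval x t = ∏ i, (t - y i) := by
  rw [← K.fib_eval, h]
  simp [eval_prod]

theorem Enum.root {x : ℂ} {y : Fin K.N → ℂ} (h : K.Enum x y) (i) : K.P.evalEval x (y i) = 0 := by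
  rw [h.evalEval_eq]
  exact Finset.prod_eq_zero (Finset.mem_univ i) (sub_self _)

theorem Enum.exists_eq {x t : ℂ} {y : Fin K.N → ℂ} (h : K.Enum x y) (ht : K.P.evalEval x t = 0) :
    ∃ i, y i = t := by
  rw [h.evalEval_eq, Finset.prod_eq_zero_iff] at ht
  obtain ⟨i, -, hi⟩ := ht
  exact ⟨i, (sub_eq_zero.mp hi).symm⟩

theorem Enum.derivative_eval {x : ℂ} {y : Fin K.N → ℂ} (h : K.Enum x y) (i) :
    K.P.derivative.evalEval x (y i) = ∏ j ∈ Finset.univ.erase i, (y i - y j) := by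
  have h1 : K.P.derivative.evalEval x (y i) = (K.fib x).derivative.eval (y i) := by
    rw [fib, derivative_map, map_evalRingHom_eval]
  rw [h1, h, derivative_prod_finset, eval_finsetSum, Finset.sum_eq_single i]
  · simp [eval_prod]
  · intro j _ hj
    rw [derivative_sub, derivative_X, derivative_C, sub_zero, mul_one, eval_prod]
    exact Finset.prod_eq_zero (i := i) (by simp [hj.symm]) (by simp)
  · simp

theorem Enum.injective {x : ℂ} {y : Fin K.N → ℂ} (h : K.Enum x y) (hx : x ∈ K.Reg) :
    Function.Injective y := by
  intro i j hij
  by_contra hne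
  refine K.derivative_ne hx (h.root i) ?_
  rw [h.derivative_eval]
  exact Finset.prod_eq_zero (i := j) (by simp [Ne.symm hne]) (by simp [hij])

theorem enum_of_injective {x : ℂ} {y : Fin K.N → ℂ} (hy : Function.Injective y)
    (h : ∀ i, K.P.evalEval x (y i) = 0) : K.Enum x y := by
  have h1 : (∏ i, (X - C (y i))) ∣ K.fib x := by
    refine Finset.prod_dvd_of_coprime (fun i _ j _ hij => ?_) fun i _ => ?_
    · exact isCoprime_X_sub_C_of_isUnit_sub (sub_ne_zero.mpr (hy.ne hij)).isUnit
    · rw [dvd_iff_isRoot, IsRoot, fib_eval, h]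
  refine (eq_of_monic_of_dvd_of_natDegree_le (monic_prod_X_sub_C _ _) (K.fib_monic x) h1 ?_)
  rw [fib_natDegree, natDegree_prod_of_monic _ _ fun i _ => monic_X_sub_C _]
  simp

theorem exists_enum (x : ℂ) : ∃ y : Fin K.N → ℂ, K.Enum x y := by
  have h := (IsAlgClosed.splits (K.fib x)).eq_prod_roots_of_monic (K.fib_monic x)
  have hc : (K.fib x).roots.card = K.N := by
    rw [← K.fib_natDegree x, (IsAlgClosed.splits (K.fib x)).natDegree_eq_card_roots]
  obtain ⟨l, hl⟩ := Quot.exists_rep (K.fib x).roots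
  have hl' : (l : Multiset ℂ) = (K.fib x).roots := hl
  have hlen : l.length = K.N := by rw [← hc, ← hl']; rfl
  refine ⟨fun i => l.get (i.cast hlen.symm), ?_⟩
  rw [Enum, h, ← hl', Multiset.map_coe, Multiset.prod_coe]
  rw [← List.prod_ofFn]
  congr 1
  apply List.ext_get
  · simp [hlen]
  · intro n h1 h2
    simp

theorem exists_local_enum {x₀ : ℂ} (hx : x₀ ∈ K.Reg) :
    ∃ r > 0, ∃ Y : Fin K.N → ℂ → ℂ, Metric.ball x₀ r ⊆ K.Reg ∧
      (∀ i, DifferentiableOn ℂ (Y i) (Metric.ball x₀ r)) ∧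
      ∀ x ∈ Metric.ball x₀ r, K.Enum x (fun i => Y i x) := by
  obtain ⟨y, hy⟩ := K.exists_enum x₀
  choose Y hY0 hY _ using fun i => exists_implicit_root K.P (hy.root i)
    (K.derivative_ne hx (hy.root i))
  have hc : ∀ i, ContinuousAt (Y i) x₀ := fun i => (hY i).self_of_nhds.1.continuousAt
  have hinj : ∀ᶠ x in 𝓝 x₀, Function.Injective fun i => Y i x := by
    have : ∀ᶠ x in 𝓝 x₀, ∀ i j, i ≠ j → Y i x ≠ Y j x := by
      refine eventually_all.mpr fun i => eventually_all.mpr fun j => ?_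
      by_cases hij : i = j
      · simp [hij]
      · refine ((hc i).ne_iff_eventually_ne (hc j)).mp ?_ |>.mono fun x hx _ => hx
        rw [hY0, hY0]
        exact (hy.injective hx).ne hij
    filter_upwards [this] with x hx i j hij
    by_contra hne
    exact hx i j hne hij
  have hall := ((eventually_all.mpr hY).and hinj).and (K.isOpen_Reg.mem_nhds hx)
  obtain ⟨r, hr, hball⟩ := Metric.eventually_nhds_iff_ball.mp hall
  refine ⟨r, hr, Y, fun x hx => (hball x hx).2, fun i x hx =>
    ((hball x hx).1.1 i).1.differentiableWithinAt, fun x hx => ?_⟩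
  exact enum_of_injective (hball x hx).1.2 fun i => ((hball x hx).1.1 i).2

end PlaneCurve

open PlaneCurve

namespace PlaneCurve
variable (K : PlaneCurve)

/-- The affine curve. -/
abbrev Pt := {p : ℂ × ℂ // K.P.evalEval p.1 p.2 = 0}

theorem isCoveringMapOn_fst : IsCoveringMapOn (fun p : K.Pt => p.1.1) K.Reg := by
  intro x₀ hx₀
  obtain ⟨r, hr, Y, hreg, hd, hY⟩ := exists_local_enum hx₀
  have hx₀b := Metric.mem_ball_self (x := x₀) hr
  set V := Metric.ball x₀ r with hV
  by_cases hN : IsEmpty (Fin K.N)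
  · have : IsEmpty K.Pt := ⟨fun p => by
      obtain ⟨y, hy⟩ := K.exists_enum p.1.1
      obtain ⟨i, -⟩ := hy.exists_eq p.2
      exact hN.elim i⟩
    exact IsCoveringMapOn.of_isEmpty _ K.Reg x₀ hx₀
  have hN' : Nonempty (Fin K.N) := not_isEmpty_iff.mp hN
  have : Nonempty (ℂ → K.Pt) := ⟨fun _ => ⟨(x₀, Y hN'.some x₀), (hY x₀ hx₀b).root _⟩⟩
  let U : Fin K.N → Set K.Pt := fun i => {p | p.1.1 ∈ V ∧ p.1.2 = Y i p.1.1}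
  have hVo : IsOpen {p : K.Pt | p.1.1 ∈ V} := Metric.isOpen_ball.preimage (by fun_prop)
  have hcont : ∀ i, ContinuousOn (fun p : K.Pt => Y i p.1.1) {p | p.1.1 ∈ V} := fun i =>
    (hd i).continuousOn.comp (by fun_prop) fun p hp => hp
  have hU : ∀ i, IsOpen (U i) := by
    intro i
    have h1 : U i = {p | p.1.1 ∈ V} ∩ ⋂ j ∈ {j | j ≠ i}, ({p : K.Pt | p.1.1 ∈ V} ∩
        {p | p.1.2 - Y j p.1.1 ∈ ({0} : Set ℂ)ᶜ}) := by
      ext p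
      simp only [U, Set.mem_ofPred_eq, Set.mem_inter_iff, Set.mem_iInter, Set.mem_compl_iff,
        Set.mem_singleton_iff, sub_eq_zero]
      constructor
      · rintro ⟨h1, h2⟩
        exact ⟨h1, fun j hj => ⟨h1, fun h3 => hj (((hY _ h1).injective (hreg h1)) (h3.symm.trans h2))⟩⟩
      · rintro ⟨h1, h2⟩
        obtain ⟨j, hj⟩ := (hY _ h1).exists_eq p.2
        by_cases hji : j = i
        · exact ⟨h1, by rw [← hji, hj]⟩
        · exact absurd hj.symm (h2 j hji).2
    rw [h1]
    refine hVo.inter ((Set.toFinite _).isOpen_biInter fun j _ => ?_)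
    exact (ContinuousOn.sub (by fun_prop) (hcont j)).isOpen_inter_preimage hVo
      isOpen_compl_singleton
  refine IsEvenlyCovered.to_isEvenlyCovered_preimage
    (IsEvenlyCovered.of_trivialization (I := Fin K.N) (t :=
      IsOpen.trivializationDiscrete (f := fun p : K.Pt => p.1.1) U V Metric.isOpen_ball ?_ ?_ ?_ ?_ ?_) ?_)
  · intro i W hW
    constructor
    · exact fun h => (h.preimage (by fun_prop)).inter (hU i)
    · intro h
      let s : V → K.Pt := fun x => ⟨(x.1, Y i x.1), (hY x.1 x.2).root i⟩
      have hs : Continuous s := by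
        refine Continuous.subtype_mk (Continuous.prodMk continuous_subtype_val ?_) _
        exact continuousOn_iff_continuous_domRestrict.mp (hd i).continuousOn
      have h2 := h.preimage hs
      have h3 : Subtype.val '' (s ⁻¹' ((fun p : K.Pt => p.1.1) ⁻¹' W ∩ U i)) = W := by
        ext x
        constructor
        · rintro ⟨x', hx', rfl⟩
          exact hx'.1
        · intro hx
          exact ⟨⟨x, hW hx⟩, ⟨hx, hW hx, rfl⟩, rfl⟩
      rw [← h3]
      exact Metric.isOpen_ball.isOpenMap_subtype_val _ h2
  · rintro i p ⟨hp, hp'⟩ q ⟨hq, hq'⟩ hpq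
    simp only at hpq
    exact Subtype.ext (Prod.ext hpq (by rw [hp', hq', hpq]))
  · intro i x hx
    exact ⟨⟨(x, Y i x), (hY x hx).root i⟩, ⟨hx, rfl⟩, rfl⟩
  · intro i j hij
    refine Set.disjoint_left.mpr ?_
    rintro p ⟨hp, hp'⟩ ⟨hq, hq'⟩
    exact hij ((hY _ hp).injective (hreg hp) (hp'.symm.trans hq'))
  · intro p hp
    obtain ⟨i, hi⟩ := (hY _ hp).exists_eq p.2
    exact Set.mem_iUnion.mpr ⟨i, hp, hi.symm⟩
  · exact hx₀b

variable {K}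

theorem differentiableAt_section {ψ Y : ℂ → ℂ} {t : ℂ} (hψ : DifferentiableAt ℂ ψ t)
    (hY : ContinuousAt Y t) (hreg : ψ t ∈ K.Reg) (h : ∀ᶠ s in 𝓝 t, K.P.evalEval (ψ s) (Y s) = 0) :
    DifferentiableAt ℂ Y t := by
  have h0 := h.self_of_nhds
  obtain ⟨φ, hφ, hφ1, hφ2⟩ := exists_implicit_root K.P h0 (K.derivative_ne hreg h0)
  have h1 : Tendsto (fun s => (ψ s, Y s)) (𝓝 t) (𝓝 (ψ t, Y t)) :=
    hψ.continuousAt.prodMk hY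
  have h2 : Y =ᶠ[𝓝 t] φ ∘ ψ := by
    filter_upwards [h1.eventually hφ2, h] with s hs hs'
    exact (hs hs').symm
  exact (hφ1.self_of_nhds.1.comp t hψ).congr_of_eventuallyEq h2

/-- The upper half plane `Im z > A`. -/
def upperPlane (A : ℝ) : Set ℂ := {z | A < z.im}

theorem isOpen_upper (A : ℝ) : IsOpen (upperPlane A) := isOpen_lt continuous_const Complex.continuous_im

theorem convex_upper (A : ℝ) : Convex ℝ (upperPlane A) := convex_halfSpace_im_gt A

theorem nonempty_upper (A : ℝ) : (upperPlane A).Nonempty :=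
  ⟨⟨0, A + 1⟩, by simp [upperPlane]⟩

theorem add_one_mem_upper {A : ℝ} {z : ℂ} (hz : z ∈ upperPlane A) : z + 1 ∈ upperPlane A := by
  simpa [upperPlane] using hz

instance (A : ℝ) : ContractibleSpace (upperPlane A) :=
  (convex_upper A).contractibleSpace (nonempty_upper A)

instance (A : ℝ) : LocallyPathConnectedSpace (upperPlane A) := (isOpen_upper A).locallyPathConnectedSpace

theorem _root_.IsPreconnected.of_eventually_iff {α : Type*} [TopologicalSpace α] {S : Set α}
    (hS : IsPreconnected S) (hSo : IsOpen S) {p : α → Prop}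
    (h : ∀ x ∈ S, ∀ᶠ y in 𝓝 x, (p y ↔ p x)) {x y : α} (hx : x ∈ S) (hy : y ∈ S) (hp : p x) :
    p y := by
  have hu : IsOpen {x | x ∈ S ∧ p x} := isOpen_iff_mem_nhds.mpr fun z hz => by
    filter_upwards [hSo.mem_nhds hz.1, h z hz.1] with w h1 h2
    exact ⟨h1, h2.mpr hz.2⟩
  have hv : IsOpen {x | x ∈ S ∧ ¬ p x} := isOpen_iff_mem_nhds.mpr fun z hz => by
    filter_upwards [hSo.mem_nhds hz.1, h z hz.1] with w h1 h2
    exact ⟨h1, fun h3 => hz.2 (h2.mp h3)⟩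
  have := hS.subset_left_of_subset_union hu hv
    (Set.disjoint_left.mpr fun z h1 h2 => h2.2 h1.2)
    (fun z hz => (em (p z)).imp (fun h => ⟨hz, h⟩) fun h => ⟨hz, h⟩) ⟨x, hx, hx, hp⟩
  exact (this hy).2

theorem section_unique {S : Set ℂ} (hS : IsPreconnected S) (hSo : IsOpen S) {X Y Y' : ℂ → ℂ}
    (hX : ContinuousOn X S) (hreg : ∀ z ∈ S, X z ∈ K.Reg)
    (hY : ContinuousOn Y S) (hY0 : ∀ z ∈ S, K.P.evalEval (X z) (Y z) = 0)
    (hY' : ContinuousOn Y' S) (hY0' : ∀ z ∈ S, K.P.evalEval (X z) (Y' z) = 0)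
    {z₀ : ℂ} (hz₀ : z₀ ∈ S) (h : Y z₀ = Y' z₀) : ∀ z ∈ S, Y z = Y' z := by
  intro z hz
  refine hS.of_eventually_iff hSo (p := fun z => Y z = Y' z) (fun t ht => ?_) hz₀ hz h
  have hn := hSo.mem_nhds ht
  have cX := hX.continuousAt hn
  have cY := hY.continuousAt hn
  have cY' := hY'.continuousAt hn
  by_cases heq : Y t = Y' t
  · obtain ⟨φ, hφ, hφ1, hφ2⟩ := exists_implicit_root K.P (hY0 t ht)
      (K.derivative_ne (hreg t ht) (hY0 t ht))
    have t1 : Tendsto (fun s => (X s, Y s)) (𝓝 t) (𝓝 (X t, Y t)) := cX.prodMk cY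
    have t2 : Tendsto (fun s => (X s, Y' s)) (𝓝 t) (𝓝 (X t, Y t)) := by
      rw [heq]; exact cX.prodMk cY'
    filter_upwards [t1.eventually hφ2, t2.eventually hφ2, hn] with s h1 h2 hs
    simp only [heq, iff_true]
    rw [← h1 (hY0 s hs), ← h2 (hY0' s hs)]
  · filter_upwards [(cY.ne_iff_eventually_ne cY').mp heq] with s hs
    simp [heq, hs]

/-- The curve over a simply connected end of the line splits into sections permuted by the
deck transformation. -/
theorem exists_end {A : ℝ} {X : ℂ → ℂ} (hX : DifferentiableOn ℂ X (upperPlane A))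
    (hreg : ∀ z ∈ upperPlane A, X z ∈ K.Reg) (hper : ∀ z ∈ upperPlane A, X (z + 1) = X z) :
    ∃ (Y : Fin K.N → ℂ → ℂ) (σ : Equiv.Perm (Fin K.N)),
      (∀ i, DifferentiableOn ℂ (Y i) (upperPlane A)) ∧
      (∀ z ∈ upperPlane A, K.Enum (X z) fun i => Y i z) ∧
      ∀ i, ∀ z ∈ upperPlane A, Y i (z + 1) = Y (σ i) z := by
  obtain ⟨z₀, hz₀⟩ := nonempty_upper A
  obtain ⟨y, hy⟩ := K.exists_enum (X z₀)
  have hpc : IsPreconnected (upperPlane A) := (convex_upper A).isPreconnected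
  have hop := isOpen_upper A
  have key : ∀ t, K.P.evalEval (X z₀) t = 0 → ∃ Y : ℂ → ℂ, Y z₀ = t ∧ ContinuousOn Y (upperPlane A) ∧
      ∀ z ∈ upperPlane A, K.P.evalEval (X z) (Y z) = 0 := by
    intro t ht
    obtain ⟨F, ⟨hF1, hF2⟩, -⟩ := K.isCoveringMapOn_fst.existsUnique_continuousMap_lifts
      (A := upperPlane A) (f := ⟨fun z => X z, continuousOn_iff_continuous_domRestrict.mp hX.continuousOn⟩)
      (a₀ := ⟨z₀, hz₀⟩) (e₀ := ⟨(X z₀, t), ht⟩) rfl (fun z => hreg z z.2)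
    have hF3 : ∀ z : upperPlane A, (F z).1.1 = X z := fun z => congrFun hF2 z
    classical
    refine ⟨fun z => if h : z ∈ upperPlane A then (F ⟨z, h⟩).1.2 else 0, ?_, ?_, ?_⟩
    · simp [hz₀, hF1]
    · rw [continuousOn_iff_continuous_domRestrict]
      have : Continuous fun z : upperPlane A => (F z).1.2 := by fun_prop
      convert this using 2 with z
      simp [Set.domRestrict]
    · intro z hz
      simp only [hz, dite_true]
      rw [← hF3 ⟨z, hz⟩]
      exact (F ⟨z, hz⟩).2
  choose Y hY0 hYc hYr using fun i => key (y i) (hy.root i)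
  have hinj : ∀ z ∈ upperPlane A, Function.Injective fun i => Y i z := by
    intro z hz i j hij
    have := section_unique hpc hop hX.continuousOn hreg (hYc i) (hYr i) (hYc j) (hYr j) hz hij z₀ hz₀
    rw [hY0, hY0] at this
    exact hy.injective (hreg z₀ hz₀) this
  have hE : ∀ z ∈ upperPlane A, K.Enum (X z) fun i => Y i z := fun z hz =>
    enum_of_injective (hinj z hz) fun i => hYr i z hz
  have hs : ∀ i, ∃ j, Y j z₀ = Y i (z₀ + 1) := fun i =>
    (hE z₀ hz₀).exists_eq (by rw [← hper z₀ hz₀]; exact hYr i _ (add_one_mem_upper hz₀))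
  choose σ hσ using hs
  have hsh : ∀ i, ∀ z ∈ upperPlane A, Y i (z + 1) = Y (σ i) z := by
    intro i
    refine section_unique hpc hop hX.continuousOn hreg (Y := fun z => Y i (z + 1)) ?_ ?_
      (hYc _) (hYr _) hz₀ (hσ i).symm
    · exact (hYc i).comp (by fun_prop) fun z hz => add_one_mem_upper hz
    · intro z hz
      rw [← hper z hz]
      exact hYr i _ (add_one_mem_upper hz)
  have hσi : Function.Injective σ := by
    intro i j hij
    refine hinj (z₀ + 1) (add_one_mem_upper hz₀) ?_
    simp only [hsh _ z₀ hz₀, hij]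
  refine ⟨Y, Equiv.ofBijective σ (Finite.injective_iff_bijective.mp hσi), fun i z hz => ?_, hE, hsh⟩
  refine (differentiableAt_section (K := K) (ψ := X) (hX.differentiableAt (hop.mem_nhds hz))
    ((hYc i).continuousAt (hop.mem_nhds hz)) (hreg z hz) ?_).differentiableWithinAt
  filter_upwards [hop.mem_nhds hz] with s hs using hYr i s hs

end PlaneCurve

theorem exists_analyticAt_extension {f : ℂ → ℂ} {c : ℂ}
    (hd : ∀ᶠ z in 𝓝[≠] c, DifferentiableAt ℂ f z) {M : ℝ} (hb : ∀ᶠ z in 𝓝[≠] c, ‖f z‖ ≤ M) :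
    ∃ l, Tendsto f (𝓝[≠] c) (𝓝 l) ∧ AnalyticAt ℂ (Function.update f c l) c := by
  have h1 := Complex.tendsto_limUnder_of_differentiable_on_punctured_nhds_of_bounded_under hd
    ⟨M + ‖f c‖, eventually_map.mpr (hb.mono fun z hz => norm_sub_le_of_le hz le_rfl)⟩
  refine ⟨_, h1, Complex.analyticAt_of_differentiable_on_punctured_nhds_of_continuousAt ?_ ?_⟩
  · filter_upwards [hd, self_mem_nhdsWithin] with z hz hne
    refine hz.congr_of_eventuallyEq ?_
    filter_upwards [isOpen_ne.mem_nhds hne] with w hw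
    rw [Function.update_of_ne hw]
  · exact continuousAt_update_same.mpr h1

theorem Polynomial.eventually_eval_ne {d : ℂ[X]} (hd : d ≠ 0) (b : ℂ) :
    ∀ᶠ x in 𝓝[≠] b, d.eval x ≠ 0 := by
  have h : ((d.rootSet ℂ) \ {b} : Set ℂ).Finite := (d.rootSet_finite ℂ).sdiff
  filter_upwards [self_mem_nhdsWithin, nhdsWithin_le_nhds (h.isClosed.isOpen_compl.mem_nhds
    (show b ∈ _ by simp))] with x hx hx' h0
  exact hx' ⟨by rw [mem_rootSet]; exact ⟨hd, by simpa using h0⟩, hx⟩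

theorem Polynomial.eventually_cobounded_eval_ne {d : ℂ[X]} (hd : d ≠ 0) :
    ∀ᶠ x in Bornology.cobounded ℂ, d.eval x ≠ 0 := by
  have h : (d.rootSet ℂ).Finite := d.rootSet_finite ℂ
  filter_upwards [Bornology.isBounded_def.mp h.isBounded] with x hx h0
  exact hx (by rw [mem_rootSet]; exact ⟨hd, by simpa using h0⟩)

theorem exists_polynomial_of_entire {s : ℕ} {F : ℂ → ℂ} (hF : Differentiable ℂ F) {C : ℝ}
    (hg : ∀ᶠ x in Bornology.cobounded ℂ, ‖F x‖ ≤ C * ‖x‖ ^ s) :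
    ∃ q : ℂ[X], q.natDegree ≤ s ∧ ∀ x, F x = q.eval x := by
  induction s generalizing F C with
  | zero =>
    have hbd : Bornology.IsBounded (Set.range F) := by
      obtain ⟨R, hR⟩ := (hasBasis_cobounded_norm.eventually_iff.mp hg)
      obtain ⟨C', hC'⟩ := (isCompact_closedBall (0 : ℂ) R).exists_bound_of_continuousOn
        hF.continuous.continuousOn
      refine isBounded_iff_forall_norm_le.mpr ⟨max C C', ?_⟩
      rintro _ ⟨x, rfl⟩
      by_cases hx : R ≤ ‖x‖
      · exact le_max_of_le_left (by simpa using hR.2 hx)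
      · exact le_max_of_le_right (hC' x (by simpa using (not_le.mp hx).le))
    obtain ⟨c, hc⟩ := hF.exists_const_forall_eq_of_bounded hbd
    exact ⟨Polynomial.C c, by simp, by simpa using hc⟩
  | succ s ih =>
    have h1 : Differentiable ℂ (dslope F 0) := by
      rw [← differentiableOn_univ] at hF ⊢
      exact (Complex.differentiableOn_dslope univ_mem).mpr hF
    obtain ⟨q, hq, hq'⟩ := ih h1 (C := C + ‖F 0‖) <| by
      filter_upwards [hg, eventually_cobounded_le_norm 1] with x hx h1
      have hx0 : x ≠ 0 := by rintro rfl; norm_num at h1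
      rw [dslope_of_ne _ hx0, slope_def_field, sub_zero, norm_div, div_le_iff₀ (by positivity)]
      calc ‖F x - F 0‖ ≤ ‖F x‖ + ‖F 0‖ := norm_sub_le _ _
        _ ≤ C * ‖x‖ ^ (s + 1) + ‖F 0‖ * ‖x‖ ^ (s + 1) := by
          gcongr
          exact le_mul_of_one_le_right (norm_nonneg _) (one_le_pow₀ h1)
        _ = _ := by ring
    refine ⟨Polynomial.C (F 0) + X * q, ?_, fun x => ?_⟩
    · refine (natDegree_add_le _ _).trans ?_
      simp only [natDegree_C, zero_le, sup_of_le_right]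
      exact natDegree_mul_le.trans (by simp; lia)
    · have := sub_smul_dslope F 0 x
      rw [hq'] at this
      simp only [sub_zero, smul_eq_mul] at this
      simp [this]

theorem exists_polynomial_of_growth {F : ℂ → ℂ} {d : ℂ[X]} (hd : d ≠ 0)
    (hF : ∀ x, d.eval x ≠ 0 → DifferentiableAt ℂ F x)
    (hb : ∀ b, d.eval b = 0 → ∃ M : ℝ, ∀ᶠ x in 𝓝[≠] b, ‖F x‖ ≤ M) {s : ℕ} {C : ℝ}
    (hg : ∀ᶠ x in Bornology.cobounded ℂ, d.eval x ≠ 0 → ‖F x‖ ≤ C * ‖x‖ ^ s) :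
    ∃ q : ℂ[X], q.natDegree ≤ s ∧ ∀ x, d.eval x ≠ 0 → F x = q.eval x := by
  have hd1 : ∀ b, ∀ᶠ z in 𝓝[≠] b, DifferentiableAt ℂ F z := fun b =>
    (eventually_eval_ne hd b).mono fun z hz => hF z hz
  have key : ∀ b, d.eval b = 0 → ∃ l, Tendsto F (𝓝[≠] b) (𝓝 l) ∧
      AnalyticAt ℂ (Function.update F b l) b := fun b hb' => by
    obtain ⟨M, hM⟩ := hb b hb'
    exact exists_analyticAt_extension (hd1 b) hM
  choose! l hl using key
  classical
  let G : ℂ → ℂ := fun x => if d.eval x = 0 then l x else F x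
  have hG : Differentiable ℂ G := by
    intro x
    by_cases hx : d.eval x = 0
    · refine (hl x hx).2.differentiableAt.congr_of_eventuallyEq ?_
      rw [Filter.EventuallyEq, ← nhdsNE_sup_pure, eventually_sup]
      refine ⟨?_, by simp [G, hx]⟩
      filter_upwards [eventually_eval_ne hd x, self_mem_nhdsWithin] with y hy hne
      simp [G, hy, Function.update_of_ne hne]
    · refine (hF x hx).congr_of_eventuallyEq ?_
      filter_upwards [d.continuous.continuousAt.eventually_ne hx] with y hy
      simp [G, hy]
  have hfin := eventually_cobounded_eval_ne hd
  obtain ⟨q, hq, hq'⟩ := exists_polynomial_of_entire hG (C := C) (s := s) (by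
    filter_upwards [hg, hfin] with x h1 h2
    simpa [G, h2] using h1 h2)
  exact ⟨q, hq, fun x hx => by rw [← hq' x]; simp [G, hx]⟩

theorem Polynomial.exists_norm_eval_le (p : ℂ[X]) :
    ∃ C : ℝ, 0 ≤ C ∧ ∃ D : ℕ, ∀ x, ‖p.eval x‖ ≤ C * (1 + ‖x‖) ^ D := by
  refine ⟨∑ n ∈ Finset.range (p.natDegree + 1), ‖p.coeff n‖, by positivity, p.natDegree, fun x => ?_⟩
  rw [eval_eq_sum_range, Finset.sum_mul]
  refine (norm_sum_le _ _).trans (Finset.sum_le_sum fun n hn => ?_)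
  rw [norm_mul, norm_pow]
  gcongr
  calc ‖x‖ ^ n ≤ (1 + ‖x‖) ^ n := by gcongr; linarith
    _ ≤ _ := pow_le_pow_right₀ (by linarith [norm_nonneg x]) (by simpa [Nat.lt_succ_iff] using hn)

theorem exists_bound_sum {ι : Type*} (s : Finset ι) (f : ι → ℂ → ℝ)
    (h : ∀ i ∈ s, ∃ C : ℝ, 0 ≤ C ∧ ∃ D : ℕ, ∀ x, f i x ≤ C * (1 + ‖x‖) ^ D) :
    ∃ C : ℝ, 0 ≤ C ∧ ∃ D : ℕ, ∀ x, ∑ i ∈ s, f i x ≤ C * (1 + ‖x‖) ^ D := by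
  choose! C hC D hD using h
  refine ⟨∑ i ∈ s, C i, Finset.sum_nonneg hC, s.sup D, fun x => ?_⟩
  rw [Finset.sum_mul]
  refine Finset.sum_le_sum fun i hi => (hD i hi x).trans ?_
  have := hC i hi
  gcongr
  · linarith [norm_nonneg x]
  · exact Finset.le_sup (f := D) hi

namespace PlaneCurve
variable (K : PlaneCurve)

theorem exists_root_bound : ∃ C : ℝ, 0 ≤ C ∧ ∃ D : ℕ, ∀ x y, K.P.evalEval x y = 0 →
    ‖y‖ ≤ C * (1 + ‖x‖) ^ D := by
  obtain ⟨C, hC, D, hD⟩ := exists_bound_sum (Finset.range K.N)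
    (fun n x => ‖(K.P.coeff n).eval x‖) fun n _ => (K.P.coeff n).exists_norm_eval_le
  refine ⟨1 + C, by positivity, D, fun x y h => ?_⟩
  have h1 : (1 : ℝ) ≤ (1 + ‖x‖) ^ D := one_le_pow₀ (by linarith [norm_nonneg x])
  by_cases hy : ‖y‖ ≤ 1
  · nlinarith [mul_nonneg hC (zero_le_one.trans h1)]
  push Not at hy
  have hN : y ^ K.N = - ∑ n ∈ Finset.range K.N, (K.P.coeff n).eval x * y ^ n := by
    rw [evalEval_eq_sum, Finset.sum_range_succ, K.monic.coeff_natDegree] at h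
    simp only [eval_one, one_mul] at h
    exact eq_neg_of_add_eq_zero_right h
  have h2 : ‖y‖ ≤ ∑ n ∈ Finset.range K.N, ‖(K.P.coeff n).eval x‖ := by
    rcases Nat.eq_zero_or_pos K.N with h0 | h0
    · rw [h0] at hN
      simp at hN
    · have h3 : ‖y‖ ^ K.N ≤ (∑ n ∈ Finset.range K.N, ‖(K.P.coeff n).eval x‖) * ‖y‖ ^ (K.N - 1) := by
        rw [← norm_pow, hN, norm_neg, Finset.sum_mul]
        refine (norm_sum_le _ _).trans (Finset.sum_le_sum fun n hn => ?_)
        rw [norm_mul, norm_pow]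
        gcongr
        · exact hy.le
        · have := Finset.mem_range.mp hn; lia
      have h4 : ‖y‖ ^ K.N = ‖y‖ * ‖y‖ ^ (K.N - 1) := by
        rw [← pow_succ']; congr 1; lia
      rw [h4] at h3
      exact le_of_mul_le_mul_right h3 (by positivity)
  nlinarith [hD x]

theorem exists_bound (g : ℂ[X][X]) : ∃ C : ℝ, 0 ≤ C ∧ ∃ D : ℕ, ∀ x y, K.P.evalEval x y = 0 →
    ‖g.evalEval x y‖ ≤ C * (1 + ‖x‖) ^ D := by
  obtain ⟨C, hC, D, hD⟩ := K.exists_root_bound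
  obtain ⟨C', hC', D', hD'⟩ := exists_bound_sum (Finset.range (g.natDegree + 1))
    (fun n x => ‖(g.coeff n).eval x‖ * (C * (1 + ‖x‖) ^ D) ^ n) fun n _ => by
      obtain ⟨C1, hC1, D1, hD1⟩ := (g.coeff n).exists_norm_eval_le
      refine ⟨C1 * C ^ n, by positivity, D1 + D * n, fun x => ?_⟩
      have := norm_nonneg x
      calc _ ≤ (C1 * (1 + ‖x‖) ^ D1) * (C * (1 + ‖x‖) ^ D) ^ n := by gcongr; exact hD1 x
        _ = _ := by ring
  refine ⟨C', hC', D', fun x y h => le_trans ?_ (hD' x)⟩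
  rw [evalEval_eq_sum]
  refine (norm_sum_le _ _).trans (Finset.sum_le_sum fun n _ => ?_)
  rw [norm_mul, norm_pow]
  gcongr
  exact hD x y h

/-- Local continuous sections of the projection over the regular values. -/
structure IsSection (Y : ℂ → ℂ) (x₀ : ℂ) : Prop where
  reg : x₀ ∈ K.Reg
  cont : ContinuousAt Y x₀
  root : ∀ᶠ x in 𝓝 x₀, K.P.evalEval x (Y x) = 0

variable {K}

theorem IsSection.root_self {Y : ℂ → ℂ} {x₀ : ℂ} (h : K.IsSection Y x₀) :
    K.P.evalEval x₀ (Y x₀) = 0 := h.root.self_of_nhds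

theorem exists_isSection {x y : ℂ} (hx : x ∈ K.Reg) (h : K.P.evalEval x y = 0) :
    ∃ φ, φ x = y ∧ K.IsSection φ x ∧
      ∀ᶠ p : ℂ × ℂ in 𝓝 (x, y), K.P.evalEval p.1 p.2 = 0 → φ p.1 = p.2 := by
  obtain ⟨φ, h0, h1, h2⟩ := exists_implicit_root K.P h (K.derivative_ne hx h)
  exact ⟨φ, h0, ⟨hx, h1.self_of_nhds.1.continuousAt, h1.mono fun x hx => hx.2⟩, h2⟩

theorem eventually_eq_of_section {φ ψ Y : ℂ → ℂ} {t : ℂ} (hψ : ContinuousAt ψ t)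
    (hY : ContinuousAt Y t) (h : ∀ᶠ s in 𝓝 t, K.P.evalEval (ψ s) (Y s) = 0)
    (hφ : ∀ᶠ p : ℂ × ℂ in 𝓝 (ψ t, Y t), K.P.evalEval p.1 p.2 = 0 → φ p.1 = p.2) :
    Y =ᶠ[𝓝 t] φ ∘ ψ := by
  have h1 : Tendsto (fun s => (ψ s, Y s)) (𝓝 t) (𝓝 (ψ t, Y t)) := hψ.prodMk hY
  filter_upwards [h1.eventually hφ, h] with s h1 h2
  exact (h1 h2).symm

theorem IsSection.eventually {Y : ℂ → ℂ} {x₀ : ℂ} (h : K.IsSection Y x₀) :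
    ∀ᶠ x in 𝓝 x₀, DifferentiableAt ℂ Y x ∧ K.IsSection Y x := by
  obtain ⟨φ, h0, h1, h2⟩ := exists_implicit_root K.P h.root_self
    (K.derivative_ne h.reg h.root_self)
  have he : Y =ᶠ[𝓝 x₀] φ := eventually_eq_of_section (ψ := id) continuousAt_id h.cont h.root h2
  filter_upwards [he.eventually_nhds, h1, h.root.eventually_nhds, K.isOpen_Reg.mem_nhds h.reg]
    with x a1 a2 a3 a4
  have := a2.1.congr_of_eventuallyEq a1
  exact ⟨this, a4, this.continuousAt, a3⟩

theorem IsSection.of_differentiableOn {Y : ℂ → ℂ} {S : Set ℂ} (hS : IsOpen S) (hSr : S ⊆ K.Reg)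
    (hY : DifferentiableOn ℂ Y S) (h : ∀ x ∈ S, K.P.evalEval x (Y x) = 0) {x : ℂ} (hx : x ∈ S) :
    K.IsSection Y x :=
  ⟨hSr hx, hY.continuousOn.continuousAt (hS.mem_nhds hx), by
    filter_upwards [hS.mem_nhds hx] with y hy using h y hy⟩

variable (K)

/-- `h` is holomorphic on the regular part of the curve, with derivative `w` with respect to the
first coordinate. -/
def HasZDeriv (h w : ℂ → ℂ → ℂ) : Prop :=
  ∀ x₀ Y, K.IsSection Y x₀ → HasDerivAt (fun x => h x (Y x)) (w x₀ (Y x₀)) x₀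

/-- `h` is holomorphic on the regular part of the curve. -/
def HolZ (h : ℂ → ℂ → ℂ) : Prop :=
  ∀ x₀ Y, K.IsSection Y x₀ → DifferentiableAt ℂ (fun x => h x (Y x)) x₀

/-- `φ` is locally constant on the regular part of the curve. -/
def LocConst (φ : ℂ → ℂ → ℂ) : Prop :=
  ∀ x₀ Y, K.IsSection Y x₀ → ∀ᶠ x in 𝓝 x₀, φ x (Y x) = φ x₀ (Y x₀)

variable {K}

theorem HasZDeriv.holZ {h w : ℂ → ℂ → ℂ} (H : K.HasZDeriv h w) : K.HolZ h :=
  fun x₀ Y hY => (H x₀ Y hY).differentiableAt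

theorem LocConst.hasZDeriv {φ : ℂ → ℂ → ℂ} (H : K.LocConst φ) : K.HasZDeriv φ (fun _ _ => 0) :=
  fun x₀ Y hY => (hasDerivAt_const x₀ (φ x₀ (Y x₀))).congr_of_eventuallyEq (H x₀ Y hY)

theorem HasZDeriv.comp {h w : ℂ → ℂ → ℂ} (H : K.HasZDeriv h w) {ψ Y : ℂ → ℂ} {ψ' t : ℂ}
    (hψ : HasDerivAt ψ ψ' t) (hY : ContinuousAt Y t) (hreg : ψ t ∈ K.Reg)
    (hr : ∀ᶠ s in 𝓝 t, K.P.evalEval (ψ s) (Y s) = 0) :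
    HasDerivAt (fun s => h (ψ s) (Y s)) (w (ψ t) (Y t) * ψ') t := by
  obtain ⟨φ, h0, h1, h2⟩ := exists_isSection hreg hr.self_of_nhds
  have he := eventually_eq_of_section hψ.continuousAt hY hr h2
  have h3 := (H _ φ h1).comp t hψ
  rw [h0] at h3
  refine h3.congr_of_eventuallyEq ?_
  filter_upwards [he] with s hs
  simp [hs]

theorem HolZ.exists_hasZDeriv {h : ℂ → ℂ → ℂ} (H : K.HolZ h) : ∃ w, K.HasZDeriv h w ∧ K.HolZ w := by
  have key : ∀ x y, x ∈ K.Reg ∧ K.P.evalEval x y = 0 → ∃ φ : ℂ → ℂ, φ x = y ∧ K.IsSection φ x ∧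
      ∀ᶠ p : ℂ × ℂ in 𝓝 (x, y), K.P.evalEval p.1 p.2 = 0 → φ p.1 = p.2 :=
    fun x y hxy => exists_isSection hxy.1 hxy.2
  choose! φ hφ0 hφ1 hφ2 using key
  let w : ℂ → ℂ → ℂ := fun x y => deriv (fun t => h t (φ x y t)) x
  have hw : ∀ x₀ Y, K.IsSection Y x₀ → w x₀ (Y x₀) = deriv (fun x => h x (Y x)) x₀ := by
    intro x₀ Y hY
    have he : Y =ᶠ[𝓝 x₀] φ x₀ (Y x₀) := eventually_eq_of_section (ψ := id) continuousAt_id hY.cont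
      hY.root (hφ2 x₀ (Y x₀) ⟨hY.reg, hY.root_self⟩)
    refine EventuallyEq.deriv_eq ?_
    filter_upwards [he] with x hx
    rw [hx]
  refine ⟨w, fun x₀ Y hY => ?_, fun x₀ Y hY => ?_⟩
  · rw [hw x₀ Y hY]
    exact (H x₀ Y hY).hasDerivAt
  · have h1 : (fun x => w x (Y x)) =ᶠ[𝓝 x₀] deriv (fun x => h x (Y x)) := by
      filter_upwards [hY.eventually] with x hx using hw x Y hx.2
    refine DifferentiableAt.congr_of_eventuallyEq ?_ h1
    obtain ⟨S, hS, hSo, hxS⟩ := mem_nhds_iff.mp hY.eventually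
    have h2 : DifferentiableOn ℂ (fun x => h x (Y x)) S := fun x hx =>
      (H x Y (hS hx).2).differentiableWithinAt
    exact (h2.deriv hSo).differentiableAt (hSo.mem_nhds hxS)

theorem HolZ.add {h k : ℂ → ℂ → ℂ} (H : K.HolZ h) (H' : K.HolZ k) :
    K.HolZ fun x y => h x y + k x y := fun x₀ Y hY => (H x₀ Y hY).add (H' x₀ Y hY)

theorem HolZ.mul {h k : ℂ → ℂ → ℂ} (H : K.HolZ h) (H' : K.HolZ k) :
    K.HolZ fun x y => h x y * k x y := fun x₀ Y hY => (H x₀ Y hY).mul (H' x₀ Y hY)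

theorem holZ_evalEval (g : ℂ[X][X]) : K.HolZ fun x y => g.evalEval x y := fun x₀ _ hY =>
  (hasDerivAt_evalEval_comp g (hasDerivAt_id x₀)
    hY.eventually.self_of_nhds.1.hasDerivAt).differentiableAt

theorem HolZ.div_derivative {h : ℂ → ℂ → ℂ} (H : K.HolZ h) :
    K.HolZ fun x y => h x y / K.P.derivative.evalEval x y := fun x₀ Y hY =>
  (H x₀ Y hY).div (holZ_evalEval K.P.derivative x₀ Y hY) (K.derivative_ne hY.reg hY.root_self)

/-- The sum of the values of a function over a fibre. -/
noncomputable def trace (K : PlaneCurve) (h : ℂ → ℂ → ℂ) (x : ℂ) : ℂ :=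
  ((K.fib x).roots.map (h x)).sum

theorem Enum.trace_eq {x : ℂ} {y : Fin K.N → ℂ} (hy : K.Enum x y) (h : ℂ → ℂ → ℂ) :
    K.trace h x = ∑ i, h x (y i) := by
  have : (K.fib x).roots = Finset.univ.val.map y := by
    rw [hy, ← roots_multiset_prod_X_sub_C (Finset.univ.val.map y)]
    simp only [Finset.prod, Multiset.map_map]
    rfl
  rw [trace, this, Multiset.map_map]
  rfl

theorem HolZ.trace {h : ℂ → ℂ → ℂ} (H : K.HolZ h) {x : ℂ} (hx : x ∈ K.Reg) :
    DifferentiableAt ℂ (K.trace h) x := by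
  obtain ⟨r, hr, Y, hreg, hd, hE⟩ := exists_local_enum hx
  have hm := Metric.mem_ball_self (x := x) hr
  have h1 : K.trace h =ᶠ[𝓝 x] fun x => ∑ i, h x (Y i x) := by
    filter_upwards [Metric.ball_mem_nhds x hr] with t ht using (hE t ht).trace_eq h
  refine DifferentiableAt.congr_of_eventuallyEq ?_ h1
  refine DifferentiableAt.fun_sum fun i _ => H x (Y i) ?_
  exact IsSection.of_differentiableOn Metric.isOpen_ball hreg (hd i) (fun x hx => (hE x hx).root i) hm

theorem norm_trace_le {h : ℂ → ℂ → ℂ} {x : ℂ} {M : ℝ}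
    (hM : ∀ y, K.P.evalEval x y = 0 → ‖h x y‖ ≤ M) : ‖K.trace h x‖ ≤ K.N * M := by
  obtain ⟨y, hy⟩ := K.exists_enum x
  rw [hy.trace_eq]
  refine (norm_sum_le _ _).trans ((Finset.sum_le_sum fun i _ => hM _ (hy.root i)).trans ?_)
  simp

/-- The trace of a function of polynomial growth is a polynomial. -/
theorem HolZ.exists_trace_eq {h : ℂ → ℂ → ℂ} (H : K.HolZ h) {C : ℝ} {s : ℕ}
    (hb : ∀ b, K.d.eval b = 0 → ∃ M : ℝ, ∀ᶠ x in 𝓝[≠] b, ∀ y, K.P.evalEval x y = 0 → ‖h x y‖ ≤ M)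
    (hg : ∀ᶠ x in Bornology.cobounded ℂ, x ∈ K.Reg → ∀ y, K.P.evalEval x y = 0 →
      ‖h x y‖ ≤ C * ‖x‖ ^ s) :
    ∃ q : ℂ[X], q.natDegree ≤ s ∧ ∀ x ∈ K.Reg, K.trace h x = q.eval x := by
  refine exists_polynomial_of_growth K.d_ne (fun x hx => H.trace hx) (fun b hb' => ?_)
    (C := K.N * C) ?_
  · obtain ⟨M, hM⟩ := hb b hb'
    exact ⟨K.N * M, hM.mono fun x hx => norm_trace_le hx⟩
  · filter_upwards [hg] with x hx hxr
    rw [mul_assoc]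
    exact norm_trace_le (hx hxr)

end PlaneCurve

namespace PlaneCurve
variable (K : PlaneCurve)

theorem exists_growth (g : ℂ[X][X]) : ∃ C : ℝ, ∃ s : ℕ, ∀ x, 1 ≤ ‖x‖ →
    ∀ y, K.P.evalEval x y = 0 → ‖g.evalEval x y‖ ≤ C * ‖x‖ ^ s := by
  obtain ⟨C, hC, D, hD⟩ := K.exists_bound g
  refine ⟨C * 2 ^ D, D, fun x hx y hy => (hD x y hy).trans ?_⟩
  rw [mul_assoc, ← mul_pow]
  gcongr
  linarith

theorem exists_local_bound (g : ℂ[X][X]) (b : ℂ) : ∃ M : ℝ, ∀ᶠ x in 𝓝 b,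
    ∀ y, K.P.evalEval x y = 0 → ‖g.evalEval x y‖ ≤ M := by
  obtain ⟨C, hC, D, hD⟩ := K.exists_bound g
  refine ⟨C * (1 + (‖b‖ + 1)) ^ D, ?_⟩
  have : ∀ᶠ x in 𝓝 b, ‖x‖ < ‖b‖ + 1 :=
    continuous_norm.continuousAt.eventually_lt continuousAt_const (by simp)
  filter_upwards [this] with x hx y hy
  refine (hD x y hy).trans ?_
  gcongr

theorem dvd_of_evalEval_eq_zero {Ω : Set ℂ} (hΩ : Ω.Infinite) (hreg : Ω ⊆ K.Reg) (Q : ℂ[X][X])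
    (h : ∀ x ∈ Ω, ∀ y, K.P.evalEval x y = 0 → Q.evalEval x y = 0) : K.P ∣ Q := by
  rw [← Polynomial.modByMonic_eq_zero_iff_dvd K.monic]
  set R := Q %ₘ K.P with hR
  have h1 : ∀ x ∈ Ω, R.map (evalRingHom x) = 0 := by
    intro x hx
    obtain ⟨y, hy⟩ := K.exists_enum x
    refine eq_zero_of_natDegree_lt_card_of_eval_eq_zero _ (hy.injective (hreg hx)) (fun i => ?_) ?_
    · have h2 := congrArg (evalEval x (y i)) (modByMonic_add_div Q K.P)
      rw [evalEval_add, evalEval_mul, hy.root, zero_mul, add_zero, h x hx _ (hy.root i)] at h2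
      rw [map_evalRingHom_eval, h2]
    · rw [Fintype.card_fin]
      refine lt_of_le_of_lt natDegree_map_le ?_
      exact natDegree_modByMonic_lt Q K.monic fun h1 => by
        have := K.irr.not_isUnit
        rw [h1] at this
        exact this isUnit_one
  ext1 n
  rw [coeff_zero]
  refine eq_zero_of_infinite_isRoot _ (hΩ.mono fun x hx => ?_)
  have := congrArg (fun p => p.coeff n) (h1 x hx)
  simpa using this

variable {K}

/-- The divided difference of `K.P` in the second variable. -/
noncomputable def divDiff (K : PlaneCurve) (x T y : ℂ) : ℂ :=
  ∑ n ∈ Finset.range (K.P.natDegree + 1), (K.P.coeff n).eval x *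
    ∑ i ∈ Finset.range n, T ^ i * y ^ (n - 1 - i)

theorem divDiff_mul (x T y : ℂ) :
    K.divDiff x T y * (T - y) = K.P.evalEval x T - K.P.evalEval x y := by
  rw [divDiff, evalEval_eq_sum, evalEval_eq_sum, Finset.sum_mul, ← Finset.sum_sub_distrib]
  refine Finset.sum_congr rfl fun n _ => ?_
  rw [mul_assoc, (Commute.all T y).geom_sum₂_mul, mul_sub]

theorem divDiff_self (x y : ℂ) : K.divDiff x y y = K.P.derivative.evalEval x y := by
  have h : K.P.derivative.evalEval x y = (K.P.map (evalRingHom x)).derivative.eval y := by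
    rw [derivative_map, map_evalRingHom_eval]
  rw [h, derivative_eval, sum_over_range' _ _ (K.P.natDegree + 1)
    (lt_of_le_of_lt natDegree_map_le (Nat.lt_succ_self _)), divDiff]
  · refine Finset.sum_congr rfl fun n _ => ?_
    have : ∀ i ∈ Finset.range n, y ^ i * y ^ (n - 1 - i) = y ^ (n - 1) := fun i hi => by
      rw [← pow_add]; congr 1; have := Finset.mem_range.mp hi; lia
    rw [Finset.sum_congr rfl this]
    simp [mul_assoc]
  · simp

theorem divDiff_enum {x : ℂ} (hx : x ∈ K.Reg) {y : Fin K.N → ℂ} (hy : K.Enum x y) (l i) :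
    K.divDiff x (y l) (y i) = if i = l then K.P.derivative.evalEval x (y l) else 0 := by
  split_ifs with h
  · rw [h, divDiff_self]
  · have := divDiff_mul (K := K) x (y l) (y i)
    rw [hy.root, hy.root, sub_zero] at this
    exact (mul_eq_zero.mp this).resolve_right
      (sub_ne_zero.mpr ((hy.injective hx).ne (Ne.symm h)))

/-- Irreducibility: a set of branches all of whose weighted power sums are polynomials is
empty or everything. -/
theorem eq_zero_or_eq_one {Ω : Set ℂ} (hΩ : Ω.Infinite) (hreg : Ω ⊆ K.Reg) {s : ℂ → ℂ → ℂ}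
    (hs : ∀ x ∈ Ω, ∀ y, K.P.evalEval x y = 0 → s x y = 0 ∨ s x y = 1) {e : ℂ[X]}
    (he : ∀ x ∈ Ω, e.eval x ≠ 0)
    (h : ∀ k : ℕ, ∃ q : ℂ[X], ∀ x ∈ Ω, ∀ y, K.Enum x y →
      q.eval x = e.eval x * ∑ i, s x (y i) * y i ^ k / K.P.derivative.evalEval x (y i)) :
    (∀ x ∈ Ω, ∀ y, K.P.evalEval x y = 0 → s x y = 0) ∨
      ∀ x ∈ Ω, ∀ y, K.P.evalEval x y = 0 → s x y = 1 := by
  choose q hq using h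
  let Q : ℂ[X][X] := ∑ n ∈ Finset.range (K.P.natDegree + 1), ∑ i ∈ Finset.range n,
    C (K.P.coeff n * q (n - 1 - i)) * X ^ i
  have hQ : ∀ x ∈ Ω, ∀ y, K.P.evalEval x y = 0 → Q.evalEval x y = e.eval x * s x y := by
    intro x hx t ht
    obtain ⟨y, hy⟩ := K.exists_enum x
    have h1 : Q.evalEval x t = e.eval x * ∑ l, s x (y l) / K.P.derivative.evalEval x (y l) *
        K.divDiff x t (y l) := by
      simp only [Q, evalEval_finsetSum, evalEval_mul, evalEval_C, eval_mul, evalEval_pow,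
        evalEval_X, divDiff, Finset.mul_sum]
      rw [Finset.sum_comm]
      refine Finset.sum_congr rfl fun n _ => ?_
      rw [Finset.sum_comm]
      refine Finset.sum_congr rfl fun i _ => ?_
      rw [hq _ x hx y hy, Finset.mul_sum, Finset.mul_sum, Finset.sum_mul]
      refine Finset.sum_congr rfl fun l _ => ?_
      ring
    obtain ⟨l, rfl⟩ := hy.exists_eq ht
    rw [h1, Finset.sum_eq_single l]
    · rw [divDiff_enum (hreg hx) hy, if_pos rfl,
        div_mul_cancel₀ _ (K.derivative_ne (hreg hx) (hy.root l))]
    · intro i _ hi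
      rw [divDiff_enum (hreg hx) hy, if_neg hi, mul_zero]
    · simp
  have hd := K.dvd_of_evalEval_eq_zero hΩ hreg (Q * (Q - C e)) (by
    intro x hx y hy
    rw [evalEval_mul, evalEval_sub, evalEval_C, hQ x hx y hy]
    rcases hs x hx y hy with h | h <;> rw [h] <;> ring)
  rcases K.irr.prime.dvd_or_dvd hd with hd | hd
  · left
    intro x hx y hy
    have h1 := hQ x hx y hy
    obtain ⟨R, hR⟩ := hd
    rw [hR, evalEval_mul, hy, zero_mul] at h1
    exact (mul_eq_zero.mp h1.symm).resolve_left (he x hx)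
  · right
    intro x hx y hy
    have h1 := hQ x hx y hy
    obtain ⟨R, hR⟩ := hd
    have h2 := congrArg (evalEval x y) hR
    rw [evalEval_sub, evalEval_mul, hy, zero_mul, evalEval_C, h1] at h2
    have h3 : e.eval x * (s x y - 1) = 0 := by linear_combination h2
    exact sub_eq_zero.mp ((mul_eq_zero.mp h3).resolve_left (he x hx))

theorem infinite_Reg (K : PlaneCurve) : K.Reg.Infinite := by
  have h : (K.d.rootSet ℂ).Finite := K.d.rootSet_finite ℂ
  refine h.infinite_compl.mono fun x hx => ?_
  by_contra h0
  refine hx ?_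
  rw [mem_rootSet]
  exact ⟨K.d_ne, by simpa [Reg] using h0⟩

/-- The regular part of an irreducible plane curve is connected. -/
theorem LocConst.eq {φ : ℂ → ℂ → ℂ} (H : K.LocConst φ) {x y x' y' : ℂ} (hx : x ∈ K.Reg)
    (hy : K.P.evalEval x y = 0) (hx' : x' ∈ K.Reg) (hy' : K.P.evalEval x' y' = 0) :
    φ x y = φ x' y' := by
  classical
  let s : ℂ → ℂ → ℂ := fun u v => if φ u v = φ x y then 1 else 0
  have hsl : K.LocConst s := fun x₀ Y hY => by
    filter_upwards [H x₀ Y hY] with t ht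
    simp only [s, ht]
  have hs1 : ∀ u v, ‖s u v‖ ≤ 1 := fun u v => by
    simp only [s]; split_ifs <;> simp
  have key := eq_zero_or_eq_one (K := K) K.infinite_Reg subset_rfl (s := s) (e := K.d)
    (fun u _ v _ => by simp only [s]; split_ifs <;> simp) (fun x hx => hx) (fun k => by
      obtain ⟨C, t, hC⟩ := K.exists_growth (K.b * X ^ k)
      obtain ⟨q, -, hq⟩ := HolZ.exists_trace_eq (K := K)
        (hsl.hasZDeriv.holZ.mul (holZ_evalEval (K.b * X ^ k))) (C := C) (s := t)
        (fun b _ => by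
          obtain ⟨M, hM⟩ := K.exists_local_bound (K.b * X ^ k) b
          refine ⟨M, nhdsWithin_le_nhds (hM.mono fun u hu v hv => ?_)⟩
          rw [norm_mul]
          exact (mul_le_of_le_one_left (norm_nonneg _) (hs1 _ _)).trans (hu v hv))
        (by
          filter_upwards [eventually_cobounded_le_norm 1] with u hu _ v hv
          rw [norm_mul]
          exact (mul_le_of_le_one_left (norm_nonneg _) (hs1 _ _)).trans (hC u hu v hv))
      refine ⟨q, fun u hu v hv => ?_⟩
      rw [← hq u hu, hv.trace_eq, Finset.mul_sum]
      refine Finset.sum_congr rfl fun i _ => ?_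
      have h1 := K.bezout_eval (hv.root i)
      have h2 := K.derivative_ne hu (hv.root i)
      rw [← h1]
      field_simp
      simp [evalEval_mul, evalEval_pow, evalEval_X]
      ring)
  rcases key with h | h
  · have := h x hx y hy
    simp [s] at this
  · have := h x' hx' y' hy'
    by_contra hne
    simp [s, Ne.symm hne] at this

end PlaneCurve

theorem eventually_eq_of_hasDerivAt_zero {D : ℂ → ℂ} {x : ℂ} (h : ∀ᶠ y in 𝓝 x, HasDerivAt D 0 y) :
    ∀ᶠ y in 𝓝 x, D y = D x := by
  obtain ⟨r, hr, hb⟩ := Metric.eventually_nhds_iff_ball.mp h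
  filter_upwards [Metric.ball_mem_nhds x hr] with y hy
  exact Metric.isOpen_ball.is_const_of_deriv_eq_zero (convex_ball x r).isPreconnected
    (fun z hz => (hb z hz).differentiableAt.differentiableWithinAt) (fun z hz => (hb z hz).deriv)
    hy (Metric.mem_ball_self hr)

theorem exists_primitive_upper {A : ℝ} {f : ℂ → ℂ} (hf : DifferentiableOn ℂ f (upperPlane A)) :
    ∃ η : ℂ → ℂ, ∀ z ∈ upperPlane A, HasDerivAt η (f z) z := by
  have h1 : ∀ z : upperPlane A, ∃ r > 0, Metric.ball z.1 r ⊆ upperPlane A ∧ ∃ g : ℂ → ℂ,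
      ∀ w ∈ Metric.ball z.1 r, HasDerivAt g (f w) w := by
    intro z
    obtain ⟨r, hr, hb⟩ := Metric.isOpen_iff.mp (isOpen_upper A) z.1 z.2
    exact ⟨r, hr, hb, (hf.mono hb).isExactOn_ball⟩
  choose r hr hb g hg using h1
  obtain ⟨F, hF⟩ := exists_glued_primitive (X := upperPlane A) (fun z => {w | w.1 ∈ Metric.ball z.1 (r z)})
    (fun z => Metric.isOpen_ball.preimage continuous_subtype_val)
    (fun z => Metric.mem_ball_self (hr z)) (fun z w => g z w.1) (by
      intro i j x hi hj
      have : ∀ᶠ y in 𝓝 x.1, g i y - g j y = g i x.1 - g j x.1 := by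
        refine eventually_eq_of_hasDerivAt_zero (D := fun y => g i y - g j y) ?_
        filter_upwards [Metric.isOpen_ball.mem_nhds hi, Metric.isOpen_ball.mem_nhds hj] with y h1 h2
        rw [← sub_self (f y)]
        exact (hg i y h1).sub (hg j y h2)
      exact continuous_subtype_val.continuousAt.eventually this)
  classical
  refine ⟨fun z => if h : z ∈ upperPlane A then F ⟨z, h⟩ else 0, fun z hz => ?_⟩
  have h1 := hF ⟨z, hz⟩ ⟨z, hz⟩ (Metric.mem_ball_self (hr _))
  have h2 : ∀ᶠ w in 𝓝 z, ∀ h : w ∈ upperPlane A, F ⟨w, h⟩ - g ⟨z, hz⟩ w = F ⟨z, hz⟩ - g ⟨z, hz⟩ z := by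
    rw [nhds_subtype_eq_comap, eventually_comap] at h1
    filter_upwards [h1] with w hw h
    exact hw ⟨w, h⟩ rfl
  refine ((hg ⟨z, hz⟩ z (Metric.mem_ball_self (hr _))).add_const
    (F ⟨z, hz⟩ - g ⟨z, hz⟩ z)).congr_of_eventuallyEq ?_
  filter_upwards [h2, (isOpen_upper A).mem_nhds hz] with w hw hwA
  simp only [hwA, dite_true]
  linear_combination hw hwA

namespace PlaneCurve
variable (K : PlaneCurve)

/-- A simply connected end of the line, over which the curve is split. -/
structure End where
  X : ℂ → ℂ
  X' : ℂ → ℂ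
  A : ℝ
  hasDerivAt : ∀ z, HasDerivAt X (X' z) z
  ne : ∀ z, X' z ≠ 0
  eq_iff : ∀ z z', X z = X z' ↔ ∃ n : ℤ, z' = z + n
  reg : ∀ z ∈ upperPlane A, X z ∈ K.Reg
  Y : Fin K.N → ℂ → ℂ
  σ : Equiv.Perm (Fin K.N)
  diff : ∀ i, DifferentiableOn ℂ (Y i) (upperPlane A)
  enum : ∀ z ∈ upperPlane A, K.Enum (X z) fun i => Y i z
  shift : ∀ i, ∀ z ∈ upperPlane A, Y i (z + 1) = Y (σ i) z

variable {K}

theorem exists_End {X X' : ℂ → ℂ} {A : ℝ} (h1 : ∀ z, HasDerivAt X (X' z) z)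
    (h0 : ∀ z, X' z ≠ 0)
    (h2 : ∀ z z', X z = X z' ↔ ∃ n : ℤ, z' = z + n) (h3 : ∀ z ∈ upperPlane A, X z ∈ K.Reg) :
    ∃ E : K.End, E.X = X ∧ E.X' = X' ∧ E.A = A := by
  obtain ⟨Y, σ, h4, h5, h6⟩ := exists_end (X := X)
    (fun z _ => (h1 z).differentiableAt.differentiableWithinAt) h3
    (fun z _ => ((h2 z (z + 1)).mpr ⟨1, by simp⟩).symm)
  exact ⟨⟨X, X', A, h1, h0, h2, h3, Y, σ, h4, h5, h6⟩, rfl, rfl, rfl⟩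

namespace End
variable (E : K.End)

theorem X_add_nat (z : ℂ) (n : ℕ) : E.X (z + n) = E.X z :=
  ((E.eq_iff z (z + n)).mpr ⟨n, by simp⟩).symm

theorem X'_add_nat (z : ℂ) (n : ℕ) : E.X' (z + n) = E.X' z := by
  have h1 := (E.hasDerivAt (z + n)).comp_add_const z n
  have h2 : (fun z => E.X (z + n)) = E.X := funext fun z => E.X_add_nat z n
  rw [h2] at h1
  exact h1.unique (E.hasDerivAt z)

theorem _root_.add_nat_mem_upper {A : ℝ} {z : ℂ} (hz : z ∈ upperPlane A) (n : ℕ) : z + n ∈ upperPlane A := by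
  simpa [upperPlane] using hz

theorem Y_add_nat (i : Fin K.N) {z : ℂ} (hz : z ∈ upperPlane E.A) (n : ℕ) :
    E.Y i (z + n) = E.Y ((E.σ ^ n) i) z := by
  induction n generalizing i with
  | zero => simp
  | succ n ih =>
    have : z + ((n + 1 : ℕ) : ℂ) = (z + n) + 1 := by push_cast; ring
    rw [this, E.shift i _ (add_nat_mem_upper hz n), ih, pow_succ, Equiv.Perm.mul_apply]

theorem root (i : Fin K.N) {z : ℂ} (hz : z ∈ upperPlane E.A) : K.P.evalEval (E.X z) (E.Y i z) = 0 :=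
  (E.enum z hz).root i

theorem injective {z : ℂ} (hz : z ∈ upperPlane E.A) : Function.Injective fun i => E.Y i z :=
  (E.enum z hz).injective (E.reg z hz)

/-- The class of a point over the end does not depend on the chosen lift. -/
theorem exists_pow_of_eq {z z' : ℂ} (hz : z ∈ upperPlane E.A) (hz' : z' ∈ upperPlane E.A) {i j : Fin K.N}
    (hX : E.X z = E.X z') (hY : E.Y i z = E.Y j z') :
    ∃ n : ℕ, (z' = z + n ∧ (E.σ ^ n) j = i) ∨ (z = z' + n ∧ (E.σ ^ n) i = j) := by
  obtain ⟨n, hn⟩ := (E.eq_iff z z').mp hX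
  rcases Int.eq_nat_or_neg n with ⟨m, rfl | rfl⟩
  · refine ⟨m, Or.inl ⟨by simpa using hn, ?_⟩⟩
    have h1 : z' = z + m := by simpa using hn
    rw [h1, E.Y_add_nat j hz] at hY
    exact (E.injective hz hY).symm
  · have h1 : z = z' + m := by rw [hn]; simp
    refine ⟨m, Or.inr ⟨h1, ?_⟩⟩
    rw [h1, E.Y_add_nat i hz'] at hY
    exact E.injective hz' hY

theorem sameCycle_of_eq {z z' : ℂ} (hz : z ∈ upperPlane E.A) (hz' : z' ∈ upperPlane E.A) {i j : Fin K.N}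
    (hX : E.X z = E.X z') (hY : E.Y i z = E.Y j z') : E.σ.SameCycle i j := by
  obtain ⟨n, ⟨-, h⟩ | ⟨-, h⟩⟩ := E.exists_pow_of_eq hz hz' hX hY
  · exact Equiv.Perm.SameCycle.symm ⟨n, by simpa using h⟩
  · exact ⟨n, by simpa using h⟩

theorem hasDerivAt_comp {h w : ℂ → ℂ → ℂ} (H : K.HasZDeriv h w) (i : Fin K.N) {z : ℂ}
    (hz : z ∈ upperPlane E.A) :
    HasDerivAt (fun z => h (E.X z) (E.Y i z)) (w (E.X z) (E.Y i z) * E.X' z) z := by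
  have hn := (isOpen_upper E.A).mem_nhds hz
  refine H.comp (E.hasDerivAt z) ((E.diff i).continuousOn.continuousAt hn) (E.reg z hz) ?_
  filter_upwards [hn] with s hs using E.root i hs

theorem differentiableAt_comp {h : ℂ → ℂ → ℂ} (H : K.HolZ h) (i : Fin K.N) {z : ℂ}
    (hz : z ∈ upperPlane E.A) : DifferentiableAt ℂ (fun z => h (E.X z) (E.Y i z)) z := by
  obtain ⟨w, hw, -⟩ := H.exists_hasZDeriv
  exact (E.hasDerivAt_comp hw i hz).differentiableAt

/-- The number of sheets in the branch of `i`. -/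
noncomputable def deg (i : Fin K.N) : ℕ := Function.minimalPeriod E.σ i

theorem deg_pos (i : Fin K.N) : 0 < E.deg i := by
  refine Function.IsPeriodicPt.minimalPeriod_pos (orderOf_pos E.σ) ?_
  rw [Function.IsPeriodicPt, Function.IsFixedPt, Equiv.Perm.iterate_eq_pow, pow_orderOf_eq_one]
  rfl

theorem pow_eq_self_iff (i : Fin K.N) (n : ℕ) : (E.σ ^ n) i = i ↔ E.deg i ∣ n := by
  rw [deg, ← Function.isPeriodicPt_iff_minimalPeriod_dvd, Function.IsPeriodicPt, Function.IsFixedPt,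
    Equiv.Perm.iterate_eq_pow]

theorem Y_add_deg (i : Fin K.N) {z : ℂ} (hz : z ∈ upperPlane E.A) : E.Y i (z + E.deg i) = E.Y i z := by
  rw [E.Y_add_nat i hz, (E.pow_eq_self_iff i _).mpr dvd_rfl]

theorem pow_injOn (i : Fin K.N) :
    Set.InjOn (fun l : ℕ => (E.σ ^ l) i) (Finset.range (E.deg i)) := by
  intro l hl m hm h
  have hl' : l < E.deg i := by simpa using hl
  have hm' : m < E.deg i := by simpa using hm
  simp only [← Equiv.Perm.iterate_eq_pow] at h
  exact Function.iterate_injOn_Iio_minimalPeriod hl' hm' h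

/-- The sheets in the branch of `i`. -/
noncomputable def branch (i : Fin K.N) : Finset (Fin K.N) :=
  (Finset.range (E.deg i)).image fun l => (E.σ ^ l) i

theorem mem_branch {i j : Fin K.N} : j ∈ E.branch i ↔ E.σ.SameCycle i j := by
  rw [branch, Finset.mem_image]
  constructor
  · rintro ⟨l, -, h⟩
    exact ⟨l, by simpa using h⟩
  · intro h
    obtain ⟨n, -, hn⟩ := h.exists_pow_eq'
    refine ⟨n % E.deg i, by simpa using Nat.mod_lt _ (E.deg_pos i), ?_⟩
    rw [← hn, ← Equiv.Perm.iterate_eq_pow, ← Equiv.Perm.iterate_eq_pow, deg,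
      Function.iterate_mod_minimalPeriod_eq]

theorem sum_branch (i : Fin K.N) (f : Fin K.N → ℂ) :
    ∑ j ∈ E.branch i, f j = ∑ l ∈ Finset.range (E.deg i), f ((E.σ ^ l) i) := by
  rw [branch, Finset.sum_image fun a ha b hb h => E.pow_injOn i ha hb h]

end End
end PlaneCurve

/-- The filter of neighbourhoods of `i∞`. -/
abbrev atImInf : Filter ℂ := comap Complex.im atTop

theorem eventually_atImInf {p : ℂ → Prop} :
    (∀ᶠ z in atImInf, p z) ↔ ∃ A, ∀ z ∈ upperPlane A, p z := by
  rw [(atTop_basis_Ioi.comap Complex.im).eventually_iff]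
  simp [upperPlane]

theorem upper_mem_atImInf (A : ℝ) : ∀ᶠ z in atImInf, z ∈ upperPlane A :=
  eventually_atImInf.mpr ⟨A, fun _ h => h⟩

instance : atImInf.NeBot := by
  refine ⟨fun h => ?_⟩
  have : ∀ᶠ z in atImInf, False := by rw [h]; exact eventually_bot
  obtain ⟨A, hA⟩ := eventually_atImInf.mp this
  obtain ⟨z, hz⟩ := nonempty_upper A
  exact hA z hz

theorem tendsto_add_atImInf (a : ℂ) : Tendsto (fun z => z + a) atImInf atImInf := by
  rw [tendsto_def]
  intro s hs
  obtain ⟨A, hA⟩ := eventually_atImInf.mp hs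
  refine eventually_atImInf.mpr ⟨A - a.im, fun z hz => hA _ ?_⟩
  have : A - a.im < z.im := hz
  change A < (z + a).im
  rw [Complex.add_im]
  linarith

theorem map_qParam {h : ℝ} (hh : 0 < h) : map (qParam h) atImInf = 𝓝[≠] 0 := by
  refine le_antisymm (qParam_tendsto hh) fun s hs => ?_
  filter_upwards [(invQParam_tendsto hh).eventually hs, self_mem_nhdsWithin] with q hq h0
  have h1 : qParam h (invQParam h q) ∈ s := hq
  rwa [qParam_right_inv hh.ne' h0] at h1

theorem hasDerivAt_qParam (h : ℝ) (z : ℂ) :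
    HasDerivAt (qParam h) (2 * Real.pi * Complex.I / h * qParam h z) z := by
  have h1 : HasDerivAt (fun z : ℂ => 2 * Real.pi * Complex.I * z / h)
      (2 * Real.pi * Complex.I / h) z := by
    simpa using ((hasDerivAt_id z).const_mul (2 * Real.pi * Complex.I : ℂ)).div_const (h : ℂ)
  rw [mul_comm]
  exact h1.cexp

theorem qParam_one_eq_iff (z z' : ℂ) : qParam 1 z = qParam 1 z' ↔ ∃ n : ℤ, z' = z + n := by
  rw [qParam, qParam, eq_comm, Complex.exp_eq_exp_iff_exists_int]
  refine exists_congr fun n => ?_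
  have := Complex.two_pi_I_ne_zero
  rw [Complex.ofReal_one, div_one, div_one]
  constructor
  · intro h
    refine mul_left_cancel₀ this ?_
    linear_combination h
  · rintro rfl
    ring

theorem qParam_pow {k : ℕ} (hk : 0 < k) (z : ℂ) : qParam k z ^ k = qParam 1 z := by
  have : (k : ℂ) ≠ 0 := by exact_mod_cast hk.ne'
  rw [qParam, qParam, ← Complex.exp_nat_mul]
  congr 1
  push_cast
  field_simp

theorem qParam_add (h : ℝ) (z w : ℂ) : qParam h (z + w) = qParam h w * qParam h z := by
  rw [qParam, qParam, qParam, ← Complex.exp_add]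
  congr 1
  ring

/-- A periodic holomorphic function on an upper half plane factors through the exponential. -/
theorem exists_cusp {A : ℝ} {k : ℕ} (hk : 0 < k) {f : ℂ → ℂ} (hf : DifferentiableOn ℂ f (upperPlane A))
    (hper : ∀ z ∈ upperPlane A, f (z + k) = f z) :
    ∃ g : ℂ → ℂ, (∀ z ∈ upperPlane A, g (qParam k z) = f z) ∧
      (∀ z ∈ upperPlane A, DifferentiableAt ℂ g (qParam k z)) ∧
      (∀ᶠ τ in 𝓝[≠] 0, DifferentiableAt ℂ g τ) ∧
      ∀ M : ℝ, (∀ᶠ z in atImInf, ‖f z‖ ≤ M) → AnalyticAt ℂ g 0 := by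
  classical
  let F : ℂ → ℂ := fun z => if z ∈ upperPlane A then f z else 0
  have hmem : ∀ z : ℂ, z + k ∈ upperPlane A ↔ z ∈ upperPlane A := fun z => by simp [upperPlane]
  have hFf : ∀ z ∈ upperPlane A, F z = f z := fun z hz => if_pos hz
  have hF : Function.Periodic F (k : ℝ) := fun z => by
    simp only [F, Complex.ofReal_natCast, hmem]
    split_ifs with h
    · exact hper z h
    · rfl
  have hk' : (0 : ℝ) < k := by exact_mod_cast hk
  have hd : ∀ z ∈ upperPlane A, DifferentiableAt ℂ F z := fun z hz => by
    have hn := (isOpen_upper A).mem_nhds hz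
    refine (hf.differentiableAt hn).congr_of_eventuallyEq ?_
    filter_upwards [hn] with w hw using hFf w hw
  have hd' : ∀ᶠ z in atImInf, DifferentiableAt ℂ F z := (upper_mem_atImInf A).mono hd
  have hd'' := eventually_differentiableAt_cuspFunction_nhds_ne_zero hk' hF hd'
  refine ⟨cuspFunction k F, fun z hz => ?_, fun z hz => ?_, hd'', fun M hM => ?_⟩
  · rw [eq_cuspFunction hk'.ne' hF, hFf z hz]
  · exact differentiableAt_cuspFunction hk'.ne' hF (hd z hz)
  · have h1 := differentiableAt_cuspFunction_zero hk' hF hd' (by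
      rw [BoundedAtFilter, Asymptotics.isBigO_iff]
      refine ⟨M, ?_⟩
      filter_upwards [hM, upper_mem_atImInf A] with z h1 h2
      simpa [hFf z h2] using h1)
    exact Complex.analyticAt_of_differentiable_on_punctured_nhds_of_continuousAt hd'' h1.continuousAt

namespace PlaneCurve
variable {K : PlaneCurve}

theorem exists_End_at (b : ℂ) : ∃ E : K.End, (∀ z, E.X z = b + qParam 1 z) ∧
    (∀ z, E.X' z = 2 * Real.pi * Complex.I * qParam 1 z) ∧ map E.X atImInf = 𝓝[≠] b := by
  have h1 : map (fun z => b + qParam 1 z) atImInf = 𝓝[≠] b := by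
    have h2 := map_qParam one_pos
    rw [show (fun z => b + qParam 1 z) = (fun z => b + z) ∘ qParam 1 from rfl, ← Filter.map_map, h2]
    simp
  have h2 : ∀ᶠ z in atImInf, b + qParam 1 z ∈ K.Reg :=
    (show Tendsto _ _ _ from h1.le).eventually (eventually_eval_ne K.d_ne b)
  obtain ⟨A, hA⟩ := eventually_atImInf.mp h2
  obtain ⟨E, e1, e2, e3⟩ := exists_End (K := K) (X := fun z => b + qParam 1 z)
    (X' := fun z => 2 * Real.pi * Complex.I * qParam 1 z)
    (fun z => by simpa using (hasDerivAt_qParam 1 z).const_add b)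
    (fun z => mul_ne_zero Complex.two_pi_I_ne_zero (qParam_ne_zero z))
    (fun z z' => by rw [add_right_inj, qParam_one_eq_iff]) hA
  exact ⟨E, fun z => by rw [e1], fun z => by rw [e2], by rw [e1, h1]⟩

theorem exists_End_infty : ∃ E : K.End, (∀ z, E.X z = (qParam 1 z)⁻¹) ∧
    (∀ z, E.X' z = -(2 * Real.pi * Complex.I) * (qParam 1 z)⁻¹) ∧
    map E.X atImInf = Bornology.cobounded ℂ := by
  have h1 : map (fun z => (qParam 1 z)⁻¹) atImInf = Bornology.cobounded ℂ := by
    have h2 := map_qParam one_pos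
    rw [show (fun z => (qParam 1 z)⁻¹) = Inv.inv ∘ qParam 1 from rfl, ← Filter.map_map, h2]
    exact Filter.inv_nhdsNE_zero
  have h2 : ∀ᶠ z in atImInf, (qParam 1 z)⁻¹ ∈ K.Reg :=
    (show Tendsto _ _ _ from h1.le).eventually (eventually_cobounded_eval_ne K.d_ne)
  obtain ⟨A, hA⟩ := eventually_atImInf.mp h2
  obtain ⟨E, e1, e2, e3⟩ := exists_End (K := K) (X := fun z => (qParam 1 z)⁻¹)
    (X' := fun z => -(2 * Real.pi * Complex.I) * (qParam 1 z)⁻¹)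
    (fun z => by
      have h3 : qParam 1 z ≠ 0 := qParam_ne_zero z
      have := (hasDerivAt_qParam 1 z).fun_inv h3
      have e : -(2 * Real.pi * Complex.I / (1 : ℝ) * qParam 1 z) / qParam 1 z ^ 2 =
          -(2 * Real.pi * Complex.I) * (qParam 1 z)⁻¹ := by
        rw [Complex.ofReal_one, div_one]
        field_simp
      rwa [e] at this)
    (fun z => mul_ne_zero (neg_ne_zero.mpr Complex.two_pi_I_ne_zero) (inv_ne_zero (qParam_ne_zero z)))
    (fun z z' => by rw [inv_inj, qParam_one_eq_iff]) hA
  exact ⟨E, fun z => by rw [e1], fun z => by rw [e2], by rw [e1, h1]⟩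

namespace End
variable (E : K.End)

/-- Properties of all points near the end can be checked on the sections. -/
theorem eventually_iff {l : Filter ℂ} (hl : map E.X atImInf = l) {p : ℂ → ℂ → Prop} :
    (∀ᶠ x in l, ∀ y, K.P.evalEval x y = 0 → p x y) ↔
      ∀ᶠ z in atImInf, ∀ i, p (E.X z) (E.Y i z) := by
  rw [← hl, eventually_map]
  refine eventually_congr ?_
  filter_upwards [upper_mem_atImInf E.A] with z hz
  constructor
  · intro h i
    exact h _ (E.root i hz)
  · intro h y hy
    obtain ⟨i, rfl⟩ := (E.enum z hz).exists_eq hy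
    exact h i

theorem exists_limit {b : ℂ} (hX : map E.X atImInf = 𝓝[≠] b) : ∃ L : Fin K.N → ℂ,
    (∀ i, Tendsto (E.Y i) atImInf (𝓝 (L i))) ∧ K.Enum b L ∧
    (∀ i, ∀ k : ℕ, 0 < k → E.deg i ∣ k → ∃ y : ℂ → ℂ, AnalyticAt ℂ y 0 ∧ y 0 = L i ∧
      ∀ z ∈ upperPlane E.A, y (qParam k z) = E.Y i z) := by
  have hb : ∀ i, ∃ M : ℝ, ∀ᶠ z in atImInf, ‖E.Y i z‖ ≤ M := by
    intro i
    obtain ⟨M, hM⟩ := K.exists_local_bound Polynomial.X b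
    refine ⟨M, ?_⟩
    filter_upwards [(E.eventually_iff hX).mp (hM.filter_mono nhdsWithin_le_nhds)] with z hz
    simpa using hz i
  have hc : ∀ i, ∀ k : ℕ, 0 < k → E.deg i ∣ k → ∃ y : ℂ → ℂ, AnalyticAt ℂ y 0 ∧
      ∀ z ∈ upperPlane E.A, y (qParam k z) = E.Y i z := by
    intro i k hk hd
    obtain ⟨M, hM⟩ := hb i
    obtain ⟨g, h1, -, -, h3⟩ := exists_cusp hk (E.diff i) fun z hz => by
      rw [E.Y_add_nat i hz, (E.pow_eq_self_iff i k).mpr hd]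
    exact ⟨g, h3 M hM, h1⟩
  have ht : ∀ i, ∀ k : ℕ, 0 < k → ∀ y : ℂ → ℂ, AnalyticAt ℂ y 0 →
      (∀ z ∈ upperPlane E.A, y (qParam k z) = E.Y i z) → Tendsto (E.Y i) atImInf (𝓝 (y 0)) := by
    intro i k hk y hy h
    have h1 := (hy.continuousAt.tendsto.mono_left nhdsWithin_le_nhds).comp
      (qParam_tendsto (show (0 : ℝ) < k by exact_mod_cast hk))
    refine h1.congr' ?_
    filter_upwards [upper_mem_atImInf E.A] with z hz using h z hz
  choose y hy hyY using fun i => hc i (E.deg i) (E.deg_pos i) dvd_rfl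
  have hl : ∀ i, Tendsto (E.Y i) atImInf (𝓝 (y i 0)) := fun i =>
    ht i _ (E.deg_pos i) _ (hy i) (hyY i)
  refine ⟨fun i => y i 0, hl, ?_, fun i k hk hd => ?_⟩
  · have hXt : Tendsto E.X atImInf (𝓝 b) := (show Tendsto _ _ _ from hX.le).mono_right
      nhdsWithin_le_nhds
    refine Polynomial.funext fun t => ?_
    rw [K.fib_eval, eval_prod]
    have h1 : Tendsto (fun z => K.P.evalEval (E.X z) t) atImInf (𝓝 (K.P.evalEval b t)) :=
      ((continuous_evalEval K.P).tendsto (b, t)).comp (hXt.prodMk_nhds tendsto_const_nhds)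
    have h2 : Tendsto (fun z => ∏ i, (t - E.Y i z)) atImInf (𝓝 (∏ i, (t - y i 0))) :=
      tendsto_finsetProd _ fun i _ => tendsto_const_nhds.sub (hl i)
    have h3 : (fun z => K.P.evalEval (E.X z) t) =ᶠ[atImInf] fun z => ∏ i, (t - E.Y i z) := by
      filter_upwards [upper_mem_atImInf E.A] with z hz using (E.enum z hz).evalEval_eq t
    simpa using tendsto_nhds_unique h1 (h2.congr' h3.symm)
  · obtain ⟨y', h1, h2⟩ := hc i k hk hd
    exact ⟨y', h1, tendsto_nhds_unique (ht i k hk y' h1 h2) (hl i), h2⟩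

end End
end PlaneCurve

namespace PlaneCurve
variable {K : PlaneCurve}

theorem HasZDeriv.locConst {φ : ℂ → ℂ → ℂ} (H : K.HasZDeriv φ fun _ _ => 0) : K.LocConst φ := by
  intro x₀ Y hY
  refine eventually_eq_of_hasDerivAt_zero (D := fun x => φ x (Y x)) ?_
  filter_upwards [hY.eventually] with x hx using H x Y hx.2

/-- Functions on a contractible curve can be glued from local primitives. -/
theorem exists_glued [ContractibleSpace K.Pt] (w : ℂ → ℂ → ℂ) (r : ℂ → ℝ) (hr : ∀ b, 0 < r b)
    (hreg : ∀ b, ∀ x ∈ Metric.ball b (r b), x ≠ b → x ∈ K.Reg) (f : ℂ → ℂ → ℂ → ℂ)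
    (hf : ∀ b, ∀ x ∈ Metric.ball b (r b), ∀ Y, K.IsSection Y x →
      HasDerivAt (fun t => f b t (Y t)) (w x (Y x)) x) :
    ∃ F : ℂ → ℂ → ℂ, K.HasZDeriv F w ∧ ∀ b y, K.P.evalEval b y = 0 →
      ∀ᶠ p : ℂ × ℂ in 𝓝 (b, y), K.P.evalEval p.1 p.2 = 0 →
        F p.1 p.2 - f b p.1 p.2 = F b y - f b b y := by
  classical
  have hcont : Continuous fun q : K.Pt => q.1.1 := continuous_fst.comp continuous_subtype_val
  obtain ⟨F, hF⟩ := exists_glued_primitive (X := K.Pt)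
    (fun p => {q | q.1.1 ∈ Metric.ball p.1.1 (r p.1.1)})
    (fun p => Metric.isOpen_ball.preimage hcont)
    (fun p => Metric.mem_ball_self (hr _)) (fun p q => f p.1.1 q.1.1 q.1.2) (by
      intro i j q hi hj
      by_cases hq : q.1.1 ∈ K.Reg
      · obtain ⟨φ, h0, h1, h2⟩ := exists_isSection hq q.2
        have h3 : ∀ᶠ t in 𝓝 q.1.1, f i.1.1 t (φ t) - f j.1.1 t (φ t) =
            f i.1.1 q.1.1 (φ q.1.1) - f j.1.1 q.1.1 (φ q.1.1) := by
          refine eventually_eq_of_hasDerivAt_zero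
            (D := fun t => f i.1.1 t (φ t) - f j.1.1 t (φ t)) ?_
          filter_upwards [h1.eventually, Metric.isOpen_ball.mem_nhds hi,
            Metric.isOpen_ball.mem_nhds hj] with t ht hti htj
          exact ((hf _ t hti φ ht.2).fun_sub (hf _ t htj φ ht.2)).congr_deriv (sub_self _)
        filter_upwards [hcont.continuousAt.eventually h3,
          continuous_subtype_val.continuousAt.eventually h2] with t ht hφ
        have := hφ t.2
        rw [this, h0] at ht
        exact ht
      · have hi' : q.1.1 = i.1.1 := by
          by_contra h
          exact hq (hreg _ _ hi h)
        have hj' : q.1.1 = j.1.1 := by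
          by_contra h
          exact hq (hreg _ _ hj h)
        rw [← hi', ← hj']
        simp)
  let G : ℂ → ℂ → ℂ := fun x y => if h : K.P.evalEval x y = 0 then F ⟨(x, y), h⟩ else 0
  have hG : ∀ b, ∀ q : K.Pt, q.1.1 ∈ Metric.ball b (r b) → (∃ y, K.P.evalEval b y = 0) →
      ∀ᶠ p : ℂ × ℂ in 𝓝 q.1, K.P.evalEval p.1 p.2 = 0 →
        G p.1 p.2 - f b p.1 p.2 = G q.1.1 q.1.2 - f b q.1.1 q.1.2 := by
    rintro b q hq ⟨y, hy⟩
    have h1 := hF ⟨(b, y), hy⟩ q hq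
    rw [nhds_subtype_eq_comap, eventually_comap] at h1
    filter_upwards [h1] with p hp h
    have := hp ⟨p, h⟩ rfl
    simp only [G, h, q.2, dite_true]
    exact this
  refine ⟨G, fun x₀ Y hY => ?_, fun b y hy => ?_⟩
  · have h1 := hG x₀ ⟨(x₀, Y x₀), hY.root_self⟩ (Metric.mem_ball_self (hr _)) ⟨_, hY.root_self⟩
    have h2 : Tendsto (fun x => (x, Y x)) (𝓝 x₀) (𝓝 (x₀, Y x₀)) :=
      continuousAt_id.prodMk hY.cont
    refine ((hf x₀ x₀ (Metric.mem_ball_self (hr _)) Y hY).add_const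
      (G x₀ (Y x₀) - f x₀ x₀ (Y x₀))).congr_of_eventuallyEq ?_
    filter_upwards [h2.eventually h1, hY.root] with x hx hx'
    linear_combination hx hx'
  · exact hG b ⟨(b, y), hy⟩ (Metric.mem_ball_self (hr _)) ⟨y, hy⟩

theorem exists_punctured_ball (b : ℂ) : ∃ r > 0, ∀ x ∈ Metric.ball b r, x ≠ b → x ∈ K.Reg := by
  have h := eventually_eval_ne K.d_ne b
  rw [eventually_nhdsWithin_iff] at h
  obtain ⟨r, hr, hb⟩ := Metric.eventually_nhds_iff_ball.mp h
  exact ⟨r, hr, fun x hx hne => hb x hx hne⟩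

namespace End
variable (E : K.End)

theorem exists_local_inverse (z : ℂ) : ∃ ψ : ℂ → ℂ, ψ (E.X z) = z ∧
    HasDerivAt ψ (E.X' z)⁻¹ (E.X z) ∧ ∀ᶠ x in 𝓝 (E.X z), E.X (ψ x) = x := by
  have h1 : HasStrictDerivAt E.X (E.X' z) z := by
    have h2 : Differentiable ℂ E.X := fun z => (E.hasDerivAt z).differentiableAt
    have := (h2.analyticAt z).hasStrictDerivAt
    rwa [(E.hasDerivAt z).deriv] at this
  refine ⟨h1.localInverse _ _ _ (E.ne z), ?_, ?_, ?_⟩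
  · exact (h1.hasStrictFDerivAt_equiv (E.ne z)).localInverse_apply_image
  · exact (h1.to_localInverse (E.ne z)).hasDerivAt
  · exact (h1.hasStrictFDerivAt_equiv (E.ne z)).eventually_right_inverse

open Classical in
/-- The function near the end defined by a compatible family of functions on the sections. -/
noncomputable def descend (η : Fin K.N → ℂ → ℂ) (x y : ℂ) : ℂ :=
  if h : ∃ p : ℂ × Fin K.N, p.1 ∈ upperPlane E.A ∧ E.X p.1 = x ∧ E.Y p.2 p.1 = y then
    η h.choose.2 h.choose.1 else 0

variable {E} {η : Fin K.N → ℂ → ℂ}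

theorem add_nat_of_compat (hη : ∀ l, ∀ z ∈ upperPlane E.A, η l (z + 1) = η (E.σ l) z) (l : Fin K.N)
    {z : ℂ} (hz : z ∈ upperPlane E.A) (n : ℕ) : η l (z + n) = η ((E.σ ^ n) l) z := by
  induction n generalizing l with
  | zero => simp
  | succ n ih =>
    have : z + ((n + 1 : ℕ) : ℂ) = (z + n) + 1 := by push_cast; ring
    rw [this, hη l _ (add_nat_mem_upper hz n), ih, pow_succ, Equiv.Perm.mul_apply]

theorem descend_eq (hη : ∀ l, ∀ z ∈ upperPlane E.A, η l (z + 1) = η (E.σ l) z) (l : Fin K.N)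
    {z : ℂ} (hz : z ∈ upperPlane E.A) : E.descend η (E.X z) (E.Y l z) = η l z := by
  have h : ∃ p : ℂ × Fin K.N, p.1 ∈ upperPlane E.A ∧ E.X p.1 = E.X z ∧ E.Y p.2 p.1 = E.Y l z :=
    ⟨(z, l), hz, rfl, rfl⟩
  rw [descend, dif_pos h]
  obtain ⟨h1, h2, h3⟩ := h.choose_spec
  obtain ⟨n, ⟨a, b⟩ | ⟨a, b⟩⟩ := E.exists_pow_of_eq h1 hz h2 h3
  · rw [← b]
    conv_rhs => rw [a]
    exact (add_nat_of_compat hη l h1 n).symm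
  · conv_lhs => rw [a]
    rw [add_nat_of_compat hη _ hz n, b]

theorem hasDerivAt_descend (hη : ∀ l, ∀ z ∈ upperPlane E.A, η l (z + 1) = η (E.σ l) z)
    {w : ℂ → ℂ → ℂ} (hw : ∀ l, ∀ z ∈ upperPlane E.A,
      HasDerivAt (η l) (w (E.X z) (E.Y l z) * E.X' z) z) {z : ℂ} (hz : z ∈ upperPlane E.A)
    {Y : ℂ → ℂ} (hY : K.IsSection Y (E.X z)) :
    HasDerivAt (fun t => E.descend η t (Y t)) (w (E.X z) (Y (E.X z))) (E.X z) := by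
  obtain ⟨l, hl⟩ := (E.enum z hz).exists_eq hY.root_self
  obtain ⟨ψ, h1, h2, h3⟩ := E.exists_local_inverse z
  have hn := (isOpen_upper E.A).mem_nhds hz
  have hψ : ∀ᶠ x in 𝓝 (E.X z), ψ x ∈ upperPlane E.A :=
    h2.continuousAt.eventually (by rw [h1]; exact hn)
  obtain ⟨φ, f0, f1, f2⟩ := exists_isSection hY.reg hY.root_self
  have e1 : Y =ᶠ[𝓝 (E.X z)] φ := eventually_eq_of_section (ψ := id) continuousAt_id hY.cont hY.root f2
  have hcY : ContinuousAt (E.Y l ∘ ψ) (E.X z) := by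
    refine ContinuousAt.comp ?_ h2.continuousAt
    rw [h1]
    exact (E.diff l).continuousOn.continuousAt hn
  have e2 : E.Y l ∘ ψ =ᶠ[𝓝 (E.X z)] φ := by
    refine eventually_eq_of_section (K := K) (ψ := id) continuousAt_id hcY ?_ ?_
    · filter_upwards [hψ, h3] with x hx hx'
      have := E.root l hx
      rwa [hx'] at this
    · simpa [h1, hl] using f2
  have h4 : HasDerivAt (η l) (w (E.X z) (E.Y l z) * E.X' z) (ψ (E.X z)) := by
    rw [h1]; exact hw l z hz
  have h5 := h4.comp (E.X z) h2
  rw [mul_assoc, mul_inv_cancel₀ (E.ne z), mul_one, hl] at h5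
  refine h5.congr_of_eventuallyEq ?_
  filter_upwards [e1, e2, hψ, h3] with x a1 a2 a3 a4
  rw [a1, ← a2]
  have := descend_eq hη l a3
  rwa [a4] at this

end End
end PlaneCurve

namespace PlaneCurve
variable {K : PlaneCurve}

namespace End
variable {E : K.End} {b : ℂ}

theorem exists_lift (hX : map E.X atImInf = 𝓝[≠] b) : ∃ r > 0, ∀ x ∈ Metric.ball b r, x ≠ b →
    x ∈ K.Reg ∧ ∃ z ∈ upperPlane E.A, E.X z = x := by
  have h1 : ∀ᶠ x in 𝓝[≠] b, x ∈ K.Reg ∧ ∃ z ∈ upperPlane E.A, E.X z = x := by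
    rw [← hX, eventually_map]
    filter_upwards [upper_mem_atImInf E.A] with z hz using ⟨E.reg z hz, z, hz, rfl⟩
  rw [eventually_nhdsWithin_iff] at h1
  obtain ⟨r, hr, hb⟩ := Metric.eventually_nhds_iff_ball.mp h1
  exact ⟨r, hr, fun x hx hne => hb x hx hne⟩

theorem tendsto_X (hX : map E.X atImInf = 𝓝[≠] b) : Tendsto E.X atImInf (𝓝 b) :=
  (show Tendsto _ _ _ from hX.le).mono_right nhdsWithin_le_nhds

/-- A contractible curve is unibranch. -/
theorem sameCycle_of_limit_eq [ContractibleSpace K.Pt] (hb : b ∉ K.Reg)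
    (hX : map E.X atImInf = 𝓝[≠] b) {L : Fin K.N → ℂ}
    (hL : ∀ i, Tendsto (E.Y i) atImInf (𝓝 (L i))) (hLE : K.Enum b L) {i j : Fin K.N}
    (hij : L i = L j) : E.σ.SameCycle i j := by
  classical
  let η : Fin K.N → ℂ → ℂ := fun l _ => if E.σ.SameCycle i l then 1 else 0
  have hη : ∀ l, ∀ z ∈ upperPlane E.A, η l (z + 1) = η (E.σ l) z := fun l z _ => by
    simp only [η, Equiv.Perm.sameCycle_apply_right]
  obtain ⟨r, hr, hlift⟩ := exists_lift hX
  choose r₀ hr₀ hreg₀ using exists_punctured_ball (K := K)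
  obtain ⟨F, hF, hFp⟩ := exists_glued (K := K) (fun _ _ => 0)
    (fun b' => if b' = b then r else r₀ b')
    (fun b' => by split_ifs; exacts [hr, hr₀ b'])
    (fun b' x hx hne => by
      split_ifs at hx with h
      · subst h; exact (hlift x hx hne).1
      · exact hreg₀ b' x hx hne)
    (fun b' x y => if b' = b then E.descend η x y else 0)
    (fun b' x hx Y hY => by
      split_ifs at hx ⊢ with h
      · subst h
        have hne : x ≠ b' := by
          rintro rfl
          exact hb hY.reg
        obtain ⟨z, hz, rfl⟩ := (hlift x hx hne).2
        exact hasDerivAt_descend hη (w := fun _ _ => 0)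
          (fun l z _ => by simpa using hasDerivAt_const z (η l 0)) hz hY
      · exact hasDerivAt_const _ _)
  have h1 := hFp b (L i) (hLE.root i)
  simp only [if_true] at h1
  have key : ∀ l, L l = L i → ∀ᶠ z in atImInf, F (E.X z) (E.Y l z) - η l 0 =
      F b (L i) - E.descend η b (L i) := by
    intro l hl
    have h2 : Tendsto (fun z => (E.X z, E.Y l z)) atImInf (𝓝 (b, L i)) := by
      rw [← hl]; exact (tendsto_X hX).prodMk_nhds (hL l)
    filter_upwards [h2.eventually h1, upper_mem_atImInf E.A] with z hz hzA
    rw [← hz (E.root l hzA), descend_eq hη l hzA]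
  obtain ⟨z, h2, h3, hz⟩ := ((key i rfl).and ((key j hij.symm).and (upper_mem_atImInf E.A))).exists
  have h4 : η i 0 = η j 0 := by
    have h5 := hF.locConst.eq (E.reg z hz) (E.root i hz) (E.reg z hz) (E.root j hz)
    linear_combination h3 - h2 + h5
  by_contra hne
  simp only [η, hne, if_false, Equiv.Perm.SameCycle.refl, if_true] at h4
  exact one_ne_zero h4

end End

theorem Enum.sum_div_derivative {x : ℂ} {y : Fin K.N → ℂ} (h : K.Enum x y) (hx : x ∈ K.Reg)
    (Q : ℂ[X][X]) : ∑ i, Q.evalEval x (y i) / K.P.derivative.evalEval x (y i) =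
      ((Q %ₘ K.P).coeff (K.N - 1)).eval x := by
  set R := (Q %ₘ K.P).map (evalRingHom x) with hR
  have hdeg : R.degree < (Finset.univ : Finset (Fin K.N)).card := by
    rw [Finset.card_univ, Fintype.card_fin, N, ← degree_eq_natDegree K.monic.ne_zero]
    exact degree_map_le.trans_lt (degree_modByMonic_lt Q K.monic)
  have h1 := Lagrange.coeff_eq_sum (h.injective hx).injOn hdeg
  rw [Finset.card_univ, Fintype.card_fin] at h1
  have h2 : ((Q %ₘ K.P).coeff (K.N - 1)).eval x = R.coeff (K.N - 1) := by
    rw [hR, coeff_map, coe_evalRingHom]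
  rw [h2, h1]
  refine Finset.sum_congr rfl fun i _ => ?_
  rw [h.derivative_eval, hR, map_evalRingHom_eval]
  congr 1
  have h3 := congrArg (evalEval x (y i)) (modByMonic_add_div Q K.P)
  rw [evalEval_add, evalEval_mul, h.root, zero_mul, add_zero] at h3
  exact h3.symm

namespace End
variable {E : K.End} {b : ℂ}

theorem isBigO_one_of_bound {f : ℂ → ℂ} {M : ℝ} (h : ∀ᶠ z in atImInf, ‖f z‖ ≤ M) :
    f =O[atImInf] fun _ => (1 : ℂ) :=
  IsBigO.of_bound M (h.mono fun z hz => by simpa using hz)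

theorem isBigO_evalEval (hX : map E.X atImInf = 𝓝[≠] b) (g : ℂ[X][X]) (i : Fin K.N) :
    (fun z => g.evalEval (E.X z) (E.Y i z)) =O[atImInf] fun _ => (1 : ℂ) := by
  obtain ⟨M, hM⟩ := K.exists_local_bound g b
  refine isBigO_one_of_bound (M := M) ?_
  filter_upwards [(E.eventually_iff hX).mp (hM.filter_mono nhdsWithin_le_nhds)] with z hz using hz i

theorem isBigO_inv_eval (hX : map E.X atImInf = 𝓝[≠] b) {d : ℂ[X]} (hd : d ≠ 0) :
    ∃ m : ℕ, (fun z => (d.eval (E.X z))⁻¹) =O[atImInf] fun z => ((E.X z - b) ^ m)⁻¹ := by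
  obtain ⟨q, hq, hq'⟩ := exists_eq_pow_rootMultiplicity_mul_and_not_dvd d hd b
  refine ⟨rootMultiplicity b d, ?_⟩
  have h1 : q.eval b ≠ 0 := fun h => hq' (dvd_iff_isRoot.mpr h)
  have h2 : Tendsto (fun z => (q.eval (E.X z))⁻¹) atImInf (𝓝 (q.eval b)⁻¹) :=
    ((q.continuous.tendsto b).comp (tendsto_X hX)).inv₀ h1
  have h3 := (isBigO_refl (fun z => ((E.X z - b) ^ rootMultiplicity b d)⁻¹) atImInf).mul
    (h2.isBigO_one ℂ)
  refine (h3.congr_left fun z => ?_).congr_right fun z => by simp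
  conv_rhs => rw [hq]
  simp [mul_comm]

/-- The sum of the values of a regular differential over the points tending to a given point. -/
theorem isBigO_cluster (hX : map E.X atImInf = 𝓝[≠] b) (hXq : ∀ z, E.X z = b + qParam 1 z)
    {L : Fin K.N → ℂ} (hLY : ∀ i, ∀ k : ℕ, 0 < k → E.deg i ∣ k → ∃ y : ℂ → ℂ, AnalyticAt ℂ y 0 ∧
      y 0 = L i ∧ ∀ z ∈ upperPlane E.A, y (qParam k z) = E.Y i z) (g : ℂ[X][X]) (c : ℂ) :
    (fun z => ∑ j with L j = c, g.evalEval (E.X z) (E.Y j z) /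
      K.P.derivative.evalEval (E.X z) (E.Y j z)) =O[atImInf] fun _ => (1 : ℂ) := by
  classical
  set k := orderOf E.σ with hk
  have hk0 : 0 < k := orderOf_pos _
  have hkd : ∀ i, E.deg i ∣ k := fun i => by
    rw [← E.pow_eq_self_iff, hk, pow_orderOf_eq_one]; rfl
  obtain ⟨m, hm⟩ := isBigO_inv_eval hX K.d_ne
  have hY : ∀ i, (fun z => E.Y i z - L i) =O[atImInf] fun z => qParam k z := by
    intro i
    obtain ⟨y, h1, h2, h3⟩ := hLY i k hk0 (hkd i)
    have h4 := h1.differentiableAt.isBigO_sub.comp_tendsto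
      ((qParam_tendsto (show (0 : ℝ) < k by exact_mod_cast hk0)).mono_right nhdsWithin_le_nhds)
    refine (h4.congr' ?_ ?_)
    · filter_upwards [upper_mem_atImInf E.A] with z hz
      simp [h2, h3 z hz]
    · exact Eventually.of_forall fun z => by simp
  have hYt : ∀ i, Tendsto (E.Y i) atImInf (𝓝 (L i)) := by
    intro i
    have h1 := (hY i).trans_tendsto ((qParam_tendsto
      (show (0 : ℝ) < k by exact_mod_cast hk0)).mono_right nhdsWithin_le_nhds)
    simpa using h1.add_const (L i)
  have main : ∀ i, ∀ e : ℂ[X], (Polynomial.X - Polynomial.C (L i)) ^ (k * m) ∣ e →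
      (fun z => e.eval (E.Y i z) * (g.evalEval (E.X z) (E.Y i z) /
        K.P.derivative.evalEval (E.X z) (E.Y i z))) =O[atImInf] fun _ => (1 : ℂ) := by
    rintro i e ⟨e', rfl⟩
    have h1 : (fun z => e'.eval (E.Y i z)) =O[atImInf] fun _ => (1 : ℂ) :=
      ((e'.continuous.tendsto (L i)).comp (hYt i)).isBigO_one ℂ
    have h2 := ((((hY i).pow (k * m)).mul h1).mul (isBigO_evalEval hX (g * K.b) i)).mul hm
    refine h2.congr' ?_ ?_
    · filter_upwards [upper_mem_atImInf E.A] with z hz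
      have h3 := K.bezout_eval (E.root i hz)
      have h4 : K.d.eval (E.X z) ≠ 0 := E.reg z hz
      have h5 := K.derivative_ne (E.reg z hz) (E.root i hz)
      rw [evalEval_mul, eval_mul, eval_pow, eval_sub, eval_X, eval_C, ← h3]
      have h6 : K.b.evalEval (E.X z) (E.Y i z) ≠ 0 := fun h => h4 (by rw [← h3, h, zero_mul])
      field_simp
    · filter_upwards with z
      rw [mul_one, mul_one, hXq, add_sub_cancel_left, pow_mul, qParam_pow hk0]
      exact mul_inv_cancel₀ (pow_ne_zero _ (qParam_ne_zero z))
  have hcop : IsCoprime ((Polynomial.X - Polynomial.C c) ^ (k * m))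
      ((∏ j with L j ≠ c, (Polynomial.X - Polynomial.C (L j)) : ℂ[X]) ^ (k * m)) := by
    refine IsCoprime.pow (IsCoprime.prod_right fun j hj => ?_)
    refine isCoprime_X_sub_C_of_isUnit_sub ?_
    rw [isUnit_iff_ne_zero, sub_ne_zero]
    exact (by simpa using hj : L j ≠ c).symm
  obtain ⟨u, v, huv⟩ := hcop
  set e := v * (∏ j with L j ≠ c, (Polynomial.X - Polynomial.C (L j)) : ℂ[X]) ^ (k * m) with he
  set Q : ℂ[X][X] := e.map Polynomial.C * g with hQ
  have hQe : ∀ x y, Q.evalEval x y = e.eval y * g.evalEval x y := by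
    intro x y
    rw [hQ, evalEval_mul, evalEval_map_C]
  have t1 : (fun z => ((Q %ₘ K.P).coeff (K.N - 1)).eval (E.X z)) =O[atImInf] fun _ => (1 : ℂ) :=
    (((Q %ₘ K.P).coeff (K.N - 1)).continuous.tendsto b |>.comp (tendsto_X hX)).isBigO_one ℂ
  have t2 : (fun z => ∑ j with L j ≠ c, e.eval (E.Y j z) * (g.evalEval (E.X z) (E.Y j z) /
        K.P.derivative.evalEval (E.X z) (E.Y j z))) =O[atImInf] fun _ => (1 : ℂ) := by
    refine IsBigO.fun_sum fun j hj => main j e (Dvd.dvd.mul_left (pow_dvd_pow_of_dvd ?_ _) _)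
    exact Finset.dvd_prod_of_mem (fun j => (Polynomial.X - Polynomial.C (L j) : ℂ[X])) hj
  have t3 : (fun z => ∑ j with L j = c, (1 - e).eval (E.Y j z) * (g.evalEval (E.X z) (E.Y j z) /
        K.P.derivative.evalEval (E.X z) (E.Y j z))) =O[atImInf] fun _ => (1 : ℂ) := by
    refine IsBigO.fun_sum fun j hj => main j (1 - e) ?_
    have hj' : L j = c := by simpa using hj
    rw [hj', ← huv, add_sub_cancel_right]
    exact dvd_mul_left _ _
  refine ((t1.sub t2).add t3).congr' ?_ EventuallyEq.rfl
  filter_upwards [upper_mem_atImInf E.A] with z hz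
  rw [← (E.enum z hz).sum_div_derivative (E.reg z hz), ← Finset.sum_filter_add_sum_filter_not
    Finset.univ (fun j => L j = c), add_sub_assoc]
  simp only [hQe, mul_div_assoc, sub_self, add_zero, ne_eq]
  rw [← Finset.sum_add_distrib]
  refine Finset.sum_congr rfl fun j _ => ?_
  simp only [eval_sub, eval_one]
  ring

end End
end PlaneCurve

/-- The period of a function is the limit of its derivative. -/
theorem period_eq_of_tendsto {A : ℝ} {Θ Θ' : ℂ → ℂ} {κ c : ℂ}
    (h : ∀ z ∈ upperPlane A, HasDerivAt Θ (Θ' z) z) (hp : ∀ z ∈ upperPlane A, Θ (z + 1) - Θ z = κ)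
    (hc : Tendsto Θ' atImInf (𝓝 c)) : κ = c := by
  refine eq_of_sub_eq_zero (norm_le_zero_iff.mp (le_of_forall_pos_le_add fun ε hε => ?_))
  have h1 : ∀ᶠ z in atImInf, ‖Θ' z - c‖ ≤ ε :=
    (hc.eventually (Metric.closedBall_mem_nhds c hε)).mono fun z hz => by
      rwa [← dist_eq_norm]
  obtain ⟨B, hB⟩ := eventually_atImInf.mp (h1.and (upper_mem_atImInf A))
  obtain ⟨z, hz⟩ := nonempty_upper B
  have h2 := (convex_upper B).norm_image_sub_le_of_norm_hasDerivWithin_le (C := ε)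
    (f := fun z => Θ z - c * z) (f' := fun z => Θ' z - c)
    (fun z hz => (((h z (hB z hz).2).fun_sub ((hasDerivAt_id z).const_mul c)).congr_deriv
      (by simp)).hasDerivWithinAt) (fun z hz => (hB z hz).1) hz (add_one_mem_upper hz)
  have h3 : Θ (z + 1) - c * (z + 1) - (Θ z - c * z) = κ - c := by
    rw [← hp z (hB z hz).2]; ring
  rw [h3] at h2
  simpa using h2

namespace PlaneCurve
variable {K : PlaneCurve}
namespace End
variable (E : K.End)

theorem modEq_of_pow_eq {i : Fin K.N} {a b : ℕ} (h : (E.σ ^ a) i = (E.σ ^ b) i) :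
    a ≡ b [MOD E.deg i] := by
  wlog hab : a ≤ b generalizing a b
  · exact (this h.symm (le_of_not_ge hab)).symm
  rw [Nat.modEq_iff_dvd' hab, ← E.pow_eq_self_iff]
  apply (E.σ ^ a).injective
  rw [← Equiv.Perm.mul_apply, ← pow_add, Nat.add_sub_cancel' hab, h]

variable {E}

theorem add_nat_mul {f : ℂ → ℂ} {k : ℕ} (hp : ∀ z ∈ upperPlane E.A, f (z + k) = f z) (m : ℕ) {z : ℂ}
    (hz : z ∈ upperPlane E.A) : f (z + (k * m : ℕ)) = f z := by
  induction m with
  | zero => simp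
  | succ m ih =>
    rw [← ih, ← hp _ (add_nat_mem_upper hz (k * m))]
    congr 1; push_cast; ring

theorem add_nat_eq_of_modEq {f : ℂ → ℂ} {k a b : ℕ} (hp : ∀ z ∈ upperPlane E.A, f (z + k) = f z)
    (hab : a ≡ b [MOD k]) {z : ℂ} (hz : z ∈ upperPlane E.A) : f (z + a) = f (z + b) := by
  have h : ∀ c : ℕ, f (z + c) = f (z + (c % k : ℕ)) := fun c => by
    conv_lhs => rw [← Nat.mod_add_div c k]
    rw [Nat.cast_add, ← add_assoc, add_nat_mul hp _ (add_nat_mem_upper hz _)]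
  rw [h a, h b, hab]

theorem hasDerivAt_add_nat {w : ℂ → ℂ → ℂ} {η : ℂ → ℂ} {i : Fin K.N}
    (h : ∀ z ∈ upperPlane E.A, HasDerivAt η (w (E.X z) (E.Y i z) * E.X' z) z) (n : ℕ) {z : ℂ}
    (hz : z ∈ upperPlane E.A) :
    HasDerivAt (fun z => η (z + n)) (w (E.X z) (E.Y ((E.σ ^ n) i) z) * E.X' z) z := by
  have := (h _ (add_nat_mem_upper hz n)).comp_add_const z n
  rwa [E.X_add_nat, E.X'_add_nat, E.Y_add_nat i hz] at this

theorem exists_compatible {w : ℂ → ℂ → ℂ} {η : Fin K.N → ℂ → ℂ}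
    (h : ∀ i, ∀ z ∈ upperPlane E.A, HasDerivAt (η i) (w (E.X z) (E.Y i z) * E.X' z) z)
    (hp : ∀ i, ∀ z ∈ upperPlane E.A, η i (z + E.deg i) = η i z) :
    ∃ θ : Fin K.N → ℂ → ℂ, (∀ l, ∀ z ∈ upperPlane E.A, θ l (z + 1) = θ (E.σ l) z) ∧
      ∀ l, ∀ z ∈ upperPlane E.A, HasDerivAt (θ l) (w (E.X z) (E.Y l z) * E.X' z) z := by
  let S := Equiv.Perm.SameCycle.setoid E.σ
  let r : Fin K.N → Fin K.N := fun l => (Quotient.mk S l).out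
  have hr : ∀ l, ∃ n : ℕ, (E.σ ^ n) (r l) = l := fun l => by
    have h1 : E.σ.SameCycle (r l) l := Quotient.exact (Quotient.out_eq (Quotient.mk S l))
    obtain ⟨n, -, hn⟩ := h1.exists_pow_eq'
    exact ⟨n, hn⟩
  choose n hn using hr
  have hrσ : ∀ l, r (E.σ l) = r l := fun l => by
    have : Quotient.mk S (E.σ l) = Quotient.mk S l :=
      Quotient.sound (Equiv.Perm.sameCycle_apply_left.mpr (Equiv.Perm.SameCycle.refl _ _))
    simp only [r, this]
  refine ⟨fun l z => η (r l) (z + n l), fun l z hz => ?_, fun l z hz => ?_⟩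
  · have h1 : n l + 1 ≡ n (E.σ l) [MOD E.deg (r l)] := by
      apply E.modEq_of_pow_eq
      have := hn (E.σ l)
      rw [hrσ] at this
      rw [this, pow_succ', Equiv.Perm.mul_apply, hn]
    have h2 := add_nat_eq_of_modEq (hp (r l)) h1 hz
    simp only [hrσ]
    rw [← h2]
    congr 1; push_cast; ring
  · have := hasDerivAt_add_nat (h (r l)) (n l) hz
    rwa [hn] at this

/-- The period of a primitive along a branch. -/
theorem hasDerivAt_sum_branch {w : ℂ → ℂ → ℂ} {η : ℂ → ℂ} {i : Fin K.N}
    (h : ∀ z ∈ upperPlane E.A, HasDerivAt η (w (E.X z) (E.Y i z) * E.X' z) z) {z : ℂ}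
    (hz : z ∈ upperPlane E.A) :
    HasDerivAt (fun z => ∑ l ∈ Finset.range (E.deg i), η (z + l))
      (E.X' z * ∑ j ∈ E.branch i, w (E.X z) (E.Y j z)) z := by
  rw [E.sum_branch, Finset.mul_sum]
  refine (HasDerivAt.fun_sum fun l _ => hasDerivAt_add_nat h l hz).congr_deriv ?_
  exact Finset.sum_congr rfl fun l _ => mul_comm _ _

theorem sum_add_one_sub (η : ℂ → ℂ) (k : ℕ) (z : ℂ) :
    ∑ l ∈ Finset.range k, η (z + 1 + l) - ∑ l ∈ Finset.range k, η (z + l) = η (z + k) - η z := by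
  rw [← Finset.sum_sub_distrib]
  have := Finset.sum_range_sub (fun l : ℕ => η (z + l)) k
  simp only [Nat.cast_zero, add_zero] at this
  rw [← this]
  refine Finset.sum_congr rfl fun l _ => ?_
  congr 2; push_cast; ring

theorem exists_period {w : ℂ → ℂ → ℂ} {η : ℂ → ℂ} {i : Fin K.N}
    (h : ∀ z ∈ upperPlane E.A, HasDerivAt η (w (E.X z) (E.Y i z) * E.X' z) z) :
    ∃ κ, ∀ z ∈ upperPlane E.A, η (z + E.deg i) - η z = κ := by
  obtain ⟨z₀, hz₀⟩ := nonempty_upper E.A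
  refine ⟨_, fun z hz => ((isOpen_upper E.A).is_const_of_deriv_eq_zero (convex_upper _).isPreconnected
    (f := fun z => η (z + E.deg i) - η z) ?_ ?_ hz hz₀)⟩
  all_goals
    have h1 : ∀ z ∈ upperPlane E.A, HasDerivAt (fun z => η (z + E.deg i) - η z) 0 z := fun z hz => by
      have h1 := hasDerivAt_add_nat h (E.deg i) hz
      rw [(E.pow_eq_self_iff i _).mpr dvd_rfl] at h1
      exact (h1.fun_sub (h z hz)).congr_deriv (sub_self _)
  · exact fun z hz => (h1 z hz).differentiableAt.differentiableWithinAt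
  · exact fun z hz => (h1 z hz).deriv

theorem exists_compatible_primitive [ContractibleSpace K.Pt] {b : ℂ} (hb : b ∉ K.Reg)
    (hX : map E.X atImInf = 𝓝[≠] b) (hXq : ∀ z, E.X z = b + qParam 1 z)
    (hX' : ∀ z, E.X' z = 2 * Real.pi * Complex.I * qParam 1 z) (g : ℂ[X][X]) :
    ∃ θ : Fin K.N → ℂ → ℂ, (∀ l, ∀ z ∈ upperPlane E.A, θ l (z + 1) = θ (E.σ l) z) ∧
      ∀ l, ∀ z ∈ upperPlane E.A, HasDerivAt (θ l) (g.evalEval (E.X z) (E.Y l z) /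
        K.P.derivative.evalEval (E.X z) (E.Y l z) * E.X' z) z := by
  obtain ⟨L, hL, hLE, hLY⟩ := E.exists_limit hX
  have hσ : ∀ i, L (E.σ i) = L i := fun i => by
    refine tendsto_nhds_unique (hL (E.σ i)) (((hL i).comp (tendsto_add_atImInf 1)).congr' ?_)
    filter_upwards [upper_mem_atImInf E.A] with z hz using E.shift i z hz
  have hcyc : ∀ i j, E.σ.SameCycle i j → L i = L j := fun i j hij => by
    obtain ⟨n, -, rfl⟩ := hij.exists_pow_eq'
    induction n with
    | zero => rfl
    | succ n ih =>
      rw [pow_succ', Equiv.Perm.mul_apply, hσ]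
      exact ih ⟨n, by simp⟩
  have hbr : ∀ i, E.branch i = Finset.univ.filter fun j => L j = L i := fun i => by
    ext j
    rw [E.mem_branch, Finset.mem_filter]
    exact ⟨fun h => ⟨Finset.mem_univ _, (hcyc _ _ h).symm⟩,
      fun h => sameCycle_of_limit_eq hb hX hL hLE h.2.symm⟩
  let w : ℂ → ℂ → ℂ := fun x y => g.evalEval x y / K.P.derivative.evalEval x y
  have hw : ∀ i, DifferentiableOn ℂ (fun z => w (E.X z) (E.Y i z) * E.X' z) (upperPlane E.A) := by
    intro i z hz
    refine (DifferentiableAt.mul ?_ ?_).differentiableWithinAt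
    · exact E.differentiableAt_comp (HolZ.div_derivative (holZ_evalEval g)) i hz
    · have : E.X' = fun z => 2 * Real.pi * Complex.I * qParam 1 z := funext hX'
      rw [this]
      exact (hasDerivAt_qParam 1 z).differentiableAt.const_mul _
  choose η hη using fun i => exists_primitive_upper (hw i)
  refine exists_compatible (w := w) hη fun i z hz => ?_
  obtain ⟨κ, hκ⟩ := exists_period (hη i)
  have h0 : κ = 0 := by
    refine period_eq_of_tendsto (fun z hz => hasDerivAt_sum_branch (hη i) hz)
      (fun z hz => (sum_add_one_sub _ _ z).trans (hκ z hz)) ?_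
    have h1 := isBigO_cluster hX hXq hLY g (L i)
    rw [← hbr] at h1
    have h2 : Tendsto E.X' atImInf (𝓝 0) := by
      have : E.X' = fun z => 2 * Real.pi * Complex.I * qParam 1 z := funext hX'
      rw [this]
      simpa using ((qParam_tendsto one_pos).mono_right nhdsWithin_le_nhds).const_mul
        (2 * Real.pi * Complex.I)
    refine ((isBigO_refl E.X' atImInf).mul h1).trans_tendsto ?_
    simpa using h2
  rw [← sub_eq_zero, hκ z hz, h0]

end End

theorem exists_local_primitive {x₀ : ℂ} (hx₀ : x₀ ∈ K.Reg) {w : ℂ → ℂ → ℂ} (hw : K.HolZ w) :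
    ∃ r > 0, Metric.ball x₀ r ⊆ K.Reg ∧ ∃ f : ℂ → ℂ → ℂ, ∀ x ∈ Metric.ball x₀ r, ∀ Y,
      K.IsSection Y x → HasDerivAt (fun t => f t (Y t)) (w x (Y x)) x := by
  classical
  obtain ⟨r, hr, Y, hreg, hY, hE⟩ := K.exists_local_enum hx₀
  have h1 : ∀ i, ∃ H : ℂ → ℂ, ∀ x ∈ Metric.ball x₀ r, HasDerivAt H (w x (Y i x)) x := fun i => by
    refine DifferentiableOn.isExactOn_ball fun x hx => ?_
    refine (hw x (Y i) ⟨hreg hx, ?_, ?_⟩).differentiableWithinAt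
    · exact (hY i).continuousOn.continuousAt (Metric.isOpen_ball.mem_nhds hx)
    · filter_upwards [Metric.isOpen_ball.mem_nhds hx] with t ht using (hE t ht).root i
  choose H hH using h1
  refine ⟨r, hr, hreg, fun t y => ∑ i, if Y i t = y then H i t else 0, fun x hx S hS => ?_⟩
  obtain ⟨i, hi⟩ := (hE x hx).exists_eq hS.root_self
  obtain ⟨φ, f0, f1, f2⟩ := exists_isSection hS.reg hS.root_self
  have e1 : S =ᶠ[𝓝 x] φ := eventually_eq_of_section (ψ := id) continuousAt_id hS.cont hS.root f2
  have hc : ContinuousAt (Y i) x := (hY i).continuousOn.continuousAt (Metric.isOpen_ball.mem_nhds hx)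
  have e2 : Y i =ᶠ[𝓝 x] φ := by
    refine eventually_eq_of_section (K := K) (ψ := id) continuousAt_id hc ?_ ?_
    · filter_upwards [Metric.isOpen_ball.mem_nhds hx] with t ht using (hE t ht).root i
    · simpa [hi] using f2
  rw [← hi]
  refine (hH i x hx).congr_of_eventuallyEq ?_
  filter_upwards [e1, e2, Metric.isOpen_ball.mem_nhds hx] with t h1 h2 ht
  rw [h1, ← h2]
  have : ∀ j, (Y j t = Y i t) ↔ j = i := fun j => ((hE t ht).injective (hreg ht)).eq_iff
  simp [this]

/-- Regular differentials on a contractible curve are exact. -/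
theorem exists_primitive [ContractibleSpace K.Pt] (g : ℂ[X][X]) : ∃ η : ℂ → ℂ → ℂ,
    K.HasZDeriv η fun x y => g.evalEval x y / K.P.derivative.evalEval x y := by
  have h : ∀ b : ℂ, ∃ r > 0, (∀ x ∈ Metric.ball b r, x ≠ b → x ∈ K.Reg) ∧ ∃ f : ℂ → ℂ → ℂ,
      ∀ x ∈ Metric.ball b r, ∀ Y, K.IsSection Y x → HasDerivAt (fun t => f t (Y t))
        (g.evalEval x (Y x) / K.P.derivative.evalEval x (Y x)) x := by
    intro b
    by_cases hb : b ∈ K.Reg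
    · obtain ⟨r, hr, h1, h2⟩ := exists_local_primitive hb (HolZ.div_derivative (holZ_evalEval g))
      exact ⟨r, hr, fun x hx _ => h1 hx, h2⟩
    · obtain ⟨E, hXq, hX', hX⟩ := K.exists_End_at b
      obtain ⟨r, hr, hlift⟩ := End.exists_lift hX
      obtain ⟨θ, h1, h2⟩ := End.exists_compatible_primitive hb hX hXq hX' g
      refine ⟨r, hr, fun x hx hne => (hlift x hx hne).1, E.descend θ, fun x hx Y hY => ?_⟩
      have hne : x ≠ b := by
        rintro rfl
        exact hb hY.reg
      obtain ⟨z, hz, rfl⟩ := (hlift x hx hne).2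
      exact End.hasDerivAt_descend h1 (w := fun x y => g.evalEval x y /
        K.P.derivative.evalEval x y) h2 hz hY
  choose r hr hreg f hf using h
  obtain ⟨F, hF, -⟩ := exists_glued (fun x y => g.evalEval x y /
    K.P.derivative.evalEval x y) r hr hreg f hf
  exact ⟨F, hF⟩

end PlaneCurve

theorem AnalyticAt.dslope_self {V : ℂ → ℂ} {c : ℂ} (hV : AnalyticAt ℂ V c) : AnalyticAt ℂ (dslope V c) c :=
  let ⟨_, hp⟩ := hV
  ⟨_, hp.has_fpower_series_dslope_fslope⟩

/-- The principal part of a meromorphic function is a polynomial in the inverse of the parameter. -/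
theorem exists_principal_part (s : ℕ) {V : ℂ → ℂ} (hV : AnalyticAt ℂ V 0) :
    ∃ (p : ℂ[X]) (V₁ : ℂ → ℂ), AnalyticAt ℂ V₁ 0 ∧
      ∀ q ≠ 0, V q * q⁻¹ ^ s = p.eval q⁻¹ + q * V₁ q := by
  have h0 : ∀ q, V q = V 0 + q * dslope V 0 q := fun q => by
    have := sub_smul_dslope V 0 q
    rw [sub_zero, smul_eq_mul] at this
    rw [this]; ring
  induction s generalizing V with
  | zero => exact ⟨C (V 0), dslope V 0, hV.dslope_self, fun q _ => by simp [← h0]⟩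
  | succ s ih =>
    obtain ⟨p, V₁, h1, h2⟩ := ih hV.dslope_self fun q => by
      have := sub_smul_dslope (dslope V 0) 0 q
      rw [sub_zero, smul_eq_mul] at this
      rw [this]; ring
    refine ⟨p + C (V 0) * X ^ (s + 1), V₁, h1, fun q hq => ?_⟩
    simp only [eval_add, eval_mul, eval_C, eval_pow, eval_X]
    have h3 : V q * q⁻¹ ^ (s + 1) = V 0 * q⁻¹ ^ (s + 1) + dslope V 0 q * q⁻¹ ^ s := by
      rw [h0 q, pow_succ]; field_simp
    rw [h3, h2 q hq]; ring

theorem Polynomial.exists_derivative_eq (p : ℂ[X]) : ∃ q : ℂ[X], derivative q = p := by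
  induction p using Polynomial.induction_on' with
  | add p q hp hq =>
    obtain ⟨a, rfl⟩ := hp
    obtain ⟨b, rfl⟩ := hq
    exact ⟨a + b, derivative_add⟩
  | monomial n a =>
    refine ⟨monomial (n + 1) (a / (n + 1)), ?_⟩
    rw [derivative_monomial]
    have : (n : ℂ) + 1 ≠ 0 := Nat.cast_add_one_ne_zero n
    simp [this]

theorem Polynomial.exists_lower_bound {d : ℂ[X]} (hd : d ≠ 0) :
    ∃ c > 0, ∀ᶠ x in Bornology.cobounded ℂ, c ≤ ‖d.eval x‖ := by
  rcases Nat.eq_zero_or_pos d.natDegree with h | h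
  · rw [eq_C_of_natDegree_eq_zero h] at hd ⊢
    refine ⟨‖d.coeff 0‖, norm_pos_iff.mpr (by simpa using hd), by simp⟩
  · exact ⟨1, one_pos, (tendsto_norm_atTop d (natDegree_pos_iff_degree_pos.mp h)
      tendsto_norm_cobounded_atTop).eventually_ge_atTop 1⟩

namespace PlaneCurve
variable {K : PlaneCurve}

namespace End
variable {E : K.End}

theorem tendsto_q_infty : Tendsto (qParam 1) atImInf (𝓝 0) :=
  (qParam_tendsto one_pos).mono_right nhdsWithin_le_nhds

theorem exists_growth_div (hX : map E.X atImInf = Bornology.cobounded ℂ) (g : ℂ[X][X]) :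
    ∃ C : ℝ, ∃ s : ℕ, ∀ᶠ z in atImInf, ∀ i, ‖g.evalEval (E.X z) (E.Y i z) /
      K.P.derivative.evalEval (E.X z) (E.Y i z)‖ ≤ C * ‖E.X z‖ ^ s := by
  obtain ⟨C, s, hC⟩ := K.exists_growth (g * K.b)
  obtain ⟨c, hc, hcd⟩ := exists_lower_bound K.d_ne
  refine ⟨C / c, s, ?_⟩
  have h1 : ∀ᶠ z in atImInf, c ≤ ‖K.d.eval (E.X z)‖ ∧ 1 ≤ ‖E.X z‖ := by
    have := hcd.and (eventually_cobounded_le_norm 1)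
    rwa [← hX, eventually_map] at this
  filter_upwards [h1, upper_mem_atImInf E.A] with z hz hzA i
  have h2 := K.bezout_eval (E.root i hzA)
  have h3 := hC _ hz.2 _ (E.root i hzA)
  have h4 := K.derivative_ne (E.reg z hzA) (E.root i hzA)
  have h5 : K.d.eval (E.X z) ≠ 0 := E.reg z hzA
  have h6 : g.evalEval (E.X z) (E.Y i z) / K.P.derivative.evalEval (E.X z) (E.Y i z) =
      (g * K.b).evalEval (E.X z) (E.Y i z) / K.d.eval (E.X z) := by
    rw [evalEval_mul, div_eq_div_iff h4 h5, ← h2]; ring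
  rw [h6, norm_div]
  calc _ ≤ C * ‖E.X z‖ ^ s / c :=
        div_le_div₀ ((norm_nonneg _).trans h3) h3 hc hz.1
    _ = _ := by ring

/-- The partial trace over a branch at infinity of a regular differential is a polynomial. -/
theorem exists_branch_sum_eq [ContractibleSpace K.Pt] (hX : map E.X atImInf = Bornology.cobounded ℂ)
    (hXq : ∀ z, E.X z = (qParam 1 z)⁻¹)
    (hX' : ∀ z, E.X' z = -(2 * Real.pi * Complex.I) * (qParam 1 z)⁻¹) (i : Fin K.N) (g : ℂ[X][X]) :
    ∃ p : ℂ[X], ∀ z ∈ upperPlane E.A, ∑ j ∈ E.branch i, g.evalEval (E.X z) (E.Y j z) /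
      K.P.derivative.evalEval (E.X z) (E.Y j z) = p.eval (E.X z) := by
  set F : ℂ → ℂ := fun z => ∑ j ∈ E.branch i, g.evalEval (E.X z) (E.Y j z) /
      K.P.derivative.evalEval (E.X z) (E.Y j z) with hF
  have hq0 : ∀ z, qParam 1 z ≠ 0 := fun z => qParam_ne_zero z
  have hFd : DifferentiableOn ℂ F (upperPlane E.A) := fun z hz =>
    (DifferentiableAt.fun_sum fun j _ => E.differentiableAt_comp
      (HolZ.div_derivative (holZ_evalEval g)) j hz).differentiableWithinAt
  have hXd : Differentiable ℂ E.X := fun z => (E.hasDerivAt z).differentiableAt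
  have hX1 : ∀ z, E.X (z + 1) = E.X z := fun z => by simpa using E.X_add_nat z 1
  have hFp : ∀ z ∈ upperPlane E.A, F (z + 1) = F z := by
    intro z hz
    simp only [hF, hX1]
    refine Finset.sum_equiv E.σ (fun j => ?_) fun j _ => by rw [E.shift j z hz]
    rw [E.mem_branch, E.mem_branch, Equiv.Perm.sameCycle_apply_right]
  obtain ⟨C, s, hC⟩ := exists_growth_div hX g
  obtain ⟨V, hV1, -, -, hV2⟩ := exists_cusp (A := E.A) (k := 1) one_pos
    (f := fun z => qParam 1 z ^ s * F z)
    (fun z hz => ((hasDerivAt_qParam 1 z).differentiableAt.pow s).differentiableWithinAt.mul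
      (hFd z hz)) (fun z hz => by
        have h1 := (qParam_one_eq_iff z (z + 1)).mpr ⟨1, by simp⟩
        simp only [Nat.cast_one, hFp z hz, ← h1])
  have hVan : AnalyticAt ℂ V 0 := by
    refine hV2 ((E.branch i).card * C) ?_
    filter_upwards [hC] with z hz
    have h1 : ‖F z‖ ≤ (E.branch i).card * (C * ‖E.X z‖ ^ s) := by
      refine (norm_sum_le _ _).trans ((Finset.sum_le_sum fun j _ => hz j).trans ?_)
      simp
    rw [norm_mul, norm_pow]
    calc _ ≤ ‖qParam 1 z‖ ^ s * ((E.branch i).card * (C * ‖E.X z‖ ^ s)) := by gcongr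
      _ = (E.branch i).card * C * (‖qParam 1 z‖ ^ s * ‖E.X z‖ ^ s) := by ring
      _ = _ := by
        rw [← mul_pow, ← norm_mul, hXq, mul_inv_cancel₀ (hq0 z)]; simp
  obtain ⟨p, V₁, hV₁, hp⟩ := exists_principal_part s hVan
  have hFV : ∀ z ∈ upperPlane E.A, F z = p.eval (E.X z) + qParam 1 z * V₁ (qParam 1 z) := by
    intro z hz
    have h1 := hV1 z hz
    rw [Nat.cast_one] at h1
    rw [hXq, ← hp _ (hq0 z), h1, mul_right_comm, ← mul_pow, mul_inv_cancel₀ (hq0 z), one_pow, one_mul]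
  have hzero : ∀ᶠ q in 𝓝 0, V₁ q = 0 := by
    by_contra hne
    obtain ⟨n, U, hU, hU0, hUe⟩ := hV₁.exists_eventuallyEq_pow_smul_nonzero_iff.mpr hne
    obtain ⟨η, hη⟩ := exists_primitive (K := K) (Polynomial.C (Polynomial.X ^ n) * g)
    obtain ⟨w, hw⟩ : ∃ w : ℂ → ℂ → ℂ, w = fun x y =>
        (Polynomial.C (Polynomial.X ^ n) * g).evalEval x y / K.P.derivative.evalEval x y := ⟨_, rfl⟩
    rw [← hw] at hη
    obtain ⟨Q, hQ⟩ := exists_derivative_eq (Polynomial.X ^ n * p)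
    have h1 : ∀ z ∈ upperPlane E.A, HasDerivAt (fun z => ∑ l ∈ Finset.range (E.deg i),
        η (E.X (z + l)) (E.Y i (z + l)) - Q.eval (E.X z))
        (E.X' z * (E.X z ^ n * (F z - p.eval (E.X z)))) z := by
      intro z hz
      have h1 := hasDerivAt_sum_branch (η := fun z => η (E.X z) (E.Y i z)) (i := i)
        (fun z hz => E.hasDerivAt_comp hη i hz) hz
      have h2 := (Q.hasDerivAt (E.X z)).comp z (E.hasDerivAt z)
      rw [hQ] at h2
      refine ((h1.fun_sub h2).congr_of_eventuallyEq ?_).congr_deriv ?_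
      · filter_upwards with z
        simp
      · rw [hF, mul_sub, mul_sub]
        congr 1
        · congr 1
          rw [Finset.mul_sum]
          refine Finset.sum_congr rfl fun j _ => ?_
          rw [hw]
          simp only [evalEval_mul, evalEval_C, eval_pow, eval_X, mul_div_assoc]
        · simp; ring
    have h2 := period_eq_of_tendsto (κ := 0) (c := -(2 * Real.pi * Complex.I) * U 0) h1 ?_ ?_
    · exact mul_ne_zero (neg_ne_zero.mpr Complex.two_pi_I_ne_zero) hU0 h2.symm
    · intro z hz
      have h3 := sum_add_one_sub (fun z => η (E.X z) (E.Y i z)) (E.deg i) z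
      rw [E.X_add_nat, E.Y_add_deg i hz, sub_self] at h3
      simp only [hX1]
      linear_combination h3
    · refine ((hU.continuousAt.tendsto.comp tendsto_q_infty).const_mul _).congr' ?_
      filter_upwards [tendsto_q_infty.eventually hUe, upper_mem_atImInf E.A] with z hz hzA
      have := hq0 z
      rw [hFV z hzA, hX', hXq, hz]
      simp only [Function.comp_apply, sub_zero, smul_eq_mul, add_sub_cancel_left, inv_pow]
      field_simp
  obtain ⟨B, hB⟩ := eventually_atImInf.mp ((tendsto_q_infty.eventually hzero).and
    (upper_mem_atImInf E.A))
  obtain ⟨z₀, hz₀⟩ := nonempty_upper B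
  refine ⟨p, AnalyticOnNhd.eqOn_of_preconnected_of_eventuallyEq
    (hFd.analyticOnNhd (isOpen_upper _))
    (fun z _ => (p.differentiable.comp hXd).analyticAt z)
    (convex_upper _).isPreconnected (hB z₀ hz₀).2 ?_⟩
  filter_upwards [(isOpen_upper B).mem_nhds hz₀] with z hz
  rw [show (∑ j ∈ E.branch i, _) = F z from rfl, hFV z (hB z hz).2, (hB z hz).1, mul_zero, add_zero]

/-- A contractible curve has one place at infinity. -/
theorem sameCycle_infty [ContractibleSpace K.Pt] (hX : map E.X atImInf = Bornology.cobounded ℂ)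
    (hXq : ∀ z, E.X z = (qParam 1 z)⁻¹)
    (hX' : ∀ z, E.X' z = -(2 * Real.pi * Complex.I) * (qParam 1 z)⁻¹) (i j : Fin K.N) :
    E.σ.SameCycle i j := by
  classical
  set Ω : Set ℂ := E.X '' upperPlane E.A with hΩ
  have hΩm : Ω ∈ Bornology.cobounded ℂ := by
    rw [← hX]
    exact image_mem_map (upper_mem_atImInf E.A)
  have hΩi : Ω.Infinite := fun hf => by
    have h1 : Ωᶜ ∈ Bornology.cobounded ℂ := by
      rw [← Bornology.isBounded_def]; exact hf.isBounded
    have h2 := inter_mem hΩm h1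
    rw [Set.inter_compl_self] at h2
    exact empty_notMem _ h2
  let s : ℂ → ℂ → ℂ := fun x y =>
    if ∃ l ∈ E.branch i, ∃ z ∈ upperPlane E.A, E.X z = x ∧ E.Y l z = y then 1 else 0
  have hs : ∀ l, ∀ z ∈ upperPlane E.A, s (E.X z) (E.Y l z) = if l ∈ E.branch i then 1 else 0 := by
    intro l z hz
    refine if_congr ⟨?_, fun h => ⟨l, h, z, hz, rfl, rfl⟩⟩ rfl rfl
    rintro ⟨m, hm, z', hz', h1, h2⟩
    rw [E.mem_branch] at hm ⊢
    exact hm.trans (E.sameCycle_of_eq hz' hz h1 h2)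
  have hmain := eq_zero_or_eq_one hΩi (by rintro _ ⟨z, hz, rfl⟩; exact E.reg z hz) (s := s)
    (fun x _ y _ => by simp only [s]; split_ifs <;> simp) (e := 1) (by simp) fun k => by
      obtain ⟨p, hp⟩ := exists_branch_sum_eq hX hXq hX' i (Polynomial.X ^ k)
      refine ⟨p, ?_⟩
      rintro _ ⟨z, hz, rfl⟩ y hy
      rw [eval_one, one_mul, ← hy.trace_eq (fun x t => s x t * t ^ k / K.P.derivative.evalEval x t),
        (E.enum z hz).trace_eq, ← hp z hz, ← Finset.sum_filter_add_sum_filter_not Finset.univ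
          (fun l => l ∈ E.branch i)]
      rw [Finset.sum_eq_zero (s := Finset.univ.filter fun l => l ∉ E.branch i), add_zero]
      · have : E.branch i = Finset.univ.filter fun l => l ∈ E.branch i := by ext; simp
        rw [← this]
        refine Finset.sum_congr rfl fun l hl => ?_
        rw [hs l z hz, if_pos hl]
        simp
      · intro l hl
        rw [hs l z hz, if_neg (by simpa using hl)]
        simp
  obtain ⟨z, hz⟩ := nonempty_upper E.A
  rcases hmain with h | h
  · have := h _ ⟨z, hz, rfl⟩ _ (E.root i hz)
    rw [hs i z hz, if_pos (E.mem_branch.mpr (Equiv.Perm.SameCycle.refl _ _))] at this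
    exact absurd this one_ne_zero
  · have := h _ ⟨z, hz, rfl⟩ _ (E.root j hz)
    rw [hs j z hz] at this
    by_contra hj
    rw [← E.mem_branch] at hj
    simp [hj] at this

end End
end PlaneCurve

theorem AnalyticAt.exists_primitive {V : ℂ → ℂ} {c : ℂ} (hV : AnalyticAt ℂ V c) :
    ∃ R : ℂ → ℂ, AnalyticAt ℂ R c ∧ ∀ᶠ τ in 𝓝 c, HasDerivAt R (V τ) τ := by
  obtain ⟨r, hr, hb⟩ := Metric.eventually_nhds_iff_ball.mp hV.eventually_analyticAt
  obtain ⟨R, hR⟩ : ∃ R : ℂ → ℂ, ∀ w ∈ Metric.ball c r, HasDerivAt R (V w) w :=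
    DifferentiableOn.isExactOn_ball fun x hx => (hb x hx).differentiableAt.differentiableWithinAt
  refine ⟨R, ?_, eventually_of_mem (Metric.ball_mem_nhds c hr) hR⟩
  exact DifferentiableOn.analyticAt (s := Metric.ball c r)
    (fun x hx => (hR x hx).differentiableAt.differentiableWithinAt) (Metric.ball_mem_nhds c hr)

/-- A primitive of a function with a pole has a pole of smaller order. -/
theorem exists_eq_div_of_hasDerivAt (c : ℕ) {V G : ℂ → ℂ} (hV : AnalyticAt ℂ V 0)
    (hG : ∀ᶠ τ in 𝓝[≠] 0, HasDerivAt G (V τ / τ ^ (c + 1)) τ) :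
    ∃ U : ℂ → ℂ, AnalyticAt ℂ U 0 ∧ ∀ᶠ τ in 𝓝[≠] 0, G τ = U τ / τ ^ c := by
  have hV0 : ∀ q, V q = V 0 + q * dslope V 0 q := fun q => by
    have := sub_smul_dslope V 0 q
    rw [sub_zero, smul_eq_mul] at this
    rw [this]; ring
  have hne : ∀ᶠ τ : ℂ in 𝓝[≠] 0, τ ≠ 0 := self_mem_nhdsWithin
  induction c generalizing V G with
  | zero =>
    obtain ⟨R, hR, hR'⟩ := hV.dslope_self.exists_primitive
    have h1 : ∀ᶠ τ in 𝓝[≠] 0, HasDerivAt (fun τ => G τ - R τ) (V 0 / τ) τ := by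
      filter_upwards [hG, hR'.filter_mono nhdsWithin_le_nhds, hne] with τ h1 h2 h3
      refine (h1.fun_sub h2).congr_deriv ?_
      rw [hV0 τ]
      field_simp
      ring
    rw [← map_qParam one_pos, eventually_map] at h1
    obtain ⟨A, hA⟩ := eventually_atImInf.mp h1
    have h2 : ∀ z ∈ upperPlane A, HasDerivAt (fun z => G (qParam 1 z) - R (qParam 1 z))
        (V 0 * (2 * Real.pi * Complex.I)) z := by
      intro z hz
      refine ((hA z hz).comp z (hasDerivAt_qParam 1 z)).congr_deriv ?_
      have := qParam_ne_zero (h := 1) z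
      rw [Complex.ofReal_one, div_one]
      field_simp
    have h3 : V 0 = 0 := by
      have h3 := period_eq_of_tendsto h2 (κ := 0) (fun z _ => by
        rw [← (qParam_one_eq_iff z (z + 1)).mpr ⟨1, by simp⟩, sub_self]) tendsto_const_nhds
      exact (mul_eq_zero.mp h3.symm).resolve_right Complex.two_pi_I_ne_zero
    obtain ⟨z₀, hz₀⟩ := nonempty_upper A
    have h4 : ∀ z ∈ upperPlane A, G (qParam 1 z) - R (qParam 1 z) =
        G (qParam 1 z₀) - R (qParam 1 z₀) := fun z hz =>
      (isOpen_upper A).is_const_of_deriv_eq_zero (convex_upper _).isPreconnected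
        (f := fun z => G (qParam 1 z) - R (qParam 1 z))
        (fun z hz => (h2 z hz).differentiableAt.differentiableWithinAt)
        (fun z hz => by rw [(h2 z hz).deriv, h3, zero_mul]; rfl) hz hz₀
    refine ⟨fun τ => R τ + (G (qParam 1 z₀) - R (qParam 1 z₀)), hR.add analyticAt_const, ?_⟩
    rw [← map_qParam one_pos, eventually_map]
    filter_upwards [upper_mem_atImInf A] with z hz
    rw [← h4 z hz]
    simp
  | succ c ih =>
    have hc : (c : ℂ) + 1 ≠ 0 := Nat.cast_add_one_ne_zero c
    obtain ⟨U, hU, hU'⟩ := ih (V := dslope V 0) (G := fun τ => G τ + V 0 / (c + 1) * (τ ^ (c + 1))⁻¹)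
      hV.dslope_self (by
        filter_upwards [hG, hne] with τ h1 h3
        refine (h1.fun_add ((((hasDerivAt_pow (c + 1) τ).inv (pow_ne_zero _ h3))).const_mul
          (V 0 / (c + 1)))).congr_deriv ?_
        rw [hV0 τ]
        push_cast
        field_simp
        ring) (fun q => by
          have := sub_smul_dslope (dslope V 0) 0 q
          rw [sub_zero, smul_eq_mul] at this
          rw [this]; ring)
    refine ⟨fun τ => τ * U τ - V 0 / (c + 1), (analyticAt_id.mul hU).sub analyticAt_const, ?_⟩
    filter_upwards [hU', hne] with τ h1 h2
    have h3 : G τ = U τ / τ ^ c - V 0 / (c + 1) * (τ ^ (c + 1))⁻¹ := by rw [← h1]; ring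
    rw [h3]
    field_simp
    ring

theorem isBigO_of_hasDerivAt_pow (m : ℕ) {V G : ℂ → ℂ} (hV : AnalyticAt ℂ V 0)
    (hG : ∀ᶠ τ in 𝓝[≠] 0, HasDerivAt G (V τ * τ ^ m) τ) :
    ∃ e, (fun τ => G τ - e) =O[𝓝[≠] 0] fun τ => τ ^ (m + 1) := by
  have hne : ∀ᶠ τ : ℂ in 𝓝[≠] 0, τ ≠ 0 := self_mem_nhdsWithin
  obtain ⟨R, hR, hR'⟩ := (hV.mul (analyticAt_id.pow m)).exists_primitive
  obtain ⟨U, hU, hU'⟩ := exists_eq_div_of_hasDerivAt 0 (V := 0) (G := fun τ => G τ - R τ)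
    analyticAt_const (by
      filter_upwards [hG, hR'.filter_mono nhdsWithin_le_nhds] with τ h1 h2
      exact (h1.fun_sub h2).congr_deriv (by simp))
  have hD : ∀ᶠ τ in 𝓝[≠] 0, HasDerivAt U 0 τ := by
    have h3 := eventually_eventually_nhdsWithin.mpr hU'
    filter_upwards [h3, hG, hR'.filter_mono nhdsWithin_le_nhds, hne] with τ h1 h2 h4 h5
    have h6 : ∀ᶠ σ in 𝓝 τ, G σ - R σ = U σ / σ ^ 0 := by
      rwa [nhdsWithin_eq_nhds.mpr] at h1
      exact isOpen_compl_singleton.mem_nhds h5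
    refine ((h2.fun_sub h4).congr_of_eventuallyEq ?_).congr_deriv (by simp)
    filter_upwards [h6] with σ h; rw [h]; simp
  have hD' : ∀ᶠ τ in 𝓝 0, HasDerivAt U 0 τ := by
    have h1 : ∀ᶠ τ in 𝓝 (0 : ℂ), deriv U τ = 0 := by
      refine (hU.deriv.continuousAt.eventuallyEq_nhds_iff_eventuallyEq_nhdsNE
        continuousAt_const).mp ?_
      exact hD.mono fun τ h => h.deriv
    filter_upwards [h1, hU.eventually_analyticAt] with τ h1 h2
    rw [← h1]
    exact h2.differentiableAt.hasDerivAt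
  have hU0 := eventually_eq_of_hasDerivAt_zero hD'
  refine ⟨R 0 + U 0, ?_⟩
  obtain ⟨M, hM⟩ := (hV.continuousAt.isBigO_one ℂ).bound
  obtain ⟨r, hr, hb⟩ := Metric.eventually_nhds_iff_ball.mp (hM.and hR')
  refine IsBigO.of_bound M ?_
  filter_upwards [hU', hU0.filter_mono nhdsWithin_le_nhds,
    nhdsWithin_le_nhds (Metric.ball_mem_nhds (0 : ℂ) hr)] with τ h1 h2 h3
  have h4 : G τ - (R 0 + U 0) = R τ - R 0 := by
    rw [pow_zero, div_one, h2] at h1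
    linear_combination h1
  have hsub : Metric.closedBall (0 : ℂ) ‖τ‖ ⊆ Metric.ball 0 r :=
    Metric.closedBall_subset_ball (by simpa using h3)
  have h5 := (convex_closedBall (0 : ℂ) ‖τ‖).norm_image_sub_le_of_norm_hasDerivWithin_le
    (f := R) (C := M * ‖τ‖ ^ m) (fun σ hσ => (hb σ (hsub hσ)).2.hasDerivWithinAt) (fun σ hσ => ?_)
    (Metric.mem_closedBall_self (norm_nonneg τ)) (show τ ∈ _ by simp)
  · rw [h4, norm_pow, pow_succ, ← mul_assoc]
    simpa using h5
  · have h6 := (hb σ (hsub hσ)).1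
    have h7 : ‖σ‖ ≤ ‖τ‖ := by simpa using hσ
    simp only [norm_one, mul_one] at h6
    simp only [Pi.mul_apply, Pi.pow_apply, id, norm_mul, norm_pow]
    gcongr
    exact (norm_nonneg _).trans h6

theorem exists_isBigO_of_hasDerivAt_inv {W G : ℂ → ℂ} (hW : MeromorphicAt W 0)
    (hW0 : ∀ᶠ τ in 𝓝[≠] 0, W τ ≠ 0) (hG : ∀ᶠ τ in 𝓝[≠] 0, HasDerivAt G (W τ)⁻¹ τ) :
    ∃ e, (fun τ => W τ * (G τ - e)) =O[𝓝[≠] 0] fun τ => τ := by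
  have hne : ∀ᶠ τ : ℂ in 𝓝[≠] 0, τ ≠ 0 := self_mem_nhdsWithin
  have htop : meromorphicOrderAt W 0 ≠ ⊤ := by
    rw [Ne, meromorphicOrderAt_eq_top_iff]
    intro h
    obtain ⟨τ, h1, h2⟩ := (h.and hW0).exists
    exact h2 h1
  obtain ⟨n, hn⟩ := WithTop.ne_top_iff_exists.mp htop
  obtain ⟨W₁, h1, h2, h3⟩ := (meromorphicOrderAt_eq_int_iff hW).mp hn.symm
  have hW1 : W₁ =O[𝓝[≠] 0] fun _ => (1 : ℂ) :=
    (h1.continuousAt.isBigO_one ℂ).mono nhdsWithin_le_nhds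
  have hV : AnalyticAt ℂ (fun τ => (W₁ τ)⁻¹) 0 := h1.inv h2
  rcases le_or_gt n 0 with hn0 | hn0
  · obtain ⟨m, hm⟩ : ∃ m : ℕ, n = -m := ⟨n.natAbs, by omega⟩
    obtain ⟨e, he⟩ := isBigO_of_hasDerivAt_pow m hV (G := G) (by
      filter_upwards [hG, h3] with τ h4 h5
      rw [h5, sub_zero, smul_eq_mul, mul_inv, hm, zpow_neg, inv_inv, zpow_natCast, mul_comm] at h4
      exact h4)
    refine ⟨e, ((hW1.mul he).mul (isBigO_refl (fun τ => (τ ^ m)⁻¹) _)).congr' ?_ ?_⟩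
    · filter_upwards [h3] with τ h5
      rw [h5, sub_zero, smul_eq_mul, hm, zpow_neg, zpow_natCast]; ring
    · filter_upwards [hne] with τ h
      field_simp
      ring
  · obtain ⟨c, hc⟩ : ∃ c : ℕ, n = (c + 1 : ℕ) := ⟨n.natAbs - 1, by omega⟩
    obtain ⟨U, hU, hU'⟩ := exists_eq_div_of_hasDerivAt c hV (G := G) (by
      filter_upwards [hG, h3] with τ h4 h5
      rw [h5, sub_zero, smul_eq_mul, mul_inv, hc, zpow_natCast, mul_comm, ← div_eq_mul_inv] at h4
      exact h4)
    have hU1 : U =O[𝓝[≠] 0] fun _ => (1 : ℂ) :=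
      (hU.continuousAt.isBigO_one ℂ).mono nhdsWithin_le_nhds
    refine ⟨0, ((hW1.mul hU1).mul (isBigO_refl (fun τ => τ) _)).congr' ?_ ?_⟩
    · filter_upwards [h3, hU', hne] with τ h5 h6 h7
      rw [h5, h6, sub_zero, sub_zero, smul_eq_mul, hc, zpow_natCast]
      field_simp
      ring
    · filter_upwards with τ
      ring

theorem qParam_isBigO_add {h : ℝ} (w : ℂ) (p : ℕ) :
    (fun z => qParam h (z + w) ^ p) =O[atImInf] fun z => qParam h z ^ p := by
  refine IsBigO.of_bound (‖qParam h w‖ ^ p) (Eventually.of_forall fun z => ?_)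
  rw [qParam_add, mul_pow, norm_mul, norm_pow (qParam h w)]

theorem isBigO_prod_one_or {ι α : Type*} {l : Filter α} (s u : Finset ι) [DecidableEq ι] (hu : u ⊆ s)
    {f : ι → α → ℂ} {g : α → ℂ} (h1 : ∀ i ∈ u, f i =O[l] g)
    (h2 : ∀ i ∈ s \ u, f i =O[l] fun _ => (1 : ℂ)) :
    (fun a => ∏ i ∈ s, f i a) =O[l] fun a => g a ^ u.card := by
  have h3 : (fun a => ∏ i ∈ u, f i a) =O[l] fun a => ∏ i ∈ u, g a := .finsetProd h1
  have h4 : (fun a => ∏ i ∈ s \ u, f i a) =O[l] fun a => ∏ i ∈ s \ u, (1 : ℂ) := .finsetProd h2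
  refine ((h4.mul h3).congr_left fun a => ?_).congr_right fun a => ?_
  · rw [Finset.prod_sdiff hu]
  · simp

namespace PlaneCurve
variable {K : PlaneCurve}

namespace End
variable {E : K.End} {b : ℂ}

theorem card_branch (E : K.End) (i : Fin K.N) : (E.branch i).card = E.deg i := by
  rw [branch, Finset.card_image_of_injOn (E.pow_injOn i), Finset.card_range]

theorem qParam_deg_tendsto (E : K.End) (i : Fin K.N) : map (qParam (E.deg i)) atImInf = 𝓝[≠] 0 :=
  map_qParam (by exact_mod_cast E.deg_pos i)

/-- A holomorphic function in a local parameter of the branch. -/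
theorem exists_chart (E : K.End) (i : Fin K.N) {h : ℂ → ℂ → ℂ} (H : K.HolZ h) : ∃ g : ℂ → ℂ,
    (∀ z ∈ upperPlane E.A, g (qParam (E.deg i) z) = h (E.X z) (E.Y i z)) ∧
    ((fun z => h (E.X z) (E.Y i z)) =O[atImInf] (fun _ => (1 : ℂ)) → AnalyticAt ℂ g 0) ∧
    ∀ w, K.HasZDeriv h w → ∀ z ∈ upperPlane E.A, HasDerivAt g
      (w (E.X z) (E.Y i z) * E.X' z / (2 * Real.pi * Complex.I / E.deg i * qParam (E.deg i) z))
      (qParam (E.deg i) z) := by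
  obtain ⟨g, h1, h2, -, h3⟩ := exists_cusp (E.deg_pos i) (f := fun z => h (E.X z) (E.Y i z))
    (fun z hz => (E.differentiableAt_comp H i hz).differentiableWithinAt) fun z hz => by
      rw [E.Y_add_deg i hz, E.X_add_nat]
  refine ⟨g, h1, fun hO => ?_, fun w hw z hz => ?_⟩
  · obtain ⟨M, hM⟩ := hO.bound
    exact h3 M (hM.mono fun z hz => by simpa using hz)
  · have h4 := (h2 z hz).hasDerivAt.comp z (hasDerivAt_qParam (E.deg i) z)
    have h5 : HasDerivAt (g ∘ qParam (E.deg i)) (w (E.X z) (E.Y i z) * E.X' z) z := by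
      refine (E.hasDerivAt_comp hw i hz).congr_of_eventuallyEq ?_
      filter_upwards [(isOpen_upper E.A).mem_nhds hz] with s hs using h1 s hs
    have h6 := h4.unique h5
    have h7 : (E.deg i : ℂ) ≠ 0 := by exact_mod_cast (E.deg_pos i).ne'
    have h8 : (2 * Real.pi * Complex.I / E.deg i * qParam (E.deg i) z) ≠ 0 :=
      mul_ne_zero (div_ne_zero Complex.two_pi_I_ne_zero h7) (qParam_ne_zero z)
    rw [← h6]
    push_cast
    rw [mul_div_cancel_right₀ _ h8]
    exact (h2 z hz).hasDerivAt

theorem isBigO_derivative (hX : map E.X atImInf = 𝓝[≠] b) (i : Fin K.N) (c : ℂ) {p : ℕ}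
    (hp : (fun z => E.Y i z - c) =O[atImInf] fun z => qParam (E.deg i) z ^ p) :
    (fun z => K.P.derivative.evalEval (E.X z) (E.Y i z)) =O[atImInf]
      fun z => (qParam (E.deg i) z ^ p) ^ (E.deg i - 1) := by
  classical
  have h0 : i ∈ E.branch i := E.mem_branch.mpr (Equiv.Perm.SameCycle.refl _ _)
  have h1 := isBigO_prod_one_or (l := atImInf) (Finset.univ.erase i) ((E.branch i).erase i)
    (Finset.erase_subset_erase i (Finset.subset_univ _)) (f := fun j z => E.Y i z - E.Y j z)
    (g := fun z => qParam (E.deg i) z ^ p) (fun j hj => ?_) (fun j _ => ?_)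
  · rw [Finset.card_erase_of_mem h0, card_branch] at h1
    refine h1.congr' ?_ EventuallyEq.rfl
    filter_upwards [upper_mem_atImInf E.A] with z hz using ((E.enum z hz).derivative_eval i).symm
  · obtain ⟨n, -, hn⟩ := (E.mem_branch.mp (Finset.mem_of_mem_erase hj)).exists_pow_eq'
    have h2 : (fun z => E.Y j z - c) =O[atImInf] fun z => qParam (E.deg i) z ^ p := by
      refine ((hp.comp_tendsto (tendsto_add_atImInf n)).congr' ?_ EventuallyEq.rfl).trans
        (qParam_isBigO_add (n : ℂ) p)
      filter_upwards [upper_mem_atImInf E.A] with z hz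
      simp only [Function.comp_apply]
      rw [E.Y_add_nat i hz, hn]
    exact (hp.sub h2).congr_left fun z => by ring
  · have h2 : ∀ j, (fun z => E.Y j z) =O[atImInf] fun _ => (1 : ℂ) := fun j => by
      simpa using isBigO_evalEval hX Polynomial.X j
    exact (h2 i).sub (h2 j)

end End
end PlaneCurve

namespace PlaneCurve
variable {K : PlaneCurve}

theorem continuous_deriv_evalEval (P : ℂ[X][X]) :
    Continuous fun p : ℂ × ℂ => deriv (fun x => P.evalEval x p.2) p.1 := by
  have h1 : ∀ p : ℂ × ℂ, deriv (fun x => P.evalEval x p.2) p.1 =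
      fderiv ℂ (fun p : ℂ × ℂ => P.evalEval p.1 p.2) p (1, 0) := fun p =>
    (HasFDerivAt.comp_hasDerivAt (f := fun x => (x, p.2)) p.1
      (hasStrictFDerivAt_evalEval P p).hasFDerivAt
      ((hasDerivAt_id _).prodMk (hasDerivAt_const _ _))).deriv
  simp_rw [h1]
  exact ((contDiff_evalEval P (n := 1)).continuous_fderiv one_ne_zero).clm_apply continuous_const

namespace End
variable {E : K.End} {b : ℂ}

/-- The derivative of the first coordinate divided by `∂P/∂y`, in a local parameter. -/
noncomputable def density (E : K.End) (i : Fin K.N) (z : ℂ) : ℂ :=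
  K.P.derivative.evalEval (E.X z) (E.Y i z) *
    (2 * Real.pi * Complex.I / E.deg i * qParam (E.deg i) z) / E.X' z

theorem scale_ne (E : K.End) (i : Fin K.N) (z : ℂ) :
    2 * Real.pi * Complex.I / E.deg i * qParam (E.deg i) z ≠ 0 :=
  mul_ne_zero (div_ne_zero Complex.two_pi_I_ne_zero (by exact_mod_cast (E.deg_pos i).ne'))
    (qParam_ne_zero z)

theorem exists_isBigO_density {η : ℂ → ℂ → ℂ}
    (hη : K.HasZDeriv η fun x y => 1 / K.P.derivative.evalEval x y) {i : Fin K.N} {W : ℂ → ℂ}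
    (hW : MeromorphicAt W 0) (hWz : ∀ z ∈ upperPlane E.A, W (qParam (E.deg i) z) = E.density i z) :
    ∃ e, (fun z => E.density i z * (η (E.X z) (E.Y i z) - e)) =O[atImInf]
      fun z => qParam (E.deg i) z := by
  obtain ⟨G, hG1, -, hG3⟩ := E.exists_chart i hη.holZ
  have hm := E.qParam_deg_tendsto i
  obtain ⟨e, he⟩ := exists_isBigO_of_hasDerivAt_inv hW (by
    rw [← hm, eventually_map]
    filter_upwards [upper_mem_atImInf E.A] with z hz
    rw [hWz z hz]
    exact div_ne_zero (mul_ne_zero (K.derivative_ne (E.reg z hz) (E.root i hz)) (E.scale_ne i z))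
      (E.ne z)) (G := G) (by
    rw [← hm, eventually_map]
    filter_upwards [upper_mem_atImInf E.A] with z hz
    rw [hWz z hz]
    refine (hG3 _ hη z hz).congr_deriv ?_
    rw [density, inv_div, one_div, ← div_eq_inv_mul, div_div])
  refine ⟨e, (he.comp_tendsto hm.le).congr' ?_ EventuallyEq.rfl⟩
  filter_upwards [upper_mem_atImInf E.A] with z hz
  simp only [Function.comp_apply]
  rw [hWz z hz, hG1 z hz]

theorem density_mul (i : Fin K.N) (z c w : ℂ) :
    c * K.P.derivative.evalEval (E.X z) (E.Y i z) * w = E.density i z * c *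
      (w * E.X' z / (2 * Real.pi * Complex.I / E.deg i * qParam (E.deg i) z)) := by
  have h1 := E.scale_ne i z
  have h2 := E.ne z
  rw [density]
  generalize 2 * Real.pi * Complex.I / E.deg i * qParam (E.deg i) z = s at *
  field_simp

theorem density_eq (hX' : ∀ z, E.X' z = 2 * Real.pi * Complex.I * qParam 1 z)
    (i : Fin K.N) (z : ℂ) : E.density i z =
    K.P.derivative.evalEval (E.X z) (E.Y i z) / (E.deg i * qParam (E.deg i) z ^ (E.deg i - 1)) := by
  have h1 := Complex.two_pi_I_ne_zero
  have h2 : qParam (E.deg i) z ≠ 0 := qParam_ne_zero z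
  have h3 : (E.deg i : ℂ) ≠ 0 := by exact_mod_cast (E.deg_pos i).ne'
  rw [density, hX', ← qParam_pow (E.deg_pos i) z]
  obtain ⟨m, hm⟩ : ∃ m, E.deg i = m + 1 := ⟨E.deg i - 1, by have := E.deg_pos i; omega⟩
  generalize hk : E.deg i = k at *
  generalize qParam k z = t at *
  subst hm
  rw [Nat.add_sub_cancel]
  generalize 2 * Real.pi * Complex.I = c at *
  field_simp
  ring

theorem exists_meromorphic_density (hX : map E.X atImInf = 𝓝[≠] b)
    (hX' : ∀ z, E.X' z = 2 * Real.pi * Complex.I * qParam 1 z)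
    (i : Fin K.N) : ∃ W : ℂ → ℂ, MeromorphicAt W 0 ∧
    ∀ z ∈ upperPlane E.A, W (qParam (E.deg i) z) = E.density i z := by
  obtain ⟨V, h1, h2, -⟩ := E.exists_chart i (holZ_evalEval K.P.derivative)
  refine ⟨fun τ => V τ / (E.deg i * τ ^ (E.deg i - 1)),
    (h2 (isBigO_evalEval hX _ i)).meromorphicAt.div
      ((MeromorphicAt.const _ _).mul ((MeromorphicAt.id _).pow _)), fun z hz => ?_⟩
  simp only
  rw [h1 z hz, density_eq hX']

theorem isBigO_density (hX : map E.X atImInf = 𝓝[≠] b)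
    (hX' : ∀ z, E.X' z = 2 * Real.pi * Complex.I * qParam 1 z)
    (i : Fin K.N) (c : ℂ) {p : ℕ}
    (hp : (fun z => E.Y i z - c) =O[atImInf] fun z => qParam (E.deg i) z ^ (p + 1)) :
    E.density i =O[atImInf] fun z => qParam (E.deg i) z ^ (p * (E.deg i - 1)) := by
  have h1 := (isBigO_derivative hX i c hp).mul
    (isBigO_refl (fun z => (E.deg i * qParam (E.deg i) z ^ (E.deg i - 1))⁻¹) atImInf)
  refine (h1.congr_left fun z => ?_).trans (IsBigO.of_bound 1 (Eventually.of_forall fun z => ?_))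
  · rw [density_eq hX', div_eq_mul_inv]
  · have h2 : qParam (E.deg i) z ≠ 0 := qParam_ne_zero z
    have h3 : (1 : ℝ) ≤ E.deg i := by exact_mod_cast E.deg_pos i
    have h4 : (qParam (E.deg i) z ^ (p + 1)) ^ (E.deg i - 1) *
        ((E.deg i : ℂ) * qParam (E.deg i) z ^ (E.deg i - 1))⁻¹ =
        qParam (E.deg i) z ^ (p * (E.deg i - 1)) * (E.deg i : ℂ)⁻¹ := by
      generalize E.deg i - 1 = m
      generalize qParam (E.deg i) z = t at *
      have h5 : (E.deg i : ℂ) ≠ 0 := by exact_mod_cast (E.deg_pos i).ne'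
      rw [← pow_mul]
      field_simp
      ring
    rw [h4, norm_mul, mul_comm]
    gcongr
    rw [norm_inv, Complex.norm_natCast]
    exact inv_le_one_of_one_le₀ h3

/-- At a singular point the density vanishes. -/
theorem tendsto_density (hX : map E.X atImInf = 𝓝[≠] b)
    (hX' : ∀ z, E.X' z = 2 * Real.pi * Complex.I * qParam 1 z)
    {i : Fin K.N} {c : ℂ} {y : ℂ → ℂ} (hy : AnalyticAt ℂ y 0) (hy0 : y 0 = c)
    (hXq : ∀ z, E.X z = b + qParam 1 z)
    (hyY : ∀ z ∈ upperPlane E.A, y (qParam (E.deg i) z) = E.Y i z)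
    (h1 : K.P.derivative.evalEval b c = 0) (h2 : deriv (fun x => K.P.evalEval x c) b = 0) :
    Tendsto (E.density i) atImInf (𝓝 0) := by
  have hm := E.qParam_deg_tendsto i
  have ht : Tendsto (qParam (E.deg i)) atImInf (𝓝 0) := hm.le.trans nhdsWithin_le_nhds
  have hk := E.deg_pos i
  have hYt : Tendsto (E.Y i) atImInf (𝓝 c) := by
    rw [← hy0]
    refine (hy.continuousAt.tendsto.comp ht).congr' ?_
    filter_upwards [upper_mem_atImInf E.A] with z hz using hyY z hz
  have hp : Tendsto (fun z => (E.X z, E.Y i z)) atImInf (𝓝 (b, c)) := (tendsto_X hX).prodMk_nhds hYt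
  by_cases hd : deriv y 0 = 0
  · rcases Nat.eq_or_lt_of_le (Nat.succ_le_of_lt hk) with hk1 | hk1
    · have h3 := ((continuous_evalEval K.P.derivative).tendsto (b, c)).comp hp
      rw [h1] at h3
      refine h3.congr fun z => ?_
      rw [density_eq hX', ← hk1]
      simp
    · have h3 : (fun z => E.Y i z - c) =O[atImInf] fun z => qParam (E.deg i) z ^ (1 + 1) := by
        have hV : ∀ τ, y τ - c = τ * dslope y 0 τ := fun τ => by
          have := sub_smul_dslope y 0 τ
          rw [sub_zero, smul_eq_mul, hy0] at this
          exact this.symm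
        have h4 : dslope y 0 =O[𝓝 0] fun τ => τ := by
          have := hy.dslope_self.differentiableAt.isBigO_sub
          simpa [dslope_same, hd] using this
        refine (((isBigO_refl (fun τ : ℂ => τ) _).mul h4).comp_tendsto ht).congr' ?_ ?_
        · filter_upwards [upper_mem_atImInf E.A] with z hz
          simp only [Function.comp_apply]
          rw [← hV, hyY z hz]
        · exact Eventually.of_forall fun z => by simp only [Function.comp_apply]; ring
      refine (isBigO_density hX hX' i c h3).trans_tendsto ?_
      have h5 := ht.pow (1 * (E.deg i - 1))
      rwa [zero_pow (by omega)] at h5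
  · have h3 : Tendsto (fun z => -deriv (fun x => K.P.evalEval x (E.Y i z)) (E.X z) /
        deriv y (qParam (E.deg i) z)) atImInf (𝓝 (-0 / deriv y 0)) := by
      refine Tendsto.div (Tendsto.neg ?_) (hy.deriv.continuousAt.tendsto.comp ht) hd
      have := ((continuous_deriv_evalEval K.P).tendsto (b, c)).comp hp
      rwa [h2] at this
    rw [neg_zero, zero_div] at h3
    refine h3.congr' ?_
    have hXτ : ∀ z, E.X z = b + qParam (E.deg i) z ^ E.deg i := fun z => by rw [hXq, qParam_pow hk]
    have h0 : ∀ᶠ τ in 𝓝[≠] 0, K.P.evalEval (b + τ ^ E.deg i) (y τ) = 0 := by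
      rw [← hm, eventually_map]
      filter_upwards [upper_mem_atImInf E.A] with z hz
      rw [hyY z hz, ← hXτ, E.root i hz]
    have h0' := eventually_eventually_nhdsWithin.mpr h0
    have h5 : ∀ᶠ τ in 𝓝[≠] 0, deriv (fun x => K.P.evalEval x (y τ)) (b + τ ^ E.deg i) *
        (E.deg i * τ ^ (E.deg i - 1)) + K.P.derivative.evalEval (b + τ ^ E.deg i) (y τ) * deriv y τ = 0 := by
      filter_upwards [h0', hy.eventually_analyticAt.filter_mono nhdsWithin_le_nhds,
        self_mem_nhdsWithin] with τ a1 a2 a3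
      rw [nhdsWithin_eq_nhds.mpr (isOpen_compl_singleton.mem_nhds a3)] at a1
      have a4 := hasDerivAt_evalEval_comp K.P ((hasDerivAt_pow (E.deg i) τ).const_add b)
        a2.differentiableAt.hasDerivAt
      have a5 := (hasDerivAt_const τ (0 : ℂ)).congr_of_eventuallyEq a1
      exact a4.unique a5
    rw [← hm, eventually_map] at h5
    have h6 : ∀ᶠ z in atImInf, deriv y (qParam (E.deg i) z) ≠ 0 :=
      (hy.deriv.continuousAt.tendsto.comp ht).eventually_ne hd
    filter_upwards [h5, h6, upper_mem_atImInf E.A] with z a1 a2 hz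
    rw [hyY z hz, ← hXτ] at a1
    have h7 : qParam (E.deg i) z ≠ 0 := qParam_ne_zero z
    have h8 : (E.deg i : ℂ) ≠ 0 := by exact_mod_cast hk.ne'
    have h9 := mul_ne_zero h8 (pow_ne_zero (E.deg i - 1) h7)
    rw [density_eq hX', div_eq_div_iff a2 h9]
    linear_combination -a1

end End
end PlaneCurve

namespace PlaneCurve
variable {K : PlaneCurve}
namespace End
variable {E : K.End} {b : ℂ}

/-- The operator `h ↦ η ∂P/∂y dh/dx` preserves boundedness, and produces functions vanishing at the
singular points. -/
theorem isBigO_and_tendsto_at (hX : map E.X atImInf = 𝓝[≠] b)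
    (hX' : ∀ z, E.X' z = 2 * Real.pi * Complex.I * qParam 1 z) (hXq : ∀ z, E.X z = b + qParam 1 z)
    {η h w : ℂ → ℂ → ℂ} (hη : K.HasZDeriv η fun x y => 1 / K.P.derivative.evalEval x y)
    (hw : K.HasZDeriv h w) {i : Fin K.N} {c : ℂ} (hc : Tendsto (E.Y i) atImInf (𝓝 c))
    (hO : (fun z => h (E.X z) (E.Y i z)) =O[atImInf] fun _ => (1 : ℂ)) :
    (fun z => η (E.X z) (E.Y i z) * K.P.derivative.evalEval (E.X z) (E.Y i z) *
      w (E.X z) (E.Y i z)) =O[atImInf] (fun _ => (1 : ℂ)) ∧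
    (K.P.derivative.evalEval b c = 0 → deriv (fun x => K.P.evalEval x c) b = 0 →
      Tendsto (fun z => η (E.X z) (E.Y i z) * K.P.derivative.evalEval (E.X z) (E.Y i z) *
        w (E.X z) (E.Y i z)) atImInf (𝓝 0)) := by
  have hm := E.qParam_deg_tendsto i
  have ht : Tendsto (qParam (E.deg i)) atImInf (𝓝 0) := hm.le.trans nhdsWithin_le_nhds
  obtain ⟨L, hL, -, hLY⟩ := E.exists_limit hX
  obtain rfl := tendsto_nhds_unique (hL i) hc
  obtain ⟨y, hy, hy0, hyY⟩ := hLY i _ (E.deg_pos i) dvd_rfl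
  obtain ⟨W, hW, hWz⟩ := exists_meromorphic_density hX hX' i
  obtain ⟨e, he⟩ := exists_isBigO_density hη hW hWz
  obtain ⟨H, -, hH2, hH3⟩ := E.exists_chart i hw.holZ
  have hH := hH2 hO
  have hH' : (fun z => w (E.X z) (E.Y i z) * E.X' z /
      (2 * Real.pi * Complex.I / E.deg i * qParam (E.deg i) z)) =O[atImInf] fun _ => (1 : ℂ) := by
    refine ((hH.deriv.continuousAt.tendsto.comp ht).isBigO_one ℂ).congr' ?_ EventuallyEq.rfl
    filter_upwards [upper_mem_atImInf E.A] with z hz using (hH3 _ hw z hz).deriv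
  have hY1 : (fun z => E.Y i z - L i) =O[atImInf] fun z => qParam (E.deg i) z ^ (0 + 1) := by
    refine (hy.differentiableAt.isBigO_sub.comp_tendsto ht).congr' ?_ ?_
    · filter_upwards [upper_mem_atImInf E.A] with z hz
      simp only [Function.comp_apply]
      rw [hyY z hz, hy0]
    · exact Eventually.of_forall fun z => by simp
  have hD := isBigO_density hX hX' i (L i) hY1
  simp only [zero_mul, pow_zero] at hD
  have hsplit : ∀ z, E.density i z * η (E.X z) (E.Y i z) =
      E.density i z * (η (E.X z) (E.Y i z) - e) + E.density i z * e := fun z => by ring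
  have he0 : Tendsto (fun z => E.density i z * (η (E.X z) (E.Y i z) - e)) atImInf (𝓝 0) :=
    he.trans_tendsto ht
  constructor
  · have h1 : (fun z => E.density i z * η (E.X z) (E.Y i z)) =O[atImInf] fun _ => (1 : ℂ) := by
      simp_rw [hsplit]
      refine (he0.isBigO_one ℂ).add ?_
      exact (hD.mul (isBigO_const_const e (one_ne_zero (α := ℂ)) atImInf)).congr_right
        fun z => mul_one 1
    refine (h1.mul hH').congr (fun z => ?_) fun z => by simp
    rw [density_mul]
  · intro hs1 hs2
    have h2 := tendsto_density hX hX' hy hy0 hXq hyY hs1 hs2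
    have h1 : Tendsto (fun z => E.density i z * η (E.X z) (E.Y i z)) atImInf (𝓝 0) := by
      simp_rw [hsplit]
      simpa using he0.add (h2.mul_const e)
    refine ((((isBigO_refl _ _).mul hH').trans_tendsto (by simpa using h1))).congr fun z => ?_
    rw [density_mul]

/-- After adding a constant to `η`, the operator `h ↦ η ∂P/∂y dh/dx` does not increase the order of
growth. -/
theorem exists_isBigO_infty (hX : map E.X atImInf = Bornology.cobounded ℂ)
    (hXq : ∀ z, E.X z = (qParam 1 z)⁻¹)
    (hX' : ∀ z, E.X' z = -(2 * Real.pi * Complex.I) * (qParam 1 z)⁻¹)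
    {η : ℂ → ℂ → ℂ} (hη : K.HasZDeriv η fun x y => 1 / K.P.derivative.evalEval x y) (i : Fin K.N) :
    ∃ e, ∀ h w s, K.HasZDeriv h w →
      ((fun z => h (E.X z) (E.Y i z)) =O[atImInf] fun z => E.X z ^ s) →
      (fun z => (η (E.X z) (E.Y i z) - e) * K.P.derivative.evalEval (E.X z) (E.Y i z) *
        w (E.X z) (E.Y i z)) =O[atImInf] fun z => E.X z ^ s := by
  have hm := E.qParam_deg_tendsto i
  have ht : Tendsto (qParam (E.deg i)) atImInf (𝓝 0) := hm.le.trans nhdsWithin_le_nhds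
  have hq0 : ∀ z, qParam 1 z ≠ 0 := fun z => qParam_ne_zero z
  have hk := E.deg_pos i
  have hk0 : (E.deg i : ℂ) ≠ 0 := by exact_mod_cast hk.ne'
  have ht0 : ∀ z, qParam (E.deg i) z ≠ 0 := fun z => qParam_ne_zero z
  have hXt : ∀ z, E.X z = (qParam (E.deg i) z ^ E.deg i)⁻¹ := fun z => by rw [hXq, qParam_pow hk]
  -- a chart for a function with polynomial growth
  have chart : ∀ (h : ℂ → ℂ → ℂ) (s : ℕ), K.HolZ h →
      ((fun z => h (E.X z) (E.Y i z)) =O[atImInf] fun z => E.X z ^ s) →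
      ∃ g : ℂ → ℂ, AnalyticAt ℂ g 0 ∧ ∀ z ∈ upperPlane E.A,
        g (qParam (E.deg i) z) = h (E.X z) (E.Y i z) * (qParam (E.deg i) z ^ E.deg i) ^ s := by
    intro h s hh hO
    obtain ⟨g, h1, -, -, h2⟩ := exists_cusp hk
      (f := fun z => h (E.X z) (E.Y i z) * qParam 1 z ^ s) (A := E.A)
      (fun z hz => ((E.differentiableAt_comp hh i hz).mul
        ((hasDerivAt_qParam 1 z).differentiableAt.pow s)).differentiableWithinAt) (fun z hz => by
          rw [E.Y_add_deg i hz, E.X_add_nat,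
            ← (qParam_one_eq_iff z (z + E.deg i)).mpr ⟨E.deg i, by simp⟩])
    obtain ⟨M, hM⟩ := (hO.mul (isBigO_refl (fun z => qParam 1 z ^ s) _)).bound
    refine ⟨g, h2 M (hM.mono fun z hz => ?_), fun z hz => by rw [h1 z hz, qParam_pow hk]⟩
    have h3 : E.X z * qParam 1 z = 1 := by rw [hXq, inv_mul_cancel₀ (hq0 z)]
    rwa [← mul_pow, h3, one_pow, norm_one, mul_one] at hz
  obtain ⟨C, n, hC⟩ := K.exists_growth K.P.derivative
  have hPO : (fun z => K.P.derivative.evalEval (E.X z) (E.Y i z)) =O[atImInf] fun z => E.X z ^ n := by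
    refine IsBigO.of_bound C ?_
    have h1 : ∀ᶠ z in atImInf, 1 ≤ ‖E.X z‖ := by
      have := eventually_cobounded_le_norm (E := ℂ) 1
      rwa [← hX, eventually_map] at this
    filter_upwards [h1, upper_mem_atImInf E.A] with z hz hzA
    rw [norm_pow]
    exact hC _ hz _ (E.root i hzA)
  obtain ⟨V, hV, hVz⟩ := chart _ n (holZ_evalEval K.P.derivative) hPO
  have hdens : ∀ z, E.density i z = K.P.derivative.evalEval (E.X z) (E.Y i z) *
      (-qParam (E.deg i) z ^ (E.deg i + 1) / E.deg i) := by
    intro z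
    have h1 := Complex.two_pi_I_ne_zero
    have h2 := ht0 z
    rw [density, hX', ← qParam_pow hk z]
    generalize qParam (E.deg i) z = t at *
    generalize 2 * Real.pi * Complex.I = c at *
    field_simp
    ring
  obtain ⟨e, he⟩ := exists_isBigO_density hη (i := i)
    (W := fun τ => V τ / (τ ^ E.deg i) ^ n * (-τ ^ (E.deg i + 1) / E.deg i))
    ((hV.meromorphicAt.div (((MeromorphicAt.id _).pow _).pow _)).mul
      ((((MeromorphicAt.id _).pow _).neg).div (MeromorphicAt.const _ _))) fun z hz => by
        have h2 := pow_ne_zero n (pow_ne_zero (E.deg i) (ht0 z))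
        rw [hVz z hz, hdens, mul_div_cancel_right₀ _ h2]
  refine ⟨e, fun h w s hw hO => ?_⟩
  obtain ⟨B, hB, hBz⟩ := chart h s hw.holZ hO
  obtain ⟨H, hH1, -, hH3⟩ := E.exists_chart i hw.holZ
  set m := E.deg i * s with hms
  have hHB : ∀ᶠ τ in 𝓝[≠] 0, B τ = H τ * τ ^ m := by
    rw [← hm, eventually_map]
    filter_upwards [upper_mem_atImInf E.A] with z hz
    rw [hBz z hz, hH1 z hz, hms, pow_mul]
  have hHB' := eventually_eventually_nhdsWithin.mpr hHB
  rw [← hm, eventually_map] at hHB'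
  have hder : (fun z => qParam (E.deg i) z ^ (m + 1) * (w (E.X z) (E.Y i z) * E.X' z /
      (2 * Real.pi * Complex.I / E.deg i * qParam (E.deg i) z))) =O[atImInf] fun _ => (1 : ℂ) := by
    have h1 : Tendsto (fun τ => τ * deriv B τ - m * B τ) (𝓝 0) (𝓝 (0 * deriv B 0 - m * B 0)) :=
      (tendsto_id.mul hB.deriv.continuousAt.tendsto).sub (hB.continuousAt.tendsto.const_mul _)
    refine ((h1.comp ht).isBigO_one ℂ).congr' ?_ EventuallyEq.rfl
    filter_upwards [hHB', upper_mem_atImInf E.A] with z h2 hz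
    rw [nhdsWithin_eq_nhds.mpr (isOpen_compl_singleton.mem_nhds (ht0 z))] at h2
    have h3 := hH3 _ hw z hz
    have h4 := (h3.mul (hasDerivAt_pow m (qParam (E.deg i) z))).congr_of_eventuallyEq h2
    simp only [Function.comp_apply]
    rw [h4.deriv, h2.self_of_nhds]
    generalize w (E.X z) (E.Y i z) * E.X' z /
      (2 * Real.pi * Complex.I / E.deg i * qParam (E.deg i) z) = D
    generalize qParam (E.deg i) z = t
    rcases m with - | m
    · simp
    · rw [Nat.add_sub_cancel]
      ring
  have h5 := (he.mul hder).mul (isBigO_refl (fun z => (qParam (E.deg i) z ^ (m + 1))⁻¹) atImInf)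
  refine h5.congr (fun z => ?_) fun z => ?_
  · rw [density_mul]
    have := ht0 z
    field_simp
  · have := ht0 z
    rw [hXt, hms, inv_pow, ← pow_mul, mul_one, pow_succ]
    field_simp

theorem exists_forall_isBigO_infty [ContractibleSpace K.Pt]
    (hX : map E.X atImInf = Bornology.cobounded ℂ)
    (hXq : ∀ z, E.X z = (qParam 1 z)⁻¹)
    (hX' : ∀ z, E.X' z = -(2 * Real.pi * Complex.I) * (qParam 1 z)⁻¹)
    {η : ℂ → ℂ → ℂ} (hη : K.HasZDeriv η fun x y => 1 / K.P.derivative.evalEval x y) :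
    ∃ e, ∀ h w s, K.HasZDeriv h w →
      (∀ i, (fun z => h (E.X z) (E.Y i z)) =O[atImInf] fun z => E.X z ^ s) →
      ∀ i, (fun z => (η (E.X z) (E.Y i z) - e) * K.P.derivative.evalEval (E.X z) (E.Y i z) *
        w (E.X z) (E.Y i z)) =O[atImInf] fun z => E.X z ^ s := by
  rcases isEmpty_or_nonempty (Fin K.N) with _ | ⟨⟨j⟩⟩
  · exact ⟨0, fun _ _ _ _ _ i => isEmptyElim i⟩
  obtain ⟨e, he⟩ := exists_isBigO_infty hX hXq hX' hη j
  refine ⟨e, fun h w s hw hO i => ?_⟩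
  obtain ⟨n, -, hn⟩ := (sameCycle_infty hX hXq hX' j i).exists_pow_eq'
  refine ((he h w s hw (hO _)).comp_tendsto (tendsto_add_atImInf n)).congr' ?_ ?_
  · filter_upwards [upper_mem_atImInf E.A] with z hz
    simp only [Function.comp_apply]
    rw [E.Y_add_nat _ hz, hn, E.X_add_nat]
  · exact Eventually.of_forall fun z => by simp only [Function.comp_apply]; rw [E.X_add_nat]

end End
end PlaneCurve

namespace PlaneCurve

/-- The restriction of a function to the regular part of the curve, extended by zero. -/
noncomputable def restr (K : PlaneCurve) (h : ℂ → ℂ → ℂ) (x y : ℂ) : ℂ :=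
  open Classical in if x ∈ K.Reg ∧ K.P.evalEval x y = 0 then h x y else 0

variable {K : PlaneCurve}

theorem restr_of_mem (h : ℂ → ℂ → ℂ) {x y : ℂ} (hx : x ∈ K.Reg) (hy : K.P.evalEval x y = 0) :
    K.restr h x y = h x y := if_pos ⟨hx, hy⟩

theorem restr_of_not (h : ℂ → ℂ → ℂ) {x y : ℂ} (hxy : ¬(x ∈ K.Reg ∧ K.P.evalEval x y = 0)) :
    K.restr h x y = 0 := if_neg hxy

theorem IsSection.restr_eventuallyEq {Y : ℂ → ℂ} {x₀ : ℂ} (hY : K.IsSection Y x₀) (h : ℂ → ℂ → ℂ) :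
    (fun x => K.restr h x (Y x)) =ᶠ[𝓝 x₀] fun x => h x (Y x) := by
  filter_upwards [hY.eventually] with x hx using restr_of_mem h hx.2.reg hx.2.root_self

theorem HolZ.restr {h : ℂ → ℂ → ℂ} (H : K.HolZ h) : K.HolZ (K.restr h) := fun x₀ Y hY =>
  (H x₀ Y hY).congr_of_eventuallyEq (hY.restr_eventuallyEq h)

theorem End.restr_eventuallyEq (E : K.End) (h : ℂ → ℂ → ℂ) (i : Fin K.N) :
    (fun z => K.restr h (E.X z) (E.Y i z)) =ᶠ[atImInf] fun z => h (E.X z) (E.Y i z) := by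
  filter_upwards [upper_mem_atImInf E.A] with z hz using restr_of_mem h (E.reg z hz) (E.root i hz)

theorem HasZDeriv.eq {h w w' : ℂ → ℂ → ℂ} (H : K.HasZDeriv h w) (H' : K.HasZDeriv h w') {x y : ℂ}
    (hx : x ∈ K.Reg) (hy : K.P.evalEval x y = 0) : w x y = w' x y := by
  obtain ⟨φ, h0, h1, -⟩ := exists_isSection hx hy
  rw [← h0]
  exact (H x φ h1).unique (H' x φ h1)

/-- An end over the punctured neighbourhood of `b`, in its standard coordinate. -/
structure End.IsAt (E : K.End) (b : ℂ) : Prop where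
  X_eq : ∀ z, E.X z = b + qParam 1 z
  X'_eq : ∀ z, E.X' z = 2 * Real.pi * Complex.I * qParam 1 z
  map_eq : map E.X atImInf = 𝓝[≠] b

/-- Holomorphic functions on the regular part of the curve, bounded at finite distance, and of
growth at most `s` at infinity. -/
def growthSpace (E : K.End) (s : ℕ) : Submodule ℂ (ℂ → ℂ → ℂ) where
  carrier := {h | (∀ x y, ¬(x ∈ K.Reg ∧ K.P.evalEval x y = 0) → h x y = 0) ∧ K.HolZ h ∧
    (∀ (b : ℂ) (F : K.End), F.IsAt b → ∀ i,
      (fun z => h (F.X z) (F.Y i z)) =O[atImInf] fun _ => (1 : ℂ)) ∧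
    ∀ i, (fun z => h (E.X z) (E.Y i z)) =O[atImInf] fun z => E.X z ^ s}
  zero_mem' := ⟨fun _ _ _ => rfl, fun _ _ _ => differentiableAt_const _,
    fun _ _ _ _ => isBigO_zero _ _, fun _ => isBigO_zero _ _⟩
  add_mem' := fun {h k} ⟨a1, a2, a3, a4⟩ ⟨b1, b2, b3, b4⟩ =>
    ⟨fun x y hxy => by simp [a1 x y hxy, b1 x y hxy], a2.add b2,
      fun b F hF i => (a3 b F hF i).add (b3 b F hF i), fun i => (a4 i).add (b4 i)⟩
  smul_mem' := fun c h ⟨a1, a2, a3, a4⟩ =>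
    ⟨fun x y hxy => by simp [a1 x y hxy], fun x₀ Y hY => (a2 x₀ Y hY).const_mul c,
      fun b F hF i => (a3 b F hF i).const_mul_left c, fun i => (a4 i).const_mul_left c⟩

theorem exists_isAt (b : ℂ) : ∃ E : K.End, E.IsAt b := by
  obtain ⟨E, h1, h2, h3⟩ := K.exists_End_at b
  exact ⟨E, h1, h2, h3⟩

variable {E : K.End}

theorem exists_restr_mem_growthSpace (hE : map E.X atImInf = Bornology.cobounded ℂ) (g : ℂ[X][X]) :
    ∃ s₀, ∀ s, s₀ ≤ s → K.restr (fun x y => g.evalEval x y) ∈ growthSpace E s := by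
  obtain ⟨C, s₀, hC⟩ := K.exists_growth g
  refine ⟨s₀, fun s hs => ⟨fun x y => restr_of_not _, (holZ_evalEval g).restr,
    fun b F hF i => (F.restr_eventuallyEq _ i).trans_isBigO (End.isBigO_evalEval hF.map_eq g i),
    fun i => (E.restr_eventuallyEq _ i).trans_isBigO (IsBigO.of_bound |C| ?_)⟩⟩
  have h1 : ∀ᶠ z in atImInf, 1 ≤ ‖E.X z‖ := by
    have : Tendsto E.X atImInf (Bornology.cobounded ℂ) := hE.le
    exact (tendsto_norm_cobounded_atTop.comp this).eventually_ge_atTop 1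
  filter_upwards [h1, upper_mem_atImInf E.A] with z h1 hz
  refine (hC _ h1 _ (E.root i hz)).trans ?_
  rw [norm_pow]
  exact mul_le_mul (le_abs_self C) (pow_le_pow_right₀ h1 hs) (by positivity) (abs_nonneg C)

/-- The traces of the functions of `growthSpace E s` are polynomials of bounded degree. -/
theorem exists_trace_eq_of_mem (hE : map E.X atImInf = Bornology.cobounded ℂ) (s l : ℕ) :
    ∃ D, ∀ h ∈ growthSpace E s, ∃ q : ℂ[X], q.natDegree ≤ D ∧
      ∀ x ∈ K.Reg, K.trace (fun x y => h x y * y ^ l) x = q.eval x := by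
  obtain ⟨C, s₀, hC⟩ := K.exists_growth (X ^ l)
  have hev : ∀ x y : ℂ, (X ^ l : ℂ[X][X]).evalEval x y = y ^ l := fun x y => by simp
  simp only [hev] at hC
  refine ⟨s + s₀, fun h ⟨_, h2, h3, h4⟩ => ?_⟩
  have hhol : K.HolZ fun x y => h x y * y ^ l := by
    simpa only [hev] using h2.mul (holZ_evalEval (X ^ l))
  choose c hc using fun i => (h4 i).bound
  have hcob : ∀ᶠ x in Bornology.cobounded ℂ, ∀ y, K.P.evalEval x y = 0 →
      ‖h x y‖ ≤ (∑ i, |c i|) * ‖x‖ ^ s := by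
    refine (E.eventually_iff hE).mpr ?_
    filter_upwards [eventually_all.mpr hc] with z hz i
    refine (hz i).trans ?_
    rw [norm_pow]
    gcongr
    exact (le_abs_self _).trans
      (Finset.single_le_sum (f := fun i => |c i|) (fun _ _ => abs_nonneg _) (Finset.mem_univ i))
  refine hhol.exists_trace_eq (C := (∑ i, |c i|) * |C|) (fun b _ => ?_) ?_
  · obtain ⟨F, hF⟩ := exists_isAt (K := K) b
    choose c' hc' using fun i => (h3 b F hF i).bound
    obtain ⟨M, hM⟩ := K.exists_local_bound (X ^ l) b
    simp only [hev] at hM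
    have h5 : ∀ᶠ x in 𝓝[≠] b, ∀ y, K.P.evalEval x y = 0 → ‖h x y‖ ≤ ∑ i, |c' i| := by
      refine (F.eventually_iff hF.map_eq).mpr ?_
      filter_upwards [eventually_all.mpr hc'] with z hz i
      refine (hz i).trans ?_
      rw [norm_one, mul_one]
      exact (le_abs_self _).trans
        (Finset.single_le_sum (f := fun i => |c' i|) (fun _ _ => abs_nonneg _) (Finset.mem_univ i))
    refine ⟨(∑ i, |c' i|) * M, ?_⟩
    filter_upwards [h5, hM.filter_mono nhdsWithin_le_nhds] with x a1 a2 y hy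
    rw [norm_mul]
    exact mul_le_mul (a1 y hy) (a2 y hy) (norm_nonneg _) (Finset.sum_nonneg fun _ _ => abs_nonneg _)
  · filter_upwards [hcob, tendsto_norm_cobounded_atTop.eventually_ge_atTop 1] with x a1 a2 _ y hy
    rw [norm_mul]
    refine (mul_le_mul (a1 y hy) ((hC x a2 y hy).trans
      (mul_le_mul_of_nonneg_right (le_abs_self C) (by positivity))) (norm_nonneg _)
      (by positivity)).trans_eq ?_
    rw [pow_add]
    ring

theorem finiteDimensional_growthSpace (hE : map E.X atImInf = Bornology.cobounded ℂ) (s : ℕ) :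
    FiniteDimensional ℂ (growthSpace E s) := by
  choose D hD using exists_trace_eq_of_mem hE s
  choose y hy using K.exists_enum
  obtain ⟨S, hS, hcard⟩ := K.infinite_Reg.exists_subset_card_eq (∑ l : Fin K.N, D l + 1)
  let Φ : growthSpace E s →ₗ[ℂ] (S × Fin K.N → ℂ) :=
    { toFun := fun h p => h.1 p.1 (y p.1 p.2)
      map_add' := fun _ _ => rfl
      map_smul' := fun _ _ => rfl }
  refine FiniteDimensional.of_injective Φ ?_
  rw [injective_iff_map_eq_zero]
  intro h hh
  have h0 : ∀ x ∈ S, ∀ i, h.1 x (y x i) = 0 := fun x hx i => congrFun hh (⟨x, hx⟩, i)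
  have htr : ∀ l : Fin K.N, ∀ x ∈ K.Reg, K.trace (fun x y => h.1 x y * y ^ (l : ℕ)) x = 0 := by
    intro l x hx
    obtain ⟨q, hq, hqx⟩ := hD l h.1 h.2
    rw [hqx x hx]
    have : q = 0 := by
      refine eq_zero_of_natDegree_lt_card_of_eval_eq_zero' q S (fun t ht => ?_) ?_
      · rw [← hqx t (hS ht), (hy t).trace_eq]
        exact Finset.sum_eq_zero fun i _ => by simp only [h0 t ht i, zero_mul]
      · rw [hcard, Nat.lt_succ_iff]
        exact hq.trans (Finset.single_le_sum (f := fun l : Fin K.N => D l) (fun _ _ => Nat.zero_le _)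
          (Finset.mem_univ l))
    rw [this, eval_zero]
  ext u v
  by_cases huv : u ∈ K.Reg ∧ K.P.evalEval u v = 0
  · obtain ⟨i, rfl⟩ := (hy u).exists_eq huv.2
    have h1 := Matrix.eq_zero_of_forall_pow_sum_mul_pow_eq_zero (f := y u)
      (v := fun i => h.1 u (y u i)) ((hy u).injective huv.1) fun l => by
        rw [← htr l u huv.1, (hy u).trace_eq]
    exact congrFun h1 i
  · exact h.2.1 u v huv

section Operator

variable {η : ℂ → ℂ → ℂ} {s : ℕ}

/-- The operator `h ↦ η ∂P/∂y dh/dx`. -/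
theorem exists_operator (hη : K.HasZDeriv η fun x y => 1 / K.P.derivative.evalEval x y)
    (hO : ∀ h w, K.HasZDeriv h w →
      (∀ i, (fun z => h (E.X z) (E.Y i z)) =O[atImInf] fun z => E.X z ^ s) →
      ∀ i, (fun z => η (E.X z) (E.Y i z) * K.P.derivative.evalEval (E.X z) (E.Y i z) *
        w (E.X z) (E.Y i z)) =O[atImInf] fun z => E.X z ^ s) :
    ∃ T : growthSpace E s →ₗ[ℂ] growthSpace E s, ∀ h, ∃ w, K.HasZDeriv h.1 w ∧ K.HolZ w ∧
      (T h).1 = K.restr fun x y => η x y * K.P.derivative.evalEval x y * w x y := by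
  choose w hw hhol using fun h : growthSpace E s => h.2.2.1.exists_hasZDeriv
  have key : ∀ h k l : growthSpace E s, ∀ w', K.HasZDeriv l.1 w' → ∀ c c' : ℂ,
      (∀ x y, w' x y = c * w h x y + c' * w k x y) →
      (K.restr fun x y => η x y * K.P.derivative.evalEval x y * w l x y) =
      c • (K.restr fun x y => η x y * K.P.derivative.evalEval x y * w h x y) +
      c' • (K.restr fun x y => η x y * K.P.derivative.evalEval x y * w k x y) := by
    intro h k l w' hw' c c' hcc
    ext x y
    by_cases hxy : x ∈ K.Reg ∧ K.P.evalEval x y = 0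
    · simp only [Pi.add_apply, Pi.smul_apply, smul_eq_mul, restr_of_mem _ hxy.1 hxy.2,
        (hw l).eq hw' hxy.1 hxy.2, hcc]
      ring
    · simp [restr_of_not _ hxy]
  refine ⟨{ toFun := fun h => ⟨K.restr fun x y => η x y * K.P.derivative.evalEval x y * w h x y,
        fun x y => restr_of_not _,
        ((hη.holZ.mul (holZ_evalEval _)).mul (hhol h)).restr, fun b F hF i => ?_, fun i =>
        (E.restr_eventuallyEq _ i).trans_isBigO (hO _ _ (hw h) h.2.2.2.2 i)⟩
            map_add' := fun h k => Subtype.ext ?_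
            map_smul' := fun c h => Subtype.ext ?_ }, fun h => ⟨w h, hw h, hhol h, rfl⟩⟩
  · obtain ⟨L, hL, -⟩ := F.exists_limit hF.map_eq
    exact (F.restr_eventuallyEq _ i).trans_isBigO (End.isBigO_and_tendsto_at hF.map_eq hF.X'_eq
      hF.X_eq hη (hw h) (hL i) (h.2.2.2.1 b F hF i)).1
  · have := key h k (h + k) (fun x y => w h x y + w k x y)
      (fun x₀ Y hY => (hw h x₀ Y hY).fun_add (hw k x₀ Y hY)) 1 1 (fun x y => by ring)
    simpa using this
  · have := key h h (c • h) (fun x y => c * w h x y)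
      (fun x₀ Y hY => (hw h x₀ Y hY).const_mul c) c 0 (fun x y => by ring)
    simpa using this

theorem eq_zero_of_mul_eq_zero (hη : K.HasZDeriv η fun x y => 1 / K.P.derivative.evalEval x y)
    {w : ℂ → ℂ → ℂ} (hw : K.HolZ w)
    (h : ∀ x ∈ K.Reg, ∀ y, K.P.evalEval x y = 0 → η x y * w x y = 0) {x₀ : ℂ} {Y : ℂ → ℂ}
    (hY : K.IsSection Y x₀) : w x₀ (Y x₀) = 0 := by
  have h1 : ∀ᶠ x in 𝓝[≠] x₀, η x (Y x) ≠ 0 := (hη x₀ Y hY).eventually_ne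
    (one_div_ne_zero (K.derivative_ne hY.reg hY.root_self))
  have h2 : ∀ᶠ x in 𝓝[≠] x₀, w x (Y x) = 0 := by
    filter_upwards [h1, hY.eventually.filter_mono nhdsWithin_le_nhds] with x a1 a2
    exact (mul_eq_zero.mp (h x a2.2.reg _ a2.2.root_self)).resolve_left a1
  exact tendsto_nhds_unique_of_eventuallyEq
    ((hw x₀ Y hY).continuousAt.tendsto.mono_left nhdsWithin_le_nhds) tendsto_const_nhds h2

end Operator

/-- A contractible curve has at most one singular point. -/
theorem eq_of_singular [ContractibleSpace K.Pt] {p₁ p₂ : ℂ × ℂ}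
    (h : ∀ p ∈ ({p₁, p₂} : Set (ℂ × ℂ)), K.P.evalEval p.1 p.2 = 0 ∧
      K.P.derivative.evalEval p.1 p.2 = 0 ∧ deriv (fun x => K.P.evalEval x p.2) p.1 = 0) :
    p₁ = p₂ := by
  by_contra hne
  obtain ⟨g, hg⟩ : ∃ g : ℂ[X][X], g.evalEval p₁.1 p₁.2 ≠ g.evalEval p₂.1 p₂.2 := by
    by_cases h1 : p₁.1 = p₂.1
    · exact ⟨X, by simpa using fun h2 => hne (Prod.ext h1 h2)⟩
    · exact ⟨C X, by simpa [evalEval_C] using h1⟩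
  obtain ⟨E, hXq, hX', hE⟩ := K.exists_End_infty
  obtain ⟨η₀, hη₀⟩ := K.exists_primitive 1
  simp only [evalEval_one] at hη₀
  obtain ⟨e, he⟩ := End.exists_forall_isBigO_infty hE hXq hX' hη₀
  obtain ⟨η, hη⟩ : ∃ η : ℂ → ℂ → ℂ, η = fun x y => η₀ x y - e := ⟨_, rfl⟩
  have hηd : K.HasZDeriv η fun x y => 1 / K.P.derivative.evalEval x y := fun x₀ Y hY => by
    rw [hη]
    exact (hη₀ x₀ Y hY).sub_const e
  obtain ⟨s₁, hs₁⟩ := exists_restr_mem_growthSpace hE 1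
  obtain ⟨s₂, hs₂⟩ := exists_restr_mem_growthSpace hE g
  obtain ⟨s, h1s, h2s⟩ : ∃ s, s₁ ≤ s ∧ s₂ ≤ s := ⟨max s₁ s₂, le_max_left _ _, le_max_right _ _⟩
  have : FiniteDimensional ℂ (growthSpace E s) := finiteDimensional_growthSpace hE s
  obtain ⟨T, hT⟩ := exists_operator (E := E) (s := s) hηd fun h w hw hh i => by
    rw [hη]
    exact he h w s hw hh i
  let u : growthSpace E s := ⟨_, hs₁ s h1s⟩
  let v : growthSpace E s := ⟨_, hs₂ s h2s⟩
  have hker : LinearMap.ker T ≤ ℂ ∙ u := by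
    intro f hf
    rw [Submodule.mem_span_singleton]
    obtain ⟨w, hw, hhol, hTw⟩ := hT f
    rw [LinearMap.mem_ker.mp hf] at hTw
    have hw0 : K.HasZDeriv f.1 fun _ _ => 0 := fun x₀ Y hY => by
      refine (hw x₀ Y hY).congr_deriv (eq_zero_of_mul_eq_zero hηd hhol (fun x hx y hy => ?_) hY)
      have h1 := congrFun (congrFun hTw x) y
      rw [restr_of_mem _ hx hy] at h1
      have h2 : (0 : ℂ) = η x y * K.P.derivative.evalEval x y * w x y := h1
      refine (mul_eq_zero.mp ?_).resolve_left (K.derivative_ne hx hy)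
      rw [h2]
      ring
    by_cases hf0 : f = 0
    · exact ⟨0, by rw [hf0, zero_smul]⟩
    · obtain ⟨x, y, hxy⟩ : ∃ x y, f.1 x y ≠ 0 := by
        by_contra! h0
        exact hf0 (Subtype.ext (funext fun x => funext fun y => h0 x y))
      have hmem : x ∈ K.Reg ∧ K.P.evalEval x y = 0 := by
        by_contra h0
        exact hxy (f.2.1 x y h0)
      refine ⟨f.1 x y, Subtype.ext (funext fun x' => funext fun y' => ?_)⟩
      change f.1 x y * K.restr (fun x y => (1 : ℂ[X][X]).evalEval x y) x' y' = f.1 x' y'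
      by_cases hmem' : x' ∈ K.Reg ∧ K.P.evalEval x' y' = 0
      · rw [restr_of_mem _ hmem'.1 hmem'.2, evalEval_one, mul_one]
        exact hw0.locConst.eq hmem.1 hmem.2 hmem'.1 hmem'.2
      · rw [restr_of_not _ hmem', mul_zero, f.2.1 x' y' hmem']
  have hran : ∀ a c : ℂ, a • u + c • v ∈ LinearMap.range T →
      ∀ p ∈ ({p₁, p₂} : Set (ℂ × ℂ)), a + c * g.evalEval p.1 p.2 = 0 := by
    rintro a c ⟨f, hf⟩ p hp
    obtain ⟨h0, hy, hx⟩ := h p hp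
    obtain ⟨w, hw, -, hTw⟩ := hT f
    obtain ⟨F, hF⟩ := exists_isAt (K := K) p.1
    obtain ⟨L, hL, hLe, -⟩ := F.exists_limit hF.map_eq
    obtain ⟨i, hi⟩ := hLe.exists_eq h0
    have hYi := hL i
    rw [hi] at hYi
    have h1 := (End.isBigO_and_tendsto_at hF.map_eq hF.X'_eq hF.X_eq hηd hw hYi
      (f.2.2.2.1 _ F hF i)).2 hy hx
    have h2 : Tendsto (fun z => a + c * g.evalEval (F.X z) (F.Y i z)) atImInf
        (𝓝 (a + c * g.evalEval p.1 p.2)) :=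
      (((continuous_evalEval g).tendsto p).comp
        ((End.tendsto_X hF.map_eq).prodMk_nhds hYi) |>.const_mul c).const_add a
    refine tendsto_nhds_unique_of_eventuallyEq h2 h1 ?_
    filter_upwards [upper_mem_atImInf F.A] with z hz
    have h3 := congrFun (congrFun (hTw.symm.trans (congrArg Subtype.val hf)) (F.X z)) (F.Y i z)
    change _ = a * K.restr _ _ _ + c * K.restr _ _ _ at h3
    rw [restr_of_mem _ (F.reg z hz) (F.root i hz), restr_of_mem _ (F.reg z hz) (F.root i hz),
      restr_of_mem _ (F.reg z hz) (F.root i hz), evalEval_one, mul_one] at h3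
    exact h3.symm
  have hran' : ∀ a c : ℂ, a • u + c • v ∈ LinearMap.range T → a = 0 ∧ c = 0 := by
    intro a c hac
    have h1 := hran a c hac p₁ (by simp)
    have h2 := hran a c hac p₂ (by simp)
    have h3 : c = 0 := by
      refine (mul_eq_zero.mp ?_).resolve_right (sub_ne_zero.mpr hg)
      linear_combination h1 - h2
    rw [h3, zero_mul, add_zero] at h1
    exact ⟨h1, h3⟩
  have hli : LinearIndependent ℂ ![u, v] := LinearIndependent.pair_iff.mpr fun a c hac =>
    hran' a c (hac ▸ zero_mem _)
  have hdisj : Disjoint (LinearMap.range T) (Submodule.span ℂ (Set.range ![u, v])) := by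
    rw [Submodule.disjoint_def]
    intro x hx hx'
    rw [Matrix.range_cons, Matrix.range_cons, Matrix.range_empty, Set.union_empty,
      Set.singleton_union, Submodule.mem_span_pair] at hx'
    obtain ⟨a, c, rfl⟩ := hx'
    obtain ⟨rfl, rfl⟩ := hran' a c hx
    simp
  have h1 := Submodule.finrank_add_finrank_le_of_disjoint hdisj
  rw [finrank_span_eq_card hli, Fintype.card_fin, ← LinearMap.finrank_range_add_finrank_ker T] at h1
  have h2 : Module.finrank ℂ (LinearMap.ker T) ≤ 1 :=
    (Submodule.finrank_mono hker).trans (finrank_span_singleton (hli.ne_zero 0)).le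
  lia

end PlaneCurve

theorem MvPolynomial.hasDerivAt_eval (f : MvPolynomial (Fin 2) ℂ) {u v : ℂ → ℂ} {u' v' t : ℂ}
    (hu : HasDerivAt u u' t) (hv : HasDerivAt v v' t) :
    HasDerivAt (fun t => MvPolynomial.eval ![u t, v t] f)
      (MvPolynomial.eval ![u t, v t] (MvPolynomial.pderiv 0 f) * u' +
        MvPolynomial.eval ![u t, v t] (MvPolynomial.pderiv 1 f) * v') t := by
  induction f using MvPolynomial.induction_on with
  | C a => simpa using hasDerivAt_const t a
  | add p q hp hq =>
    simp only [map_add]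
    exact (hp.fun_add hq).congr_deriv (by ring)
  | mul_X p i hp =>
    have hX : HasDerivAt (fun t => ![u t, v t] i) (![u', v'] i) t := by
      fin_cases i
      · exact hu
      · exact hv
    simp only [map_mul, MvPolynomial.eval_X, Derivation.leibniz, MvPolynomial.pderiv_X, map_add,
      smul_eq_mul]
    refine (hp.fun_mul hX).congr_deriv ?_
    fin_cases i <;> simp <;> ring

/-- The polynomial `f(x + y ^ r, y)`. -/
noncomputable def shearEquiv (r : ℕ) : MvPolynomial (Fin 2) ℂ ≃ₐ[ℂ] ℂ[X][X] :=
  .ofAlgHom (MvPolynomial.aeval ![C X + X ^ r, X])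
    (aevalAeval (MvPolynomial.X 0 - MvPolynomial.X 1 ^ r) (MvPolynomial.X 1))
    (by ext <;> simp) (by ext i; fin_cases i <;> simp)

theorem shearEquiv_apply (r : ℕ) (f : MvPolynomial (Fin 2) ℂ) :
    shearEquiv r f = MvPolynomial.aeval ![C X + X ^ r, X] f := rfl

theorem evalEval_shearEquiv (r : ℕ) (f : MvPolynomial (Fin 2) ℂ) (x y : ℂ) :
    (shearEquiv r f).evalEval x y = MvPolynomial.eval ![x + y ^ r, y] f := by
  rw [shearEquiv_apply]
  induction f using MvPolynomial.induction_on with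
  | C a => simp [Polynomial.algebraMap_apply, evalEval_C]
  | add p q hp hq => simp only [map_add, evalEval_add, hp, hq]
  | mul_X p i hp =>
    simp only [map_mul, evalEval_mul, hp, MvPolynomial.aeval_X, MvPolynomial.eval_X]
    fin_cases i <;> simp [evalEval_C]

theorem exists_shearEquiv_leadingCoeff {f : MvPolynomial (Fin 2) ℂ} (hf : f ≠ 0) :
    ∃ r : ℕ, ∃ a : ℂ, a ≠ 0 ∧ (shearEquiv r f).leadingCoeff = C a := by
  obtain ⟨r, hr⟩ : ∃ r : ℕ, ∀ m ∈ f.support, m 1 < r :=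
    ⟨f.support.sup (fun m => m 1) + 1, fun m hm =>
      Nat.lt_succ_of_le (Finset.le_sup (f := fun m : Fin 2 →₀ ℕ => m 1) hm)⟩
  obtain ⟨m, hm, hmax⟩ := f.support.exists_max_image (fun m => r * m 0 + m 1)
    (MvPolynomial.support_nonempty.mpr hf)
  have hlt : ∀ n ∈ f.support, n ≠ m → r * n 0 + n 1 < r * m 0 + m 1 := by
    intro n hn hne
    refine lt_of_le_of_ne (hmax n hn) fun h => hne ?_
    have h1 := hr n hn
    have h2 := hr m hm
    have h3 : n 0 = m 0 := by
      have := congrArg (· / r) h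
      simpa [Nat.mul_add_div (by lia : 0 < r), Nat.div_eq_of_lt h1, Nat.div_eq_of_lt h2] using this
    ext i
    fin_cases i
    · exact h3
    · rw [h3] at h
      exact Nat.add_left_cancel h
  have h0 : 0 < r := by have := hr m hm; lia
  have hmon : ∀ n : Fin 2 →₀ ℕ, ((C X + X ^ r : ℂ[X][X]) ^ n 0 * X ^ n 1).Monic ∧
      ((C X + X ^ r : ℂ[X][X]) ^ n 0 * X ^ n 1).natDegree = r * n 0 + n 1 := by
    intro n
    have h1 : (X ^ r + C X : ℂ[X][X]).Monic := monic_X_pow_add_C _ h0.ne'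
    rw [add_comm (C X)]
    refine ⟨(h1.pow _).mul (monic_X_pow _), ?_⟩
    rw [(h1.pow _).natDegree_mul (monic_X_pow _), h1.natDegree_pow, natDegree_X_pow_add_C,
      natDegree_X_pow, mul_comm]
  have hsum : shearEquiv r f = ∑ n ∈ f.support,
      C (C (f.coeff n)) * ((C X + X ^ r) ^ n 0 * X ^ n 1) := by
    rw [shearEquiv_apply, MvPolynomial.aeval_def, MvPolynomial.eval₂_eq']
    refine Finset.sum_congr rfl fun n _ => ?_
    rw [Fin.prod_univ_two]
    rfl
  have ha : f.coeff m ≠ 0 := MvPolynomial.mem_support_iff.mp hm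
  have hcoeff : (shearEquiv r f).coeff (r * m 0 + m 1) = C (f.coeff m) := by
    rw [hsum, finsetSum_coeff, Finset.sum_eq_single_of_mem m hm]
    · rw [coeff_C_mul, ← (hmon m).2, (hmon m).1.coeff_natDegree, mul_one]
    · intro n hn hne
      rw [coeff_C_mul, coeff_eq_zero_of_natDegree_lt, mul_zero]
      rw [(hmon n).2]
      exact hlt n hn hne
  have hdeg : (shearEquiv r f).natDegree = r * m 0 + m 1 := by
    refine natDegree_eq_of_le_of_coeff_ne_zero ?_ (by rw [hcoeff]; exact C_ne_zero.mpr ha)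
    rw [hsum]
    refine natDegree_sum_le_of_forall_le _ _ fun n hn => ?_
    exact (natDegree_C_mul_le _ _).trans ((hmon n).2.trans_le (hmax n hn))
  exact ⟨r, f.coeff m, ha, by rw [leadingCoeff, hdeg, hcoeff]⟩

theorem exists_bezout {P : ℂ[X][X]} (hP : P.Monic) (hirr : Irreducible P) :
    ∃ d : ℂ[X], d ≠ 0 ∧ ∃ a b : ℂ[X][X], a * P + b * P.derivative = C d := by
  have h1 := (hP.irreducible_iff_irreducible_map_fraction_map (K := FractionRing ℂ[X])).mp hirr
  obtain ⟨u, v, huv⟩ := h1.separable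
  obtain ⟨s, hs, hu⟩ := IsLocalization.integerNormalization_spec (nonZeroDivisors ℂ[X]) u
  obtain ⟨t, ht, hv⟩ := IsLocalization.integerNormalization_spec (nonZeroDivisors ℂ[X]) v
  set u' := IsLocalization.integerNormalization (nonZeroDivisors ℂ[X]) u
  set v' := IsLocalization.integerNormalization (nonZeroDivisors ℂ[X]) v
  refine ⟨s * t, nonZeroDivisors.ne_zero (mul_mem hs ht), C t * u', C s * v', ?_⟩
  refine map_injective (algebraMap ℂ[X] (FractionRing ℂ[X])) (IsFractionRing.injective _ _) ?_
  rw [algebra_compatible_smul (FractionRing ℂ[X]), smul_eq_C_mul] at hu hv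
  simp only [Polynomial.map_add, Polynomial.map_mul, map_C, hu, hv, map_mul]
  rw [derivative_map] at huv
  linear_combination C (algebraMap ℂ[X] (FractionRing ℂ[X]) s) *
    C (algebraMap ℂ[X] (FractionRing ℂ[X]) t) * huv

/-- The polynomial automorphism `(x, y) ↦ (x + y ^ r, y)` of the plane. -/
def shearHomeomorph (r : ℕ) : ℂ × ℂ ≃ₜ ℂ × ℂ where
  toFun p := (p.1 + p.2 ^ r, p.2)
  invFun p := (p.1 - p.2 ^ r, p.2)
  left_inv p := by simp
  right_inv p := by simp
  continuous_toFun := by fun_prop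
  continuous_invFun := by fun_prop

/-- The singular points of a contractible irreducible curve coincide. -/
theorem subsingleton_singular_of_contractible
    (f : MvPolynomial (Fin 2) ℂ) (hf : Irreducible f)
    (hcontr : ContractibleSpace {p : ℂ × ℂ // MvPolynomial.eval ![p.1, p.2] f = 0}) :
    {p : ℂ × ℂ | MvPolynomial.eval ![p.1, p.2] f = 0 ∧
      MvPolynomial.eval ![p.1, p.2] (MvPolynomial.pderiv 0 f) = 0 ∧
      MvPolynomial.eval ![p.1, p.2] (MvPolynomial.pderiv 1 f) = 0}.Subsingleton := by
  obtain ⟨r, a, ha, hlead⟩ := exists_shearEquiv_leadingCoeff hf.ne_zero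
  obtain ⟨P, hP⟩ : ∃ P, P = C (C a⁻¹) * shearEquiv r f := ⟨_, rfl⟩
  have hev : ∀ x y, P.evalEval x y = a⁻¹ * MvPolynomial.eval ![x + y ^ r, y] f := fun x y => by
    rw [hP, evalEval_mul, evalEval_shearEquiv, evalEval_C, eval_C]
  have hmonic : P.Monic := by
    rw [Monic, hP, leadingCoeff_mul, hlead, leadingCoeff_C, ← C_mul, inv_mul_cancel₀ ha,
      C_1]
  have hunit : IsUnit (C (C a⁻¹) : ℂ[X][X]) :=
    ((IsUnit.mk0 _ (inv_ne_zero ha)).map C).map C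
  have hirr : Irreducible P := by
    rw [hP, irreducible_isUnit_mul hunit]
    exact (MulEquiv.irreducible_iff (shearEquiv r)).mpr hf
  obtain ⟨d, hd, u, v, huv⟩ := exists_bezout hmonic hirr
  let K : PlaneCurve := ⟨P, hmonic, hirr, d, hd, u, v, huv⟩
  have : ContractibleSpace K.Pt := by
    refine Homeomorph.contractibleSpace ((shearHomeomorph r).subtype (q := fun p =>
      MvPolynomial.eval ![p.1, p.2] f = 0) fun p => ?_)
    change P.evalEval p.1 p.2 = 0 ↔ MvPolynomial.eval ![p.1 + p.2 ^ r, p.2] f = 0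
    rw [hev, mul_eq_zero, or_iff_right (inv_ne_zero ha)]
  have key : ∀ p ∈ {p : ℂ × ℂ | MvPolynomial.eval ![p.1, p.2] f = 0 ∧
      MvPolynomial.eval ![p.1, p.2] (MvPolynomial.pderiv 0 f) = 0 ∧
      MvPolynomial.eval ![p.1, p.2] (MvPolynomial.pderiv 1 f) = 0},
      P.evalEval (p.1 - p.2 ^ r) p.2 = 0 ∧ P.derivative.evalEval (p.1 - p.2 ^ r) p.2 = 0 ∧
      deriv (fun x => P.evalEval x p.2) (p.1 - p.2 ^ r) = 0 := by
    rintro ⟨x, y⟩ ⟨h0, h1, h2⟩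
    refine ⟨by rw [hev, sub_add_cancel, h0, mul_zero], ?_, ?_⟩
    · refine (hasDerivAt_evalEval_right P _ _).unique ?_
      simp only [hev]
      refine ((f.hasDerivAt_eval (((hasDerivAt_id y).fun_pow r).const_add (x - y ^ r))
        (hasDerivAt_id y)).const_mul a⁻¹).congr_deriv ?_
      simp only [id, sub_add_cancel, h1, h2]
      ring
    · simp only [hev]
      refine (((f.hasDerivAt_eval ((hasDerivAt_id (x - y ^ r)).add_const (y ^ r))
        (hasDerivAt_const _ y)).const_mul a⁻¹).congr_deriv ?_).deriv
      simp only [id, sub_add_cancel, h1, h2]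
      ring
  intro p hp q hq
  have h := eq_of_singular (K := K) (p₁ := (p.1 - p.2 ^ r, p.2)) (p₂ := (q.1 - q.2 ^ r, q.2)) (by
    rintro _ (rfl | rfl)
    · exact key p hp
    · exact key q hq)
  exact (shearHomeomorph r).symm.injective h

end

open MvPolynomial

/-- **Intermediate claim in the proof of Theorem A.**
A contractible irreducible algebraic curve `Z(f) ⊆ ℂ²` has at most one singular
point: the set of points where `f`, `∂f/∂X` and `∂f/∂Y` vanish simultaneously
contains at most one element. -/
theorem contractible_curve_at_most_one_singular_point
    (f : MvPolynomial (Fin 2) ℂ) (hf : Irreducible f)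
    (hcontr : ContractibleSpace {p : ℂ × ℂ // MvPolynomial.eval ![p.1, p.2] f = 0}) :
    {p : ℂ × ℂ |
      MvPolynomial.eval ![p.1, p.2] f = 0 ∧
      MvPolynomial.eval ![p.1, p.2] (pderiv 0 f) = 0 ∧
      MvPolynomial.eval ![p.1, p.2] (pderiv 1 f) = 0}.Subsingleton :=
  subsingleton_singular_of_contractible f hf hcontr
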